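/- There exists a constant C₀ > 0 depending only on n, λ, Λ such that for every M > 0, every u ∈ P₁⁺(z,M) with z ∈ Γ(u) ∩ B(0,1/2), and every j ∈ ℕ satisfying V_{2^{−j}}(z,u) ≤ C₀, one has S_{j+1}(z,u) ≤ max{ 2⁻² S_j(z,u), C₀ M 2^{−2j} }, where S_j(z,u) = sup_{B⁺(z,2^{−j})} |u|. (Lemma 2.1: dyadic decay.) -/

import Mathlib

open Metric Set MeasureTheory Filter

noncomputable section

attribute [local instance] Matrix.normedAddCommGroup Matrix.normedSpace

/-- Euclidean space ℝⁿ. -/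
abbrev En (n : ℕ) := EuclideanSpace ℝ (Fin n)

/-- The open half-space `{x : x₁ > 0}`. -/
def HplusSet (n : ℕ) [NeZero n] : Set (En n) := {x | 0 < x 0}

/-- The closed half-space `{x : x₁ ≥ 0}`. -/
def HcloSet (n : ℕ) [NeZero n] : Set (En n) := {x | 0 ≤ x 0}

/-- The hyperplane `Π = {x : x₁ = 0}`. -/
def PiSet (n : ℕ) [NeZero n] : Set (En n) := {x | x 0 = 0}

/-- The half-ball `B⁺(z,r)`. -/
def Bplus (n : ℕ) [NeZero n] (z : En n) (r : ℝ) : Set (En n) := HplusSet n ∩ ball z r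

/-- Operator norm of a matrix acting on Euclidean space. -/
def matOpNorm {n : ℕ} (N : Matrix (Fin n) (Fin n) ℝ) : ℝ :=
  ‖(Matrix.toEuclideanCLM (𝕜 := ℝ) N : EuclideanSpace ℝ (Fin n) →L[ℝ] EuclideanSpace ℝ (Fin n))‖

/-- The structural assumptions on the fully nonlinear operator `F`:
uniform ellipticity with constants `0 < lam ≤ Lam`, positive one-homogeneity,
convexity (on symmetric matrices) and `C¹` smoothness. -/
structure EllipticF (n : ℕ) (lam Lam : ℝ) (F : Matrix (Fin n) (Fin n) ℝ → ℝ) : Prop where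
  lam_pos : 0 < lam
  lam_le_Lam : lam ≤ Lam
  elliptic_lower : ∀ A N : Matrix (Fin n) (Fin n) ℝ, A.IsSymm → N.PosSemidef →
    lam * matOpNorm N ≤ F (A + N) - F A
  elliptic_upper : ∀ A N : Matrix (Fin n) (Fin n) ℝ, A.IsSymm → N.PosSemidef →
    F (A + N) - F A ≤ Lam * matOpNorm N
  homogeneous : ∀ (t : ℝ) (A : Matrix (Fin n) (Fin n) ℝ), F (t • A) = t * F A
  convexF : ConvexOn ℝ {A : Matrix (Fin n) (Fin n) ℝ | A.IsSymm} F
  smoothF : ContDiff ℝ 1 F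

/-- The quadratic polynomial `x ↦ c + b·x + ½ xᵀAx`. -/
def quadPoly {n : ℕ} (c : ℝ) (b : En n) (A : Matrix (Fin n) (Fin n) ℝ) (x : En n) : ℝ :=
  c + ∑ i, b i * x i + (1 / 2) * ∑ i, ∑ j, A i j * x i * x j

/-- `u` is a viscosity solution of `F(D²u) = g` in the open set `D`. -/
def ViscositySol {n : ℕ} (F : Matrix (Fin n) (Fin n) ℝ → ℝ) (g : En n → ℝ) (D : Set (En n))
    (u : En n → ℝ) : Prop :=
  ∀ x₀ ∈ D,
    (∀ (c : ℝ) (b : En n) (A : Matrix (Fin n) (Fin n) ℝ), A.IsSymm →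
      IsLocalMaxOn (fun x => u x - quadPoly c b A x) D x₀ → g x₀ ≤ F A) ∧
    (∀ (c : ℝ) (b : En n) (A : Matrix (Fin n) (Fin n) ℝ), A.IsSymm →
      IsLocalMinOn (fun x => u x - quadPoly c b A x) D x₀ → F A ≤ g x₀)

/-- Membership in the class `P_r⁺(z,M)` of local solutions, with associated open set `Ω`. -/
structure MemPplus {n : ℕ} [NeZero n] (F : Matrix (Fin n) (Fin n) ℝ → ℝ) (z : En n) (r M : ℝ)
    (u : En n → ℝ) (Ω : Set (En n)) : Prop where
  cont : ContinuousOn u (closure (Bplus n z r))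
  Ω_open : IsOpen Ω
  Ω_sub : Ω ⊆ HplusSet n
  sol : ViscositySol F (Ω.indicator fun _ => (1 : ℝ)) (Bplus n z r) u
  vanish : ∀ x ∈ Bplus n z r \ Ω, u x = 0 ∧ HasGradientAt u 0 x
  bdd : ∀ x ∈ Bplus n z r, |u x| ≤ M
  bdry_zero : ∀ x ∈ PiSet n ∩ ball (0 : En n) 1, u x = 0
  z_bdry : z ∈ frontier Ω

/-- Membership in the class `P_∞⁺(0,M)` of global solutions, with associated open set `Ω`. -/
structure MemPinf {n : ℕ} [NeZero n] (F : Matrix (Fin n) (Fin n) ℝ → ℝ) (M : ℝ)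
    (u : En n → ℝ) (Ω : Set (En n)) : Prop where
  cont : ContinuousOn u (HcloSet n)
  Ω_open : IsOpen Ω
  Ω_sub : Ω ⊆ HplusSet n
  sol : ViscositySol F (Ω.indicator fun _ => (1 : ℝ)) (HplusSet n) u
  vanish : ∀ x ∈ HplusSet n \ Ω, u x = 0 ∧ HasGradientAt u 0 x
  growth : ∀ x, |u x| ≤ M * (‖x‖ ^ 2 + 1)
  bdry_zero : ∀ x ∈ PiSet n, u x = 0
  zero_bdry : (0 : En n) ∈ frontier Ω

/-- The density `V_r(z,u) = vol(Ω⁻(u) ∩ B⁺(z,r)) / rⁿ`. -/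
def Vr {n : ℕ} [NeZero n] (u : En n → ℝ) (Ω : Set (En n)) (z : En n) (r : ℝ) : ℝ :=
  (volume ({x ∈ Ω | u x < 0} ∩ Bplus n z r)).toReal / r ^ n

/-- A modulus of continuity: nonnegative, nondecreasing on `(0,∞)` and tending to `0` at `0⁺`. -/
def IsModulus (σ : ℝ → ℝ) : Prop :=
  (∀ r : ℝ, 0 < r → 0 ≤ σ r) ∧ (∀ ⦃r s : ℝ⦄, 0 < r → r ≤ s → σ r ≤ σ s) ∧
    Tendsto σ (nhdsWithin 0 (Ioi 0)) (nhds 0)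

/-- The dyadic supremum `S_j(z,u) = sup_{B⁺(z,2^{-j})} |u|`. -/
def Sdyadic (n : ℕ) [NeZero n] (u : En n → ℝ) (z : En n) (j : ℕ) : ℝ :=
  sSup ((fun x => |u x|) '' Bplus n z ((2 : ℝ) ^ (-(j : ℤ))))

namespace DD
set_option linter.all false

section

open scoped Topology

abbrev Mat (n : ℕ) := Matrix (Fin n) (Fin n) ℝ

variable {n : ℕ}

def qf (A : Mat n) (v : En n) : ℝ := ∑ i, ∑ j, A i j * v i * v j

def LB (B A : Mat n) : ℝ := ∑ i, ∑ j, B i j * A i j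

structure Ell (lam Lam : ℝ) (B : Mat n) : Prop where
  lam_pos : 0 < lam
  lam_le : lam ≤ Lam
  symm : ∀ i j, B i j = B j i
  lower : ∀ v, lam * ‖v‖ ^ 2 ≤ qf B v
  upper : ∀ v, qf B v ≤ Lam * ‖v‖ ^ 2

def UJ (w : En n → ℝ) (x b : En n) (A : Mat n) : Prop :=
  ∀ ε > 0, ∀ᶠ y in 𝓝 x, w y - w x ≤ inner ℝ b (y - x) + qf A (y - x) / 2 + ε * ‖y - x‖ ^ 2

def Sub (B : Mat n) (w f : En n → ℝ) (D : Set (En n)) : Prop :=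
  ∀ x ∈ D, ∀ b A, A.IsSymm → UJ w x b A → f x ≤ LB B A

lemma inner_eq (b v : En n) : inner ℝ b v = ∑ i, b i * v i := by
  simp [PiLp.inner_apply, mul_comm]

lemma abs_coord (v : En n) (i : Fin n) : |v i| ≤ ‖v‖ := by
  simpa using PiLp.norm_apply_le v i

lemma qf_add (A C : Mat n) (v : En n) : qf (A + C) v = qf A v + qf C v := by
  simp [qf, add_mul, Finset.sum_add_distrib]

lemma qf_smul (c : ℝ) (A : Mat n) (v : En n) : qf (c • A) v = c * qf A v := by
  simp [qf, Finset.mul_sum, mul_assoc]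

lemma qf_neg (A : Mat n) (v : En n) : qf (-A) v = - qf A v := by
  simp [qf]

lemma qf_zero (v : En n) : qf (0 : Mat n) v = 0 := by simp [qf]

lemma qf_vsmul (c : ℝ) (A : Mat n) (v : En n) : qf A (c • v) = c ^ 2 * qf A v := by
  simp only [qf, Finset.mul_sum]
  refine Finset.sum_congr rfl fun i _ => Finset.sum_congr rfl fun j _ => ?_
  simp; ring

lemma qf_vneg (A : Mat n) (v : En n) : qf A (-v) = qf A v := by
  simp [qf]

lemma qf_one (v : En n) : qf (1 : Mat n) v = ‖v‖ ^ 2 := by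
  rw [EuclideanSpace.norm_sq_eq]
  simp [qf, Matrix.one_apply, sq]

lemma qf_bound (A : Mat n) (c : ℝ) (hA : ∀ i j, |A i j| ≤ c) (v : En n) :
    |qf A v| ≤ n ^ 2 * c * ‖v‖ ^ 2 := by
  unfold qf
  calc _ ≤ ∑ i, ∑ j, |A i j * v i * v j| :=
        (Finset.abs_sum_le_sum_abs _ _).trans
          (Finset.sum_le_sum fun i _ => Finset.abs_sum_le_sum_abs _ _)
    _ ≤ ∑ i : Fin n, ∑ j : Fin n, c * ‖v‖ ^ 2 := by
        refine Finset.sum_le_sum fun i _ => Finset.sum_le_sum fun j _ => ?_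
        rw [abs_mul, abs_mul, sq, ← mul_assoc]
        have := (abs_nonneg _).trans (hA i j)
        gcongr
        · exact hA i j
        · exact abs_coord v i
        · exact abs_coord v j
    _ = _ := by simp; ring

lemma LB_add (B A C : Mat n) : LB B (A + C) = LB B A + LB B C := by
  simp [LB, mul_add, Finset.sum_add_distrib]

lemma LB_smul (B : Mat n) (c : ℝ) (A : Mat n) : LB B (c • A) = c * LB B A := by
  simp only [LB, Finset.mul_sum]
  refine Finset.sum_congr rfl fun i _ => Finset.sum_congr rfl fun j _ => ?_
  simp; ring

lemma LB_neg (B A : Mat n) : LB B (-A) = - LB B A := by simp [LB]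

lemma LB_zero (B : Mat n) : LB B (0 : Mat n) = 0 := by simp [LB]

lemma qf_single (B : Mat n) (i : Fin n) : qf B (EuclideanSpace.single i 1) = B i i := by
  simp [qf, PiLp.single_apply]

lemma Ell.diag_lower {lam Lam : ℝ} {B : Mat n} (hB : Ell lam Lam B) (i : Fin n) : lam ≤ B i i := by
  have := hB.lower (EuclideanSpace.single i 1)
  rw [qf_single] at this; simpa using this

lemma Ell.diag_upper {lam Lam : ℝ} {B : Mat n} (hB : Ell lam Lam B) (i : Fin n) : B i i ≤ Lam := by
  have := hB.upper (EuclideanSpace.single i 1)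
  rw [qf_single] at this; simpa using this

lemma LB_one (B : Mat n) : LB B 1 = ∑ i, B i i := by
  simp [LB, Matrix.one_apply]

lemma Ell.tr_lower {lam Lam : ℝ} {B : Mat n} (hB : Ell lam Lam B) : n * lam ≤ LB B 1 := by
  rw [LB_one]
  calc _ = ∑ i : Fin n, lam := by simp
    _ ≤ _ := Finset.sum_le_sum fun i _ => hB.diag_lower i

lemma Ell.tr_upper {lam Lam : ℝ} {B : Mat n} (hB : Ell lam Lam B) : LB B 1 ≤ n * Lam := by
  rw [LB_one]
  calc _ ≤ ∑ i : Fin n, Lam := Finset.sum_le_sum fun i _ => hB.diag_upper i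
    _ = _ := by simp

lemma UJ.add {w g : En n → ℝ} {x b b' : En n} {A A' : Mat n} (h : UJ w x b A) (h' : UJ g x b' A') :
    UJ (fun y => w y + g y) x (b + b') (A + A') := by
  intro ε hε
  filter_upwards [h (ε/2) (by positivity), h' (ε/2) (by positivity)] with y h1 h2
  rw [inner_add_left, qf_add]; linarith

lemma UJ.congr {w g : En n → ℝ} {x b : En n} {A : Mat n} (h : UJ w x b A) (hg : w =ᶠ[𝓝 x] g) :
    UJ g x b A := by
  intro ε hε
  filter_upwards [h ε hε, hg] with y h1 h2
  rw [← h2, ← hg.self_of_nhds]; exact h1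

/-- adding a function with (lower) second-order jets to a subsolution -/
lemma Sub.add {B : Mat n} {w f g k : En n → ℝ} {D : Set (En n)} (h : Sub B w f D)
    (hg : ∀ x ∈ D, ∃ b A, Matrix.IsSymm A ∧ k x ≤ LB B A ∧ UJ (fun y => - g y) x (-b) (-A)) :
    Sub B (fun y => w y + g y) (fun y => f y + k y) D := by
  intro x hx b A hA hU
  obtain ⟨b', A', hs, hk, hU'⟩ := hg x hx
  have h2 := hU.add hU'
  have h3 := h x hx (b + -b') (A + -A') (by
    unfold Matrix.IsSymm at *; simp [Matrix.transpose_add, Matrix.transpose_neg, hA, hs])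
    (by simpa using h2)
  rw [LB_add, LB_neg] at h3
  linarith

lemma Sub.mono {B : Mat n} {w f g : En n → ℝ} {D D' : Set (En n)} (h : Sub B w f D)
    (hD : D' ⊆ D) (hfg : ∀ x ∈ D', g x ≤ f x) : Sub B w g D' :=
  fun x hx b A hA hU => (hfg x hx).trans (h x (hD hx) b A hA hU)

lemma norm_sq_expand (x y : En n) : ‖y‖ ^ 2 = ‖x‖ ^ 2 + 2 * inner ℝ x (y - x) + ‖y - x‖ ^ 2 := by
  have := norm_add_sq_real x (y - x)
  simpa using this

lemma one_symm : (1 : Mat n).IsSymm := Matrix.isSymm_one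

/-- jets of `c‖y-p‖²`. -/
lemma UJ_normsq (c : ℝ) (p x : En n) :
    UJ (fun y => c * ‖y - p‖ ^ 2) x ((2 * c) • (x - p)) ((2 * c) • (1 : Mat n)) := by
  intro ε hε
  filter_upwards with y
  have := norm_sq_expand (x - p) (y - p)
  rw [qf_smul, qf_one, inner_smul_left]
  simp only [sub_sub_sub_cancel_right] at this
  rw [this]
  simp
  nlinarith [sq_nonneg ‖y - x‖]

lemma UJ.neg_normsq (c : ℝ) (p x : En n) :
    UJ (fun y => - (c * ‖y - p‖ ^ 2)) x (-((2 * c) • (x - p))) (-((2 * c) • (1 : Mat n))) := by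
  have := UJ_normsq (-c) p x
  simpa [neg_smul] using this

/-- General maximum principle. -/
lemma max_principle_gen {lam Lam : ℝ} {B : Mat n} (hB : Ell lam Lam B) (hn : 0 < n)
    {w : En n → ℝ} {D : Set (En n)} (hD : IsOpen D) (hc : IsCompact (closure D))
    (hw : ContinuousOn w (closure D)) (hsub : Sub B w (fun _ => 0) D) {m : ℝ}
    (hm : ∀ x ∈ closure D, x ∉ D → w x ≤ m) : ∀ x ∈ closure D, w x ≤ m := by
  intro x1 hx1
  by_contra hcon
  push Not at hcon
  obtain ⟨R, hR⟩ := hc.isBounded.exists_norm_le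
  have hR1 : 0 ≤ R := (norm_nonneg _).trans (hR x1 hx1)
  obtain ⟨ε, hε, hε2⟩ : ∃ ε > 0, ε * R ^ 2 < w x1 - m := by
    refine ⟨(w x1 - m) / (2 * (R ^ 2 + 1)), by have := sub_pos.2 hcon; positivity, ?_⟩
    have := sub_pos.2 hcon
    rw [div_mul_eq_mul_div, div_lt_iff₀ (by positivity)]
    nlinarith [sq_nonneg R]
  obtain ⟨x0, hx0, hmax⟩ := hc.exists_isMaxOn ⟨x1, hx1⟩
    (f := fun y => w y + ε * ‖y‖ ^ 2) (by fun_prop)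
  have h10 := hmax hx1
  simp only [mem_setOf_eq] at h10
  have hx0D : x0 ∈ D := by
    by_contra hx0D
    have h1 := hm x0 hx0 hx0D
    have h2 : ‖x0‖ ^ 2 ≤ R ^ 2 := by gcongr; exact hR x0 hx0
    nlinarith [sq_nonneg ‖x1‖]
  have hU : UJ w x0 (-((2 * ε) • (x0 - 0))) (-((2 * ε) • (1 : Mat n))) := by
    intro η hη
    filter_upwards [UJ.neg_normsq ε 0 x0 η hη, hD.mem_nhds hx0D] with y h1 h2
    have h3 := hmax (subset_closure h2)
    simp only [mem_setOf_eq, sub_zero] at h3 h1 ⊢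
    linarith
  have := hsub x0 hx0D _ _ (by
    unfold Matrix.IsSymm; simp [Matrix.transpose_neg, Matrix.transpose_smul]) hU
  rw [LB_neg, LB_smul] at this
  have h2 := hB.tr_lower
  have h3 : 0 < (n : ℝ) * lam := mul_pos (by exact_mod_cast hn) hB.lam_pos
  nlinarith

lemma max_principle {lam Lam : ℝ} {B : Mat n} (hB : Ell lam Lam B) (hn : 0 < n)
    {w : En n → ℝ} {p : En n} {r : ℝ} (hr : 0 < r)
    (hw : ContinuousOn w (closedBall p r)) (hsub : Sub B w (fun _ => 0) (ball p r)) {m : ℝ}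
    (hm : ∀ x ∈ sphere p r, w x ≤ m) : ∀ x ∈ closedBall p r, w x ≤ m := by
  have hcl : closure (ball p r) = closedBall p r := closure_ball p hr.ne'
  have := max_principle_gen hB hn isOpen_ball (by rw [hcl]; exact isCompact_closedBall p r)
    (by rw [hcl]; exact hw) hsub (m := m) (by
      intro x hx hx'
      rw [hcl] at hx
      apply hm
      simp only [mem_closedBall, mem_ball, mem_sphere, not_lt] at *
      linarith)
  rwa [hcl] at this

end

section

open scoped Topology
open MvPolynomial (pderiv)

variable {n : ℕ}

abbrev Pol (n : ℕ) := MvPolynomial (Fin n) ℝ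

def ev (p : Pol n) (x : En n) : ℝ := MvPolynomial.eval (fun i => x i) p

def gr (p : Pol n) (x : En n) : En n := WithLp.toLp 2 fun i => ev (pderiv i p) x

def he (p : Pol n) (x : En n) : Mat n := Matrix.of fun i j => ev (pderiv i (pderiv j p)) x

def LP (B : Mat n) (p : Pol n) : Pol n := ∑ i, ∑ j, MvPolynomial.C (B i j) * pderiv i (pderiv j p)

def GP (B : Mat n) (p q : Pol n) : Pol n := ∑ i, ∑ j, MvPolynomial.C (B i j) * (pderiv i p * pderiv j q)

@[simp] lemma ev_add (p q : Pol n) (x) : ev (p + q) x = ev p x + ev q x := by simp [ev]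
@[simp] lemma ev_sub (p q : Pol n) (x) : ev (p - q) x = ev p x - ev q x := by simp [ev]
@[simp] lemma ev_neg (p : Pol n) (x) : ev (-p) x = - ev p x := by simp [ev]
@[simp] lemma ev_mul (p q : Pol n) (x) : ev (p * q) x = ev p x * ev q x := by simp [ev]
@[simp] lemma ev_pow (p : Pol n) (k : ℕ) (x) : ev (p ^ k) x = ev p x ^ k := by simp [ev]
@[simp] lemma ev_C (a : ℝ) (x : En n) : ev (MvPolynomial.C a) x = a := by simp [ev]
@[simp] lemma ev_X (i : Fin n) (x : En n) : ev (MvPolynomial.X i) x = x i := by simp [ev]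
@[simp] lemma ev_zero (x : En n) : ev (0 : Pol n) x = 0 := by simp [ev]
@[simp] lemma ev_one (x : En n) : ev (1 : Pol n) x = 1 := by simp [ev]
lemma ev_sum {ι : Type*} (s : Finset ι) (f : ι → Pol n) (x) : ev (∑ i ∈ s, f i) x = ∑ i ∈ s, ev (f i) x := by
  simp [ev]

lemma ev_cont (p : Pol n) : Continuous (ev p) := by
  unfold ev
  exact (MvPolynomial.continuous_eval p).comp (by fun_prop)

lemma pderiv_comm' (i j : Fin n) (p : Pol n) : pderiv i (pderiv j p) = pderiv j (pderiv i p) := by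
  induction p using MvPolynomial.induction_on with
  | C a => simp
  | add p q hp hq => simp [hp, hq]
  | mul_X p k hp =>
    simp only [Derivation.leibniz, MvPolynomial.pderiv_X, smul_eq_mul, map_add, hp]
    by_cases h : i = k <;> by_cases h' : j = k <;> simp [Pi.single_apply, h, h'] <;> ring

lemma he_symm (p : Pol n) (x) : (he p x).IsSymm := by
  ext i j; simp [he, pderiv_comm' i j]

lemma ev_LP (B : Mat n) (p : Pol n) (x) : ev (LP B p) x = LB B (he p x) := by
  simp [LP, LB, he, ev_sum]

lemma LP_add (B : Mat n) (p q : Pol n) : LP B (p + q) = LP B p + LP B q := by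
  simp [LP, mul_add, Finset.sum_add_distrib]
lemma LP_sub (B : Mat n) (p q : Pol n) : LP B (p - q) = LP B p - LP B q := by
  simp [LP, mul_sub, Finset.sum_sub_distrib]
lemma LP_C_mul (B : Mat n) (c : ℝ) (p : Pol n) : LP B (MvPolynomial.C c * p) = MvPolynomial.C c * LP B p := by
  simp only [LP, Finset.mul_sum, MvPolynomial.pderiv_C_mul]
  refine Finset.sum_congr rfl fun i _ => Finset.sum_congr rfl fun j _ => ?_
  ring

lemma GP_symm (B : Mat n) (hB : ∀ i j, B i j = B j i) (p q : Pol n) : GP B p q = GP B q p := by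
  unfold GP
  rw [Finset.sum_comm]
  refine Finset.sum_congr rfl fun i _ => Finset.sum_congr rfl fun j _ => ?_
  rw [hB]; ring

lemma LP_mul (B : Mat n) (hB : ∀ i j, B i j = B j i) (p q : Pol n) :
    LP B (p * q) = p * LP B q + q * LP B p + 2 * GP B p q := by
  have h2 : 2 * GP B p q = GP B p q + GP B q p := by rw [GP_symm B hB q p]; ring
  rw [h2]
  simp only [LP, GP, Finset.mul_sum, ← Finset.sum_add_distrib]
  refine Finset.sum_congr rfl fun i _ => Finset.sum_congr rfl fun j _ => ?_
  simp only [Derivation.leibniz, smul_eq_mul, map_add]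
  ring

lemma GP_mul_left (B : Mat n) (p q r : Pol n) : GP B (p * q) r = p * GP B q r + q * GP B p r := by
  simp only [GP, Finset.mul_sum, ← Finset.sum_add_distrib]
  refine Finset.sum_congr rfl fun i _ => Finset.sum_congr rfl fun j _ => ?_
  simp only [Derivation.leibniz, smul_eq_mul]
  ring

/-- bilinear form -/
def bf (A : Mat n) (v w : En n) : ℝ := ∑ i, ∑ j, A i j * v i * w j

lemma ev_GP (B : Mat n) (p q : Pol n) (x) : ev (GP B p q) x = bf B (gr p x) (gr q x) := by
  simp [GP, bf, gr, ev_sum, mul_assoc]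

lemma ev_GP_self (B : Mat n) (p : Pol n) (x) : ev (GP B p p) x = qf B (gr p x) := by
  rw [ev_GP]; rfl

lemma poly_taylor (p : Pol n) (x : En n) : ∃ C, 0 ≤ C ∧ ∀ y, ‖y - x‖ ≤ 1 →
    |ev p y - ev p x - inner ℝ (gr p x) (y - x) - qf (he p x) (y - x) / 2| ≤ C * ‖y - x‖ ^ 3 := by
  induction p using MvPolynomial.induction_on with
  | C a => 
    refine ⟨0, le_rfl, fun y _ => ?_⟩
    have h1 : inner ℝ (gr (MvPolynomial.C a) x) (y - x) = 0 := by simp [inner_eq, gr]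
    have h2 : qf (he (MvPolynomial.C a) x) (y - x) = 0 := by simp [qf, he]
    simp [h1, h2]
  | add p q hp hq =>
    obtain ⟨C, hC, hp⟩ := hp
    obtain ⟨C', hC', hq⟩ := hq
    refine ⟨C + C', by positivity, fun y hy => ?_⟩
    have h1 : gr (p + q) x = gr p x + gr q x := by ext i; simp [gr]
    have h2 : he (p + q) x = he p x + he q x := by ext i j; simp [he]
    rw [h1, h2, inner_add_left, qf_add, ev_add, ev_add, add_mul]
    refine le_trans ?_ (add_le_add (hp y hy) (hq y hy))
    refine le_trans (le_of_eq ?_) (abs_add_le _ _)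
    congr 1; ring
  | mul_X p k hp =>
    obtain ⟨C, hC, hp⟩ := hp
    obtain ⟨c, hc⟩ : ∃ c, ∀ i j, |he p x i j| ≤ c := by
      refine ⟨∑ i, ∑ j, |he p x i j|, fun i j => ?_⟩
      exact (Finset.single_le_sum (f := fun j => |he p x i j|) (fun _ _ => abs_nonneg _)
        (Finset.mem_univ j)).trans (Finset.single_le_sum (f := fun i => ∑ j, |he p x i j|)
          (fun _ _ => Finset.sum_nonneg fun _ _ => abs_nonneg _) (Finset.mem_univ i))
    have hc0 : 0 ≤ c := (abs_nonneg _).trans (hc k k)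
    refine ⟨|x k| * C + n ^ 2 * c / 2 + C, by positivity, fun y hy => ?_⟩
    set v := y - x with hv
    have hg : inner ℝ (gr (p * MvPolynomial.X k) x) v = x k * inner ℝ (gr p x) v + ev p x * v k := by
      simp only [inner_eq, gr, Derivation.leibniz, MvPolynomial.pderiv_X, smul_eq_mul, ev_add, ev_mul, ev_X,
        add_mul, Finset.sum_add_distrib, Finset.mul_sum]
      rw [add_comm]
      congr 1
      · refine Finset.sum_congr rfl fun i _ => by ring
      · rw [Finset.sum_eq_single k]
        · simp
        · intro b _ hb; simp [Pi.single_apply, hb]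
        · simp
    have hh : qf (he (p * MvPolynomial.X k) x) v = x k * qf (he p x) v + 2 * v k * inner ℝ (gr p x) v := by
      have e1 : ∀ i j, ev (pderiv i (pderiv j (p * MvPolynomial.X k))) x
        = x k * ev (pderiv i (pderiv j p)) x + (if i = k then ev (pderiv j p) x else 0)
          + (if j = k then ev (pderiv i p) x else 0) := by
        intro i j
        have h1 : pderiv i (Pi.single (M := fun _ => Pol n) k (1 : Pol n) j) = 0 := by
          by_cases h : j = k
          · subst h; simp
          · simp [Pi.single_apply, h]
        simp only [Derivation.leibniz, MvPolynomial.pderiv_X, smul_eq_mul, map_add, h1, ev_add, ev_mul, ev_X, ev_zero]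
        by_cases h : i = k <;> by_cases h' : j = k <;> simp [Pi.single_apply, h, h'] <;> ring
      simp only [qf, he, Matrix.of_apply, e1, inner_eq, gr, add_mul, Finset.sum_add_distrib, ite_mul, zero_mul]
      rw [Finset.sum_eq_single (a := k) (f := fun i => ∑ j, if i = k then ev (pderiv j p) x * v i * v j else 0)]
      · simp only [if_true, Finset.sum_ite_eq', Finset.mem_univ, Finset.mul_sum, add_assoc, ← Finset.sum_add_distrib]
        refine Finset.sum_congr rfl fun i _ => ?_
        congr 1
        · refine Finset.sum_congr rfl fun j _ => by ring
        · ring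
      · intro b _ hb; simp [hb]
      · simp
    rw [hg, hh, ev_mul, ev_mul, ev_X, ev_X]
    have hyk : y k = x k + v k := by simp [hv]
    have key : ev p y * y k - ev p x * x k - (x k * inner ℝ (gr p x) v + ev p x * v k)
        - (x k * qf (he p x) v + 2 * v k * inner ℝ (gr p x) v) / 2
        = (x k + v k) * (ev p y - ev p x - inner ℝ (gr p x) v - qf (he p x) v / 2)
          + qf (he p x) v / 2 * v k := by rw [hyk]; ring
    rw [key]
    have hq := qf_bound _ c hc v
    have hvk := abs_coord v k
    have hp := hp y hy
    calc _ ≤ |x k + v k| * |ev p y - ev p x - inner ℝ (gr p x) v - qf (he p x) v / 2|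
          + |qf (he p x) v| / 2 * |v k| := by
          refine (abs_add_le _ _).trans (le_of_eq ?_)
          rw [abs_mul, abs_mul, abs_div]; norm_num
      _ ≤ (|x k| + 1) * (C * ‖v‖ ^ 3) + (n ^ 2 * c * ‖v‖ ^ 2) / 2 * ‖v‖ := by
          gcongr
          exact (abs_add_le _ _).trans (by linarith)
      _ = _ := by ring

lemma UJ_poly (p : Pol n) (x : En n) : UJ (ev p) x (gr p x) (he p x) := by
  obtain ⟨C, hC, h⟩ := poly_taylor p x
  intro ε hε
  have h1 : ∀ᶠ y in 𝓝 x, ‖y - x‖ < min 1 (ε / (C + 1)) := by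
    have : Tendsto (fun y => ‖y - x‖) (𝓝 x) (𝓝 0) := by
      have : Continuous fun y : En n => ‖y - x‖ := by fun_prop
      simpa using this.tendsto x
    exact this.eventually (gt_mem_nhds (by positivity))
  filter_upwards [h1] with y hy
  have h2 := (abs_le.1 (h y (hy.le.trans (min_le_left _ _)))).2
  have h3 : (C + 1) * ‖y - x‖ ≤ ε := by
    have := hy.le.trans (min_le_right _ _)
    rw [le_div_iff₀ (by positivity)] at this; linarith
  have h4 : C * ‖y - x‖ ^ 3 ≤ ε * ‖y - x‖ ^ 2 := by
    have : C * ‖y - x‖ ≤ ε := by nlinarith [norm_nonneg (y - x)]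
    calc C * ‖y - x‖ ^ 3 = (C * ‖y - x‖) * ‖y - x‖ ^ 2 := by ring
      _ ≤ _ := by gcongr
  linarith

lemma gr_neg (p : Pol n) (x) : gr (-p) x = - gr p x := by ext i; simp [gr]
lemma he_neg (p : Pol n) (x) : he (-p) x = - he p x := by ext i j; simp [he]
lemma gr_sub (p q : Pol n) (x) : gr (p - q) x = gr p x - gr q x := by ext i; simp [gr]

lemma UJ_poly_neg (p : Pol n) (x : En n) : UJ (fun y => - ev p y) x (-gr p x) (-he p x) := by
  have := UJ_poly (-p) x
  rw [gr_neg, he_neg] at this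
  have e : ev (-p) = fun y => - ev p y := by ext y; simp
  rwa [e] at this

lemma Sub.add_poly {B : Mat n} {w f : En n → ℝ} {D : Set (En n)} (h : Sub B w f D) (p : Pol n) :
    Sub B (fun y => w y + ev p y) (fun y => f y + ev (LP B p) y) D :=
  h.add fun x _ => ⟨gr p x, he p x, he_symm p x, (ev_LP B p x).le, UJ_poly_neg p x⟩

lemma UJ_nonneg_of_const {x b : En n} {A : Mat n} (h : UJ (fun _ => (0 : ℝ)) x b A) (v : En n) :
    0 ≤ qf A v := by
  by_cases hv : v = 0
  · subst hv; simp [qf]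
  have hv' : 0 < ‖v‖ := norm_pos_iff.2 hv
  by_contra hneg
  push Not at hneg
  have hε : 0 < - qf A v / (4 * ‖v‖ ^ 2) := by
    apply div_pos (by linarith) (by positivity)
  have h1 := h _ hε
  have t1 : Tendsto (fun t : ℝ => x + t • v) (𝓝[>] 0) (𝓝 x) := by
    have : Continuous fun t : ℝ => x + t • v := by fun_prop
    simpa using (this.tendsto 0).mono_left nhdsWithin_le_nhds
  have t2 : Tendsto (fun t : ℝ => x + t • (-v)) (𝓝[>] 0) (𝓝 x) := by
    have : Continuous fun t : ℝ => x + t • (-v) := by fun_prop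
    simpa using (this.tendsto 0).mono_left nhdsWithin_le_nhds
  obtain ⟨t, ⟨h2, h3⟩, ht⟩ := ((t1.eventually h1).and (t2.eventually h1) |>.and self_mem_nhdsWithin).exists
  have ht : 0 < t := ht
  simp only [add_sub_cancel_left, qf_vsmul, qf_vneg, inner_smul_right, inner_neg_right, norm_smul, norm_neg,
    mul_pow, Real.norm_eq_abs, sq_abs] at h2 h3
  have e : -qf A v / (4 * ‖v‖ ^ 2) * (t ^ 2 * ‖v‖ ^ 2) = - qf A v * t ^ 2 / 4 := by
    field_simp
  rw [e] at h2 h3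
  have : 0 < t ^ 2 := by positivity
  nlinarith

lemma UJ_zero_sub_of {B : Mat n} (hpos : ∀ A : Mat n, A.IsSymm → (∀ v, 0 ≤ qf A v) → 0 ≤ LB B A)
    (D : Set (En n)) : Sub B (fun _ => 0) (fun _ => 0) D :=
  fun x _ _ A hA hU => hpos A hA (UJ_nonneg_of_const hU)

end

section

open scoped Topology
open MvPolynomial (pderiv)

variable {n : ℕ}

def mv (A : Mat n) (v : En n) : En n := WithLp.toLp 2 fun i => ∑ j, A i j * v j

lemma qf_eq_inner (A : Mat n) (v : En n) : qf A v = inner ℝ v (mv A v) := by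
  rw [inner_eq]
  simp only [qf, mv, Finset.mul_sum]
  refine Finset.sum_congr rfl fun i _ => Finset.sum_congr rfl fun j _ => by ring

lemma spec (A : Mat n) (hA : A.IsSymm) : ∃ (v : OrthonormalBasis (Fin n) ℝ (En n)) (μ : Fin n → ℝ),
    (∀ i j, A i j = ∑ k, μ k * v k i * v k j) ∧ (∀ k, mv A (v k) = μ k • v k) := by
  have hH : A.IsHermitian := by
    unfold Matrix.IsHermitian; rw [Matrix.conjTranspose_eq_transpose_of_trivial]; exact hA
  have h1 : ∀ k, mv A (hH.eigenvectorBasis k) = hH.eigenvalues k • hH.eigenvectorBasis k := by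
    intro k
    have := hH.mulVec_eigenvectorBasis k
    ext i
    have := congrFun this i
    simpa [mv, Matrix.mulVec, dotProduct] using this
  refine ⟨hH.eigenvectorBasis, hH.eigenvalues, fun i j => ?_, h1⟩
  have h2 := hH.eigenvectorBasis.sum_repr (EuclideanSpace.single j (1:ℝ))
  have h3 : mv A (EuclideanSpace.single j (1:ℝ)) i = A i j := by simp [mv, PiLp.single_apply]
  rw [← h3, ← h2]
  have h4 : mv A (∑ k, hH.eigenvectorBasis.repr (EuclideanSpace.single j (1:ℝ)) k • hH.eigenvectorBasis k) i
     = ∑ k, hH.eigenvectorBasis.repr (EuclideanSpace.single j (1:ℝ)) k * mv A (hH.eigenvectorBasis k) i := by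
    simp only [mv, Finset.mul_sum, WithLp.ofLp_sum, Finset.sum_apply, WithLp.ofLp_smul, Pi.smul_apply, smul_eq_mul]
    rw [Finset.sum_comm]
    refine Finset.sum_congr rfl fun i _ => Finset.sum_congr rfl fun j _ => by ring
  rw [h4]
  refine Finset.sum_congr rfl fun k _ => ?_
  rw [h1]
  rw [OrthonormalBasis.repr_apply_apply]
  simp [inner_eq, PiLp.single_apply]
  ring

lemma spec_LB {B A : Mat n} {v : Fin n → En n} {μ : Fin n → ℝ}
    (h : ∀ i j, A i j = ∑ k, μ k * v k i * v k j) : LB B A = ∑ k, μ k * qf B (v k) := by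
  simp only [LB, h, qf, Finset.mul_sum]
  rw [Finset.sum_comm' (t' := Finset.univ) (s' := fun _ => Finset.univ) (by simp)]
  calc _ = ∑ y, ∑ i, ∑ k, B i y * (μ k * (v k) i * (v k) y) := rfl
    _ = ∑ y, ∑ k, ∑ i, B i y * (μ k * (v k) i * (v k) y) :=
        Finset.sum_congr rfl fun _ _ => Finset.sum_comm
    _ = ∑ k, ∑ y, ∑ i, B i y * (μ k * (v k) i * (v k) y) := Finset.sum_comm
    _ = _ := by
      refine Finset.sum_congr rfl fun k _ => ?_
      rw [Finset.sum_comm]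
      refine Finset.sum_congr rfl fun i _ => Finset.sum_congr rfl fun j _ => by ring

lemma LB_nonneg {lam Lam : ℝ} {B : Mat n} (hB : Ell lam Lam B) (A : Mat n) (hA : A.IsSymm)
    (hp : ∀ v, 0 ≤ qf A v) : 0 ≤ LB B A := by
  obtain ⟨v, μ, h1, h2⟩ := spec A hA
  rw [spec_LB h1]
  refine Finset.sum_nonneg fun k _ => ?_
  have h3 := hp (v k)
  rw [qf_eq_inner, h2, inner_smul_right, real_inner_self_eq_norm_sq] at h3
  have : ‖v k‖ = 1 := v.orthonormal.1 k
  rw [this] at h3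
  have h4 := hB.lower (v k)
  rw [this] at h4
  have := hB.lam_pos
  apply mul_nonneg <;> linarith

lemma Sub_poly {lam Lam : ℝ} {B : Mat n} (hB : Ell lam Lam B) (p : Pol n) (D : Set (En n)) :
    Sub B (ev p) (ev (LP B p)) D := by
  simpa using (UJ_zero_sub_of (LB_nonneg hB) D).add_poly p

/-- maximum principle for polynomials -/
lemma poly_max {lam Lam : ℝ} {B : Mat n} (hB : Ell lam Lam B) (hn : 0 < n) (p : Pol n)
    {x : En n} {r m : ℝ} (hr : 0 < r) (hL : ∀ y ∈ ball x r, 0 ≤ ev (LP B p) y)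
    (hm : ∀ y ∈ sphere x r, ev p y ≤ m) : ∀ y ∈ closedBall x r, ev p y ≤ m :=
  max_principle hB hn hr (ev_cont p).continuousOn
    ((Sub_poly hB p _).mono subset_rfl fun y hy => hL y hy) hm

/-- zeta = 1 - |x|² -/
def zet (n : ℕ) : Pol n := 1 - ∑ i, MvPolynomial.X i ^ 2

lemma ev_zet (x : En n) : ev (zet n) x = 1 - ‖x‖ ^ 2 := by
  simp [zet, ev_sum, EuclideanSpace.norm_sq_eq]

lemma totalDegree_pderiv (i : Fin n) (p : Pol n) {d : ℕ} (hp : p.totalDegree ≤ d + 1) :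
    (pderiv i p).totalDegree ≤ d := by
  rw [p.as_sum, map_sum]
  refine (MvPolynomial.totalDegree_finset_sum _ _).trans (Finset.sup_le fun s hs => ?_)
  rw [MvPolynomial.pderiv_monomial]
  by_cases hsi : s i = 0
  · simp [hsi]
  refine (MvPolynomial.totalDegree_monomial_le _ _).trans ?_
  have h1 := (MvPolynomial.le_totalDegree hs).trans hp
  have h2 : s - Finsupp.single i 1 + Finsupp.single i 1 = s :=
    tsub_add_cancel_of_le (by simp; omega)
  have h3 : (s.sum fun _ e => e) = ((s - Finsupp.single i 1).sum fun _ e => e) + 1 := by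
    conv_lhs => rw [← h2]
    rw [Finsupp.sum_add_index' (by simp) (by simp)]
    simp
  change ((s - Finsupp.single i 1).sum fun _ e => e) ≤ d
  omega

lemma totalDegree_LP (B : Mat n) (p : Pol n) {d : ℕ} (hp : p.totalDegree ≤ d + 2) :
    (LP B p).totalDegree ≤ d := by
  unfold LP
  refine (MvPolynomial.totalDegree_finset_sum _ _).trans (Finset.sup_le fun i _ => ?_)
  refine (MvPolynomial.totalDegree_finset_sum _ _).trans (Finset.sup_le fun j _ => ?_)
  refine (MvPolynomial.totalDegree_mul _ _).trans ?_
  have := totalDegree_pderiv i _ (totalDegree_pderiv (d := d+1) j p hp)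
  simpa using this

lemma zet_deg (n : ℕ) : (zet n).totalDegree ≤ 2 := by
  unfold zet
  refine (MvPolynomial.totalDegree_sub _ _).trans ?_
  simp only [MvPolynomial.totalDegree_one, max_le_iff, zero_le, true_and]
  refine (MvPolynomial.totalDegree_finset_sum _ _).trans (Finset.sup_le fun i _ => ?_)
  exact (MvPolynomial.totalDegree_pow _ _).trans (by simp)

lemma pol_zero_of_ball (q : Pol n) (h : ∀ x ∈ ball (0 : En n) 1, ev q x = 0) : q = 0 := by
  have h0 : (0:ℝ) < 1 / (n + 1) := by positivity
  apply MvPolynomial.funext_set (fun _ : Fin n => Set.Ioo (0:ℝ) (1 / (n + 1)))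
    (fun i => Set.Ioo_infinite h0)
  intro x hx
  rw [Set.mem_univ_pi] at hx
  have := h (WithLp.toLp 2 x) (by
    rw [mem_ball_zero_iff]
    have : ‖WithLp.toLp 2 x‖ ^ 2 < 1 := by
      rw [EuclideanSpace.norm_sq_eq]
      calc ∑ i, ‖x i‖ ^ 2 ≤ ∑ i : Fin n, (1 / ((n:ℝ) + 1)) ^ 2 := by
            refine Finset.sum_le_sum fun i _ => ?_
            rw [Real.norm_of_nonneg (hx i).1.le]
            have := (hx i).1.le
            have := (hx i).2.le
            gcongr
        _ = n / (n + 1) ^ 2 := by simp; field_simp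
        _ < 1 := by
            rw [div_lt_one (by positivity)]
            nlinarith [(Nat.cast_nonneg n : (0:ℝ) ≤ n)]
    nlinarith [norm_nonneg (WithLp.toLp 2 x)])
  simpa [ev] using this

lemma dirichlet {lam Lam : ℝ} {B : Mat n} (hB : Ell lam Lam B) (hn : 0 < n) (p : Pol n) :
    ∃ h : Pol n, LP B h = 0 ∧ ∀ x ∈ sphere (0 : En n) 1, ev h x = ev p x := by
  set d := p.totalDegree with hd
  let W := MvPolynomial.restrictTotalDegree (Fin n) ℝ d
  have hmem : ∀ q : Pol n, q ∈ W ↔ q.totalDegree ≤ d := fun q => MvPolynomial.mem_restrictTotalDegree _ _ _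
  let T : W →ₗ[ℝ] W :=
    { toFun := fun q => ⟨LP B (zet n * q.1), by
        rw [hmem]
        apply totalDegree_LP
        have := (hmem _).1 q.2
        have := MvPolynomial.totalDegree_mul (zet n) q.1
        have := zet_deg n
        omega⟩
      map_add' := by
        intro a b; ext1; simp [mul_add, LP_add]
      map_smul' := by
        intro c a; ext1
        simp only [Submodule.coe_smul, RingHom.id_apply, MvPolynomial.smul_eq_C_mul]
        rw [← LP_C_mul]; congr 1; ring }
  have hinj : Function.Injective T := by
    rw [← LinearMap.ker_eq_bot, LinearMap.ker_eq_bot']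
    intro q hq
    have hq0 : LP B (zet n * q.1) = 0 := congrArg Subtype.val hq
    have hb : ∀ s : Pol n, LP B (zet n * s) = 0 → ∀ x ∈ closedBall (0:En n) 1, ev (zet n * s) x ≤ 0 := by
      intro s hs
      apply poly_max hB hn _ one_pos
      · intro y _; simp [hs]
      · intro y hy
        rw [mem_sphere_zero_iff_norm] at hy
        simp [ev_zet, hy]
    ext1
    apply pol_zero_of_ball
    intro x hx
    have h1 := hb q.1 hq0 x (ball_subset_closedBall hx)
    have h2 := hb (-q.1) (by
      have : zet n * -q.1 = MvPolynomial.C (-1) * (zet n * q.1) := by simp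
      rw [this, LP_C_mul, hq0, mul_zero]) x (ball_subset_closedBall hx)
    rw [mem_ball_zero_iff] at hx
    have h3 : 0 < ev (zet n) x := by
      rw [ev_zet]; nlinarith [norm_nonneg x]
    simp only [ev_mul, ev_neg] at h1 h2
    nlinarith
  have hsurj := LinearMap.injective_iff_surjective.1 hinj
  obtain ⟨q, hq⟩ := hsurj ⟨LP B p, by
    rw [hmem]; apply totalDegree_LP; omega⟩
  refine ⟨p - zet n * q.1, ?_, ?_⟩
  · rw [LP_sub, sub_eq_zero]
    exact (congrArg Subtype.val hq).symm
  · intro x hx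
    rw [mem_sphere_zero_iff_norm] at hx
    simp [ev_zet, hx]

/-- affine substitution -/
def asub (a : En n) (c : ℝ) : Pol n →ₐ[ℝ] Pol n :=
  MvPolynomial.bind₁ (fun i => MvPolynomial.C (a i) + MvPolynomial.C c * MvPolynomial.X i)

lemma ev_asub (a : En n) (c : ℝ) (p : Pol n) (x : En n) : ev (asub a c p) x = ev p (a + c • x) := by
  induction p using MvPolynomial.induction_on with
  | C r => simp [asub]
  | add p q hp hq => simp [hp, hq]
  | mul_X p k hp =>
    simp only [map_mul, ev_mul, hp, ev_X]
    congr 1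
    simp [asub]

lemma pderiv_asub (a : En n) (c : ℝ) (p : Pol n) (i : Fin n) :
    pderiv i (asub a c p) = MvPolynomial.C c * asub a c (pderiv i p) := by
  induction p using MvPolynomial.induction_on with
  | C r => simp [asub]
  | add p q hp hq => simp [hp, hq, mul_add]
  | mul_X p k hp =>
    have hk : asub a c (MvPolynomial.X k) = MvPolynomial.C (a k) + MvPolynomial.C c * MvPolynomial.X k := by
      simp [asub]
    simp only [map_mul, Derivation.leibniz, MvPolynomial.pderiv_X, smul_eq_mul, map_add, hp, hk,
      MvPolynomial.pderiv_C, MvPolynomial.pderiv_C_mul]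
    by_cases h : i = k
    · subst h; simp; ring
    · simp [Pi.single_apply, h]; ring

lemma LP_asub (B : Mat n) (a : En n) (c : ℝ) (p : Pol n) :
    LP B (asub a c p) = MvPolynomial.C (c ^ 2) * asub a c (LP B p) := by
  simp only [LP, pderiv_asub, map_sum, map_mul, Finset.mul_sum, MvPolynomial.pderiv_C_mul]
  refine Finset.sum_congr rfl fun i _ => Finset.sum_congr rfl fun j _ => ?_
  have : asub a c (MvPolynomial.C (B i j)) = MvPolynomial.C (B i j) := by simp [asub]
  rw [this, MvPolynomial.C_pow]; ring

/-- harmonic approximations of continuous boundary data -/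
lemma harm_approx {lam Lam : ℝ} {B : Mat n} (hB : Ell lam Lam B) (hn : 0 < n) {x : En n} {r : ℝ} (hr : 0 < r)
    {w : En n → ℝ} (hw : ContinuousOn w (sphere x r)) {η : ℝ} (hη : 0 < η) :
    ∃ h : Pol n, LP B h = 0 ∧ ∀ y ∈ sphere x r, |w y - ev h y| ≤ η := by
  let S : Set (En n) := sphere 0 1
  have hS : CompactSpace S := isCompact_iff_compactSpace.1 (isCompact_sphere _ _)
  have hmap : ∀ y : S, x + r • (y : En n) ∈ sphere x r := by
    intro y
    have := y.2
    simp only [S, mem_sphere_zero_iff_norm] at this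
    simp [norm_smul, this, abs_of_pos hr]
  let f : C(S, ℝ) := ⟨fun y => w (x + r • (y : En n)), by
    have : Continuous fun y : S => x + r • (y : En n) := by fun_prop
    exact hw.comp_continuous this hmap⟩
  let ψ : Pol n →ₐ[ℝ] C(S, ℝ) := MvPolynomial.aeval (fun i => ⟨fun y : S => (y : En n) i, by fun_prop⟩)
  have hψ : ∀ (p : Pol n) (y : S), ψ p y = ev p y := by
    intro p y
    induction p using MvPolynomial.induction_on with
    | C r => simp [ψ]
    | add p q hp hq => simp [hp, hq]
    | mul_X p k hp => simp only [map_mul, ContinuousMap.mul_apply, hp, ev_mul]; simp [ψ]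
  obtain ⟨g, hg⟩ := ContinuousMap.exists_mem_subalgebra_near_continuousMap_of_separatesPoints ψ.range (by
    intro a b hab
    have : ∃ i, (a : En n) i ≠ (b : En n) i := by
      by_contra hcon; push Not at hcon
      exact hab (Subtype.ext (by ext i; exact hcon i))
    obtain ⟨i, hi⟩ := this
    refine ⟨ψ (MvPolynomial.X i), ⟨ψ (MvPolynomial.X i), ⟨MvPolynomial.X i, rfl⟩, rfl⟩, ?_⟩
    rw [hψ, hψ]; simpa using hi) f η hη
  obtain ⟨p, hp⟩ := g.2
  obtain ⟨h, hh, hh2⟩ := dirichlet hB hn p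
  refine ⟨asub (-(r⁻¹ • x)) r⁻¹ h, by rw [LP_asub, hh]; simp, fun y hy => ?_⟩
  rw [ev_asub]
  have hyS : -(r⁻¹ • x) + r⁻¹ • y ∈ S := by
    have : -(r⁻¹ • x) + r⁻¹ • y = r⁻¹ • (y - x) := by rw [smul_sub]; abel
    rw [this]
    simp only [S, mem_sphere_zero_iff_norm, norm_smul]
    rw [mem_sphere_iff_norm] at hy
    rw [hy]; simp [abs_of_pos hr, hr.ne']
  rw [hh2 _ hyS]
  have h1 := (ContinuousMap.norm_coe_le_norm (g.1 - f) ⟨_, hyS⟩).trans hg.le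
  have h2 : x + r • (-(r⁻¹ • x) + r⁻¹ • y) = y := by
    rw [smul_add, smul_neg, smul_smul, smul_smul, mul_inv_cancel₀ hr.ne']; simp
  rw [← hp] at h1
  have h3 : (ψ p - f) ⟨_, hyS⟩ = ev p (-(r⁻¹ • x) + r⁻¹ • y) - w y := by
    rw [ContinuousMap.sub_apply, hψ]
    congr 1
    show w _ = w y
    rw [h2]
  have h4 : ((ψ.toRingHom : Pol n → C(S, ℝ)) p - f) ⟨_, hyS⟩ = ev p (-(r⁻¹ • x) + r⁻¹ • y) - w y := h3
  rw [abs_sub_comm, ← h3, ← Real.norm_eq_abs]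
  exact h1

end

section

open scoped Topology
open MvPolynomial (pderiv)

variable {n : ℕ}

lemma pderiv_LP (B : Mat n) (p : Pol n) (i : Fin n) : LP B (pderiv i p) = pderiv i (LP B p) := by
  simp only [LP, map_sum, MvPolynomial.pderiv_C_mul]
  refine Finset.sum_congr rfl fun k _ => Finset.sum_congr rfl fun j _ => ?_
  rw [pderiv_comm' j i, pderiv_comm' k i]

lemma pderiv_zet (i : Fin n) : pderiv i (zet n) = MvPolynomial.C (-2) * MvPolynomial.X i := by
  simp only [zet, map_sub, map_sum, Derivation.leibniz_pow, MvPolynomial.pderiv_X]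
  rw [Finset.sum_eq_single i]
  · have : (MvPolynomial.C (-2) : Pol n) = -2 := by rw [map_neg]; simp [map_ofNat MvPolynomial.C 2]
    rw [this]; simp
  · intro b _ hb; simp [Pi.single_apply, hb.symm]
  · simp

lemma gr_zet (x : En n) : gr (zet n) x = (-2 : ℝ) • x := by
  ext i; simp [gr, pderiv_zet]

lemma he_zet (x : En n) : he (zet n) x = (-2 : ℝ) • (1 : Mat n) := by
  ext i j
  simp only [he, Matrix.of_apply, pderiv_zet, MvPolynomial.pderiv_C_mul, MvPolynomial.pderiv_X]
  by_cases h : i = j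
  · subst h; simp
  · simp [Pi.single_apply, h, Ne.symm h]

lemma qf_comb (B : Mat n) (hB : ∀ i j, B i j = B j i) (a b : ℝ) (v w : En n) :
    qf B (a • v + b • w) = a ^ 2 * qf B v + 2 * a * b * bf B v w + b ^ 2 * qf B w := by
  have e : bf B v w = ∑ i, ∑ j, B i j * w i * v j := by
    unfold bf; rw [Finset.sum_comm]
    refine Finset.sum_congr rfl fun k _ => Finset.sum_congr rfl fun j _ => ?_
    rw [hB]; ring
  have e2 : 2 * a * b * bf B v w = a * b * bf B v w + a * b * ∑ i, ∑ j, B i j * w i * v j := by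
    rw [← e]; ring
  rw [e2]
  simp only [qf, bf, Finset.mul_sum, ← Finset.sum_add_distrib]
  refine Finset.sum_congr rfl fun k _ => Finset.sum_congr rfl fun j _ => ?_
  simp; ring

lemma Ell.qf_nonneg {lam Lam : ℝ} {B : Mat n} (hB : Ell lam Lam B) (v : En n) : 0 ≤ qf B v :=
  le_trans (by have := hB.lam_pos; positivity) (hB.lower v)

def aB (n : ℕ) (lam Lam : ℝ) : ℝ := (2 * n * Lam + 12 * Lam) / lam

def cB (n : ℕ) (lam Lam : ℝ) : ℝ := Real.sqrt (aB n lam Lam) + 1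

lemma cB_pos (n : ℕ) (lam Lam : ℝ) : 0 < cB n lam Lam := by unfold cB; positivity
lemma cB_one (n : ℕ) (lam Lam : ℝ) : 1 ≤ cB n lam Lam := by
  unfold cB; linarith [Real.sqrt_nonneg (aB n lam Lam)]

lemma bernstein {lam Lam : ℝ} {B : Mat n} (hB : Ell lam Lam B) (hn : 0 < n) (h : Pol n)
    (hh : LP B h = 0) {m : ℝ} (hm : ∀ y ∈ closedBall (0 : En n) 1, |ev h y| ≤ m) (i : Fin n) :
    |ev (pderiv i h) 0| ≤ cB n lam Lam * m := by
  have hl := hB.lam_pos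
  have hL : 0 < Lam := hl.trans_le hB.lam_le
  have hm0 : 0 ≤ m := (abs_nonneg _).trans (hm 0 (by simp))
  set α := aB n lam Lam with hα
  have hαl : α * lam = 2 * n * Lam + 12 * Lam := by rw [hα, aB]; field_simp
  have hα0 : 0 < α := by rw [hα, aB]; positivity
  set g := pderiv i h with hg
  have hLg : LP B g = 0 := by rw [hg, pderiv_LP, hh]; simp
  have key := poly_max hB hn ((zet n * zet n) * (g * g) + MvPolynomial.C α * (h * h)) (x := 0) one_pos (m := α * m ^ 2)
    (by
      intro y hy
      rw [mem_ball_zero_iff] at hy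
      have e1 : LP B (h * h) = 2 * GP B h h := by rw [LP_mul B hB.symm, hh]; ring
      have e2 : LP B (g * g) = 2 * GP B g g := by rw [LP_mul B hB.symm, hLg]; ring
      have e3 : LP B (zet n * zet n) = 2 * zet n * LP B (zet n) + 2 * GP B (zet n) (zet n) := by
        rw [LP_mul B hB.symm]; ring
      have e4 : GP B (zet n * zet n) (g * g) = 4 * (zet n * g * GP B (zet n) g) := by
        rw [GP_mul_left, GP_symm B hB.symm (zet n) (g * g), GP_mul_left, GP_symm B hB.symm g (zet n)]; ring
      rw [LP_add, LP_C_mul, LP_mul B hB.symm (zet n * zet n), e1, e2, e3, e4]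
      have two : ∀ x : En n, ev (2 : Pol n) x = 2 := fun x => by
        have : (2 : Pol n) = MvPolynomial.C 2 := (map_ofNat MvPolynomial.C 2).symm
        rw [this, ev_C]
      have four : ∀ x : En n, ev (4 : Pol n) x = 4 := fun x => by
        have : (4 : Pol n) = MvPolynomial.C 4 := (map_ofNat MvPolynomial.C 4).symm
        rw [this, ev_C]
      simp only [ev_add, ev_mul, ev_C, two, four, ev_GP_self, ev_LP, he_zet, gr_zet, LB_smul, qf_vsmul, ev_GP, ev_zet]
      have hz0 : 0 ≤ 1 - ‖y‖ ^ 2 := by nlinarith [norm_nonneg y]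
      have hz1 : 1 - ‖y‖ ^ 2 ≤ 1 := by nlinarith [norm_nonneg y]
      set ζ := 1 - ‖y‖ ^ 2
      have hq := hB.qf_nonneg (ζ • gr g y + (2 * ev g y) • ((-2 : ℝ) • y))
      rw [qf_comb B hB.symm, qf_vsmul] at hq
      have hsym : bf B (gr g y) ((-2:ℝ) • y) = bf B ((-2:ℝ) • y) (gr g y) := by
        unfold bf; rw [Finset.sum_comm]
        refine Finset.sum_congr rfl fun k _ => Finset.sum_congr rfl fun j _ => ?_
        rw [hB.symm]; ring
      rw [hsym] at hq
      have h1 := hB.tr_upper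
      have h1' : 0 ≤ LB B 1 := le_trans (by positivity) hB.tr_lower
      have h2 : qf B y ≤ Lam := (hB.upper y).trans (by nlinarith [norm_nonneg y])
      have h3 : lam * (ev g y) ^ 2 ≤ qf B (gr h y) := by
        refine le_trans ?_ (hB.lower _)
        have := abs_coord (gr h y) i
        have e : gr h y i = ev g y := by simp [gr, hg]
        rw [e] at this
        have : ev g y ^ 2 ≤ ‖gr h y‖ ^ 2 := by
          rw [← sq_abs]; gcongr
        gcongr
      have hG2 : 0 ≤ ev g y ^ 2 := sq_nonneg _
      have h4 : α * (lam * ev g y ^ 2) ≤ α * qf B (gr h y) := by gcongr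
      have h5 : ev g y ^ 2 * (α * lam) = ev g y ^ 2 * (2 * n * Lam + 12 * Lam) := by rw [hαl]
      have h6 : ev g y ^ 2 * (ζ * LB B 1) ≤ ev g y ^ 2 * (n * Lam) := by
        apply mul_le_mul_of_nonneg_left _ hG2
        nlinarith
      have h7 : ev g y ^ 2 * qf B y ≤ ev g y ^ 2 * Lam := by gcongr
      nlinarith)
    (by
      intro y hy
      have hy' := mem_sphere_zero_iff_norm.1 hy
      have := hm y (sphere_subset_closedBall hy)
      simp only [ev_add, ev_mul, ev_C, ev_zet, hy']
      have : ev h y ^ 2 ≤ m ^ 2 := by rw [← sq_abs]; gcongr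
      nlinarith) 0 (by simp)
  simp only [ev_add, ev_mul, ev_C, ev_zet, norm_zero] at key
  have k2 : ev g 0 ^ 2 ≤ (Real.sqrt α * m) ^ 2 := by
    rw [mul_pow, Real.sq_sqrt hα0.le]
    nlinarith [mul_nonneg hα0.le (mul_self_nonneg (ev h 0))]
  have k3 := abs_le_of_sq_le_sq k2 (by positivity)
  unfold cB; rw [← hα]; nlinarith

lemma bern_ball {lam Lam : ℝ} {B : Mat n} (hB : Ell lam Lam B) (hn : 0 < n) (h : Pol n)
    (hh : LP B h = 0) {m ρ : ℝ} (hρ : 0 < ρ) {x : En n} (hm : ∀ y ∈ closedBall x ρ, |ev h y| ≤ m) (i : Fin n) :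
    |ev (pderiv i h) x| ≤ cB n lam Lam * m / ρ := by
  have := bernstein hB hn (asub x ρ h) (by rw [LP_asub, hh]; simp) (m := m) (by
    intro y hy
    rw [ev_asub]
    apply hm
    rw [mem_closedBall_zero_iff] at hy
    simp [norm_smul, abs_of_pos hρ]
    nlinarith) i
  rw [pderiv_asub, ev_mul, ev_C, ev_asub, abs_mul, abs_of_pos hρ] at this
  rw [le_div_iff₀ hρ]
  simpa [mul_comm] using this

lemma bern_half {lam Lam : ℝ} {B : Mat n} (hB : Ell lam Lam B) (hn : 0 < n) (h : Pol n)
    (hh : LP B h = 0) {m ρ : ℝ} (hρ : 0 < ρ) {x : En n} (hm : ∀ y ∈ closedBall x ρ, |ev h y| ≤ m) (i : Fin n) :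
    ∀ y ∈ closedBall x (ρ / 2), |ev (pderiv i h) y| ≤ 2 * cB n lam Lam * m / ρ := by
  intro y hy
  have := bern_ball hB hn h hh (half_pos hρ) (x := y) (m := m) (by
    intro w hw
    apply hm
    rw [mem_closedBall] at *
    linarith [dist_triangle w y x]) i
  refine this.trans (le_of_eq ?_)
  field_simp

lemma norm_le_coords (v : En n) {c : ℝ} (h : ∀ i, |v i| ≤ c) (hc : 0 ≤ c) : ‖v‖ ≤ n * c := by
  have h1 : v = ∑ i, v i • EuclideanSpace.single i (1:ℝ) := by
    ext j; simp [Pi.single_apply]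
  rw [h1]
  refine (norm_sum_le _ _).trans ?_
  calc _ ≤ ∑ i : Fin n, c := Finset.sum_le_sum fun i _ => by simpa [norm_smul] using h i
    _ = _ := by simp

lemma gr_bound {lam Lam : ℝ} {B : Mat n} (hB : Ell lam Lam B) (hn : 0 < n) (h : Pol n)
    (hh : LP B h = 0) {m ρ : ℝ} (hρ : 0 < ρ) {x : En n} (hm : ∀ y ∈ closedBall x ρ, |ev h y| ≤ m) :
    ‖gr h x‖ ≤ n * cB n lam Lam * m / ρ := by
  have hm0 : 0 ≤ m := (abs_nonneg _).trans (hm x (by simp [hρ.le]))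
  have := norm_le_coords (gr h x) (c := cB n lam Lam * m / ρ) (fun i => by
    simpa [gr] using bern_ball hB hn h hh hρ hm i) (by have := cB_pos n lam Lam; positivity)
  refine this.trans (le_of_eq (by ring))

lemma he_bound {lam Lam : ℝ} {B : Mat n} (hB : Ell lam Lam B) (hn : 0 < n) (h : Pol n)
    (hh : LP B h = 0) {m ρ : ℝ} (hρ : 0 < ρ) {x : En n} (hm : ∀ y ∈ closedBall x ρ, |ev h y| ≤ m) (i j : Fin n) :
    |he h x i j| ≤ 4 * cB n lam Lam ^ 2 * m / ρ ^ 2 := by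
  have h1 := bern_half hB hn h hh hρ hm j
  have h2 := bern_ball hB hn (pderiv j h) (by rw [pderiv_LP, hh]; simp) (half_pos hρ) h1 i
  refine (h2.trans (le_of_eq ?_))
  field_simp; try ring

lemma third_bound {lam Lam : ℝ} {B : Mat n} (hB : Ell lam Lam B) (hn : 0 < n) (h : Pol n)
    (hh : LP B h = 0) {m ρ : ℝ} (hρ : 0 < ρ) {x : En n} (hm : ∀ y ∈ closedBall x ρ, |ev h y| ≤ m) (i j k : Fin n) :
    ∀ y ∈ closedBall x (ρ / 8), |ev (pderiv i (pderiv j (pderiv k h))) y| ≤ 64 * cB n lam Lam ^ 3 * m / ρ ^ 3 := by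
  intro y hy
  have h1 := bern_half hB hn h hh hρ hm k
  have h2 := bern_half hB hn (pderiv k h) (by rw [pderiv_LP, hh]; simp) (half_pos hρ) h1 j
  have h3 := bern_half hB hn (pderiv j (pderiv k h)) (by rw [pderiv_LP, pderiv_LP, hh]; simp)
    (half_pos (half_pos hρ)) h2 i y (by
      rw [mem_closedBall] at *; linarith)
  refine (h3.trans (le_of_eq ?_))
  field_simp; try ring

/-- directional derivative -/
def Dv (v : En n) (p : Pol n) : Pol n := ∑ i, MvPolynomial.C (v i) * pderiv i p

lemma hasDeriv_line (p : Pol n) (x v : En n) (t : ℝ) :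
    HasDerivAt (fun t : ℝ => ev p (x + t • v)) (ev (Dv v p) (x + t • v)) t := by
  induction p using MvPolynomial.induction_on with
  | C a => simpa [Dv, ev_sum] using hasDerivAt_const t a
  | add p q hp hq =>
    have e : Dv v (p + q) = Dv v p + Dv v q := by simp [Dv, mul_add, Finset.sum_add_distrib]
    simp only [e, ev_add]; exact hp.add hq
  | mul_X p k hp =>
    have e : Dv v (p * MvPolynomial.X k) = Dv v p * MvPolynomial.X k + p * MvPolynomial.C (v k) := by
      simp only [Dv, Derivation.leibniz, MvPolynomial.pderiv_X, smul_eq_mul, mul_add, Finset.sum_add_distrib,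
        Finset.sum_mul]
      rw [add_comm]
      congr 1
      · refine Finset.sum_congr rfl fun i _ => by ring
      · rw [Finset.sum_eq_single k]
        · simp; ring
        · intro b _ hb; simp [Pi.single_apply, hb]
        · simp
    have h2 : HasDerivAt (fun t : ℝ => x k + t * v k) (v k) t := by
      simpa using ((hasDerivAt_id t).mul_const (v k)).const_add (x k)
    have := hp.mul h2
    simp only [e, ev_add, ev_mul, ev_X, ev_C]; exact this

lemma ev_Dv (v : En n) (p : Pol n) (x) : ev (Dv v p) x = inner ℝ (gr p x) v := by
  simp [Dv, ev_sum, inner_eq, gr, mul_comm]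

lemma ev_Dv2 (v : En n) (p : Pol n) (x) : ev (Dv v (Dv v p)) x = qf (he p x) v := by
  simp only [Dv, map_sum, MvPolynomial.pderiv_C_mul, ev_sum, ev_mul, ev_C, qf, he, Matrix.of_apply, Finset.mul_sum]
  refine Finset.sum_congr rfl fun i _ => Finset.sum_congr rfl fun j _ => by ring

lemma ev_Dv3_bound (v : En n) (p : Pol n) (x) {K : ℝ} (hK : ∀ i j k, |ev (pderiv i (pderiv j (pderiv k p))) x| ≤ K) :
    |ev (Dv v (Dv v (Dv v p))) x| ≤ n ^ 3 * K * ‖v‖ ^ 3 := by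
  have e : ev (Dv v (Dv v (Dv v p))) x = ∑ i, ∑ j, ∑ k, v i * (v j * (v k * ev (pderiv i (pderiv j (pderiv k p))) x)) := by
    simp only [Dv, map_sum, MvPolynomial.pderiv_C_mul, ev_sum, ev_mul, ev_C, Finset.mul_sum]
  rw [e]
  calc _ ≤ ∑ i, ∑ j, ∑ k, |v i * (v j * (v k * ev (pderiv i (pderiv j (pderiv k p))) x))| :=
        (Finset.abs_sum_le_sum_abs _ _).trans (Finset.sum_le_sum fun i _ =>
          (Finset.abs_sum_le_sum_abs _ _).trans (Finset.sum_le_sum fun j _ => Finset.abs_sum_le_sum_abs _ _))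
    _ ≤ ∑ i : Fin n, ∑ j : Fin n, ∑ k : Fin n, ‖v‖ * (‖v‖ * (‖v‖ * K)) := by
        refine Finset.sum_le_sum fun i _ => Finset.sum_le_sum fun j _ => Finset.sum_le_sum fun k _ => ?_
        rw [abs_mul, abs_mul, abs_mul]
        gcongr
        · exact abs_coord v i
        · exact abs_coord v j
        · exact abs_coord v k
        · exact hK i j k
    _ = _ := by simp; ring

lemma taylor1D {f f1 f2 f3 : ℝ → ℝ} (h0 : ∀ t, HasDerivAt f (f1 t) t) (h1 : ∀ t, HasDerivAt f1 (f2 t) t)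
    (h2 : ∀ t, HasDerivAt f2 (f3 t) t) {K : ℝ} (hK : ∀ t ∈ Icc (0:ℝ) 1, |f3 t| ≤ K) :
    |f 1 - f 0 - f1 0 - f2 0 / 2| ≤ K := by
  have hK0 : 0 ≤ K := (abs_nonneg _).trans (hK 0 (by simp))
  have gen : ∀ (φ ψ : ℝ → ℝ), (∀ t, HasDerivAt φ (ψ t) t) → (∀ t ∈ Icc (0:ℝ) 1, |ψ t| ≤ K) →
      ∀ t ∈ Icc (0:ℝ) 1, |φ t - φ 0| ≤ K := by
    intro φ ψ hd hb t ht
    have := (convex_Icc (0:ℝ) 1).norm_image_sub_le_of_norm_hasDerivWithin_le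
      (fun t _ => (hd t).hasDerivWithinAt) (fun t ht => hb t ht) (left_mem_Icc.2 zero_le_one) ht
    rw [Real.norm_eq_abs, Real.norm_eq_abs] at this
    refine this.trans ?_
    have : |t - 0| ≤ 1 := by rw [sub_zero, abs_of_nonneg ht.1]; exact ht.2
    nlinarith
  have s1 := gen f2 f3 h2 hK
  have s2 := gen (fun t => f1 t - t * f2 0) (fun t => f2 t - f2 0)
    (fun t => by
      have e := (h1 t).sub ((hasDerivAt_id t).mul_const (f2 0))
      exact e.congr_deriv (by simp)) s1
  have s3 := gen (fun t => f t - t * f1 0 - t ^ 2 / 2 * f2 0) (fun t => f1 t - t * f2 0 - f1 0)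
    (fun t => by
      have e := ((h0 t).sub ((hasDerivAt_id t).mul_const (f1 0))).sub
        (((hasDerivAt_pow 2 t).div_const 2).mul_const (f2 0))
      refine e.congr_deriv ?_
      simp; ring) (fun t ht => by simpa using s2 t ht) 1 (by simp)
  refine le_trans (le_of_eq ?_) s3
  congr 1; ring

lemma harm_taylor {lam Lam : ℝ} {B : Mat n} (hB : Ell lam Lam B) (hn : 0 < n) (h : Pol n)
    (hh : LP B h = 0) {m ρ : ℝ} (hρ : 0 < ρ) {x : En n} (hm : ∀ y ∈ closedBall x ρ, |ev h y| ≤ m) :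
    ∀ y ∈ closedBall x (ρ / 8), |ev h y - ev h x - inner ℝ (gr h x) (y - x) - qf (he h x) (y - x) / 2|
      ≤ 64 * n ^ 3 * cB n lam Lam ^ 3 * m * ‖y - x‖ ^ 3 / ρ ^ 3 := by
  intro y hy
  rw [mem_closedBall_iff_norm] at hy
  set v := y - x with hv
  have := taylor1D (hasDeriv_line h x v) (hasDeriv_line _ x v) (hasDeriv_line _ x v)
    (K := n ^ 3 * (64 * cB n lam Lam ^ 3 * m / ρ ^ 3) * ‖v‖ ^ 3) (by
      intro t ht
      apply ev_Dv3_bound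
      intro i j k
      apply third_bound hB hn h hh hρ hm
      rw [mem_closedBall_iff_norm]
      simp only [add_sub_cancel_left, norm_smul, Real.norm_eq_abs, abs_of_nonneg ht.1]
      nlinarith [ht.1, ht.2, norm_nonneg v])
  simp only [one_smul, zero_smul, add_zero, ev_Dv2] at this
  rw [ev_Dv] at this
  have e : x + v = y := by simp [hv]
  rw [e] at this
  refine this.trans (le_of_eq (by ring))

end

section

open scoped Topology
open MvPolynomial (pderiv)

variable {n : ℕ}

/-- quadratic polynomial centered at `z` -/
def qp (z : En n) (c : ℝ) (b : En n) (A : Mat n) : Pol n :=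
  MvPolynomial.C c + ∑ i, MvPolynomial.C (b i) * (MvPolynomial.X i - MvPolynomial.C (z i))
   + MvPolynomial.C (1/2) * ∑ i, ∑ j, MvPolynomial.C (A i j) *
      ((MvPolynomial.X i - MvPolynomial.C (z i)) * (MvPolynomial.X j - MvPolynomial.C (z j)))

lemma ev_qp (z : En n) (c : ℝ) (b : En n) (A : Mat n) (y) :
    ev (qp z c b A) y = c + inner ℝ b (y - z) + qf A (y - z) / 2 := by
  simp only [qp, ev_add, ev_sum, ev_mul, ev_sub, ev_C, ev_X, inner_eq, qf]
  have : ∀ i, (y - z) i = y i - z i := fun i => rfl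
  simp only [this, mul_assoc]
  ring

lemma pderiv_qp (z : En n) (c : ℝ) (b : En n) (A : Mat n) (hA : A.IsSymm) (k : Fin n) :
    pderiv k (qp z c b A) = MvPolynomial.C (b k) + ∑ j, MvPolynomial.C (A k j) * (MvPolynomial.X j - MvPolynomial.C (z j)) := by
  have hA' : ∀ i j, A i j = A j i := fun i j => by
    conv_lhs => rw [← hA]
    rfl
  have hs : ∀ i, (Pi.single (M := fun _ => Pol n) k (1 : Pol n) i) = if i = k then 1 else 0 := by
    intro i; by_cases h : i = k
    · subst h; simp
    · simp [Pi.single_apply, h, Ne.symm h]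
  simp only [qp, map_add, map_sum, MvPolynomial.pderiv_C_mul, map_sub, MvPolynomial.pderiv_C, MvPolynomial.pderiv_X,
    Derivation.leibniz, smul_eq_mul, sub_zero, zero_add, hs, mul_add, Finset.sum_add_distrib, mul_ite, mul_one, mul_zero,
    Finset.sum_ite_eq', Finset.mem_univ, if_true, Finset.sum_const_zero, add_zero]
  congr 1
  have e : ∑ x, ∑ y, (if x = k then MvPolynomial.C (A x y) * (MvPolynomial.X y - MvPolynomial.C (z y)) else (0 : Pol n))
     = ∑ j, MvPolynomial.C (A k j) * (MvPolynomial.X j - MvPolynomial.C (z j)) := by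
    rw [Finset.sum_eq_single k]
    · simp
    · intro b _ hb; simp [hb]
    · simp
  have e2 : ∑ x, MvPolynomial.C (A x k) * (MvPolynomial.X x - MvPolynomial.C (z x))
     = ∑ j, MvPolynomial.C (A k j) * (MvPolynomial.X j - MvPolynomial.C (z j) : Pol n) := by
    refine Finset.sum_congr rfl fun i _ => by rw [hA' i k]
  rw [e, e2, ← mul_add, ← two_mul, ← mul_assoc]
  have : (MvPolynomial.C (1/2) * 2 : Pol n) = 1 := by
    rw [← map_ofNat MvPolynomial.C 2, ← map_mul]; norm_num
  rw [this, one_mul]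

lemma gr_qp (z : En n) (c : ℝ) (b : En n) (A : Mat n) (hA : A.IsSymm) (y) :
    gr (qp z c b A) y = b + mv A (y - z) := by
  ext i
  simp only [gr, pderiv_qp z c b A hA, ev_add, ev_sum, ev_mul, ev_sub, ev_C, ev_X]
  rfl

lemma he_qp (z : En n) (c : ℝ) (b : En n) (A : Mat n) (hA : A.IsSymm) (y) :
    he (qp z c b A) y = A := by
  ext i j
  have hA' : ∀ i j, A i j = A j i := fun i j => by
    conv_lhs => rw [← hA]
    rfl
  have hs : ∀ k, (Pi.single (M := fun _ => Pol n) i (1 : Pol n) k) = if k = i then 1 else 0 := by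
    intro k; by_cases h : k = i
    · subst h; simp
    · simp [Pi.single_apply, h, Ne.symm h]
  simp only [he, Matrix.of_apply, pderiv_qp z c b A hA, map_add, map_sum, MvPolynomial.pderiv_C_mul, map_sub, MvPolynomial.pderiv_C,
    MvPolynomial.pderiv_X, hs, sub_zero, zero_add, mul_ite, mul_one, mul_zero, Finset.sum_ite_eq', Finset.mem_univ, if_true, ev_C]
  exact hA' j i

lemma LP_qp (B : Mat n) (z : En n) (c : ℝ) (b : En n) (A : Mat n) (hA : A.IsSymm) :
    LP B (qp z c b A) = MvPolynomial.C (LB B A) := by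
  apply MvPolynomial.funext
  intro x
  have := ev_LP B (qp z c b A) (WithLp.toLp 2 x)
  rw [he_qp z c b A hA] at this
  simpa [ev] using this

lemma harm_repl {lam Lam : ℝ} {B : Mat n} (hB : Ell lam Lam B) (hn : 0 < n) {x : En n} {ρ : ℝ} (hρ : 0 < ρ)
    {w : En n → ℝ} (hw : ContinuousOn w (closedBall x ρ)) {b : En n → ℝ} (hb : ContinuousOn b (closedBall x ρ))
    (h1 : Sub B (fun y => w y + b y) (fun _ => 0) (ball x ρ))
    (h2 : Sub B (fun y => - w y + b y) (fun _ => 0) (ball x ρ))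
    {β η : ℝ} (hβ : ∀ y ∈ closedBall x ρ, |b y - b x| ≤ β) (hη : 0 < η) :
    ∃ h : Pol n, LP B h = 0 ∧ ∀ y ∈ closedBall x ρ, |w y - ev h y| ≤ 2 * β + η := by
  obtain ⟨h, hh, hs⟩ := harm_approx hB hn hρ (hw.mono sphere_subset_closedBall) hη
  refine ⟨h, hh, fun y hy => ?_⟩
  have hhn : LP B (-h) = 0 := by
    have : -h = MvPolynomial.C (-1) * h := by simp
    rw [this, LP_C_mul, hh, mul_zero]
  have m1 := max_principle hB hn hρ (w := fun y => w y + b y + ev (-h) y)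
    ((hw.add hb).add (ev_cont _).continuousOn)
    (by simpa [hhn] using h1.add_poly (-h)) (m := η + (b x + β)) (by
      intro t ht
      have := abs_le.1 (hs t ht)
      have := abs_le.1 (hβ t (sphere_subset_closedBall ht))
      simp only [ev_neg]
      linarith) y hy
  have m2 := max_principle hB hn hρ (w := fun y => -w y + b y + ev h y)
    ((hw.neg.add hb).add (ev_cont _).continuousOn)
    (by simpa [hh] using h2.add_poly h) (m := η + (b x + β)) (by
      intro t ht
      have := abs_le.1 (hs t ht)
      have := abs_le.1 (hβ t (sphere_subset_closedBall ht))
      linarith) y hy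
  have := abs_le.1 (hβ y hy)
  simp only [ev_neg] at m1 m2
  rw [abs_le]; constructor <;> linarith

lemma grad_general {lam Lam : ℝ} {B : Mat n} (hB : Ell lam Lam B) (hn : 0 < n) {x g : En n} {ρ m P : ℝ} (hρ : 0 < ρ)
    {w : En n → ℝ} (hm : ∀ y ∈ closedBall x ρ, |w y| ≤ m) (hg : HasGradientAt w g x)
    {e Ψ : ℕ → ℝ} (he0 : ∀ k, 0 ≤ e k)
    (hp : ∀ k, ∃ p : Pol n, LP B p = 0 ∧ ∀ y ∈ closedBall x (ρ / 2 ^ k), |w y - ev p y| ≤ e k)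
    (het : Tendsto (fun k => e k / (ρ / 2 ^ k)) atTop (𝓝 0))
    (hstep : ∀ k, (e k + e (k+1)) / (ρ / 2 ^ (k+1)) ≤ Ψ (k+1) - Ψ k) (h0 : 0 ≤ Ψ 0) (hP : ∀ k, Ψ k ≤ P) :
    ‖g‖ ≤ n * cB n lam Lam * ((m + e 0) / ρ + P) := by
  choose p hp1 hp2 using hp
  set K := n * cB n lam Lam with hK
  have hK0 : 0 < K := by have := cB_pos n lam Lam; have : (0:ℝ) < n := by exact_mod_cast hn
                         positivity
  have hind : ∀ k, ‖gr (p k) x‖ ≤ K * ((m + e 0) / ρ + Ψ k) := by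
    intro k
    induction k with
    | zero =>
      have := gr_bound hB hn (p 0) (hp1 0) hρ (x := x) (m := m + e 0) (by
        intro y hy
        have h1 := hp2 0 y (by simpa using hy)
        have h2 := hm y hy
        rw [abs_le] at *; constructor <;> linarith)
      refine this.trans ?_
      rw [mul_div_assoc]
      gcongr; linarith
    | succ k ih =>
      have hσ : 0 < ρ / 2 ^ (k+1) := by positivity
      have := gr_bound hB hn (p (k+1) - p k) (by rw [LP_sub, hp1, hp1, sub_zero]) hσ (x := x) (m := e k + e (k+1)) (by
        intro y hy
        have h1 := hp2 (k+1) y hy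
        have h2 := hp2 k y (closedBall_subset_closedBall (by
          gcongr <;> norm_num) hy)
        rw [ev_sub]
        rw [abs_le] at *; constructor <;> linarith)
      rw [gr_sub, mul_div_assoc] at this
      have h3 : ‖gr (p (k+1)) x‖ ≤ ‖gr (p (k+1)) x - gr (p k) x‖ + ‖gr (p k) x‖ := by
        simpa using norm_add_le (gr (p (k+1)) x - gr (p k) x) (gr (p k) x)
      have h4 := mul_le_mul_of_nonneg_left (hstep k) hK0.le
      nlinarith
  have key : ∀ ε > 0, ‖g‖ ≤ K * ((m + e 0) / ρ + P) + K * (2 * ε) := by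
    intro ε hε
    have hg' := hg.hasFDerivAt.isLittleO
    have hg'' := hg'.def hε
    rw [Metric.eventually_nhds_iff_ball] at hg''
    obtain ⟨δ, hδ, hδ2⟩ := hg''
    have ht : Tendsto (fun k : ℕ => ρ / 2 ^ k) atTop (𝓝 0) := by
      have := (tendsto_pow_atTop_nhds_zero_of_lt_one (r := (1/2:ℝ)) (by norm_num) (by norm_num)).const_mul ρ
      simpa [div_eq_mul_inv] using this
    obtain ⟨k, hk1, hk2⟩ := ((ht.eventually (gt_mem_nhds hδ)).and (het.eventually (gt_mem_nhds hε))).exists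
    have hσ : 0 < ρ / 2 ^ k := by positivity
    have := gr_bound hB hn (p k - qp x (w x) g 0) (by
      rw [LP_sub, hp1, LP_qp _ _ _ _ _ Matrix.isSymm_zero, LB_zero]; simp) hσ (x := x) (m := e k + ε * (ρ / 2 ^ k)) (by
        intro y hy
        have h1 := hp2 k y hy
        have hyn : ‖y - x‖ ≤ ρ / 2 ^ k := by rwa [mem_closedBall_iff_norm] at hy
        have h2 := hδ2 y (by rw [mem_ball_iff_norm]; linarith)
        have h3 : |w y - w x - inner ℝ g (y - x)| ≤ ε * (ρ / 2 ^ k) := by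
          refine le_trans ?_ (h2.trans (by gcongr))
          simp [InnerProductSpace.toDual_apply_apply]
        rw [ev_sub, ev_qp, qf_zero]
        rw [abs_le] at *; constructor <;> linarith)
    rw [gr_sub, gr_qp _ _ _ _ Matrix.isSymm_zero] at this
    have e0 : mv (0 : Mat n) (x - x) = 0 := by ext i; simp [mv]
    rw [e0, add_zero, mul_div_assoc] at this
    have h5 : (e k + ε * (ρ / 2 ^ k)) / (ρ / 2 ^ k) ≤ 2 * ε := by
      rw [add_div, mul_div_cancel_right₀ _ hσ.ne']; linarith
    have h6 : ‖g‖ ≤ ‖gr (p k) x‖ + ‖gr (p k) x - g‖ := by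
      have := norm_sub_le (gr (p k) x) (gr (p k) x - g)
      simpa using this
    have h7 := mul_le_mul_of_nonneg_left h5 hK0.le
    have h8 : K * ((m + e 0) / ρ + Ψ k) ≤ K * ((m + e 0) / ρ + P) := by
      gcongr; exact hP k
    linarith [hind k]
  apply le_of_forall_pos_le_add
  intro ε hε
  have := key (ε / (2 * K)) (by positivity)
  refine this.trans (le_of_eq ?_)
  field_simp

/-- constant of the gradient lemma -/
def cG (n : ℕ) (lam Lam Cb s : ℝ) : ℝ :=
  n * cB n lam Lam * (1 + (2 * Cb + 1 / (n * lam) + 1) * (4 / ((2:ℝ) ^ (1 - s) - 1) + 21))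

lemma Sub_quad {lam Lam : ℝ} {B : Mat n} (hB : Ell lam Lam B) (hn : 0 < n) {w f : En n → ℝ} {D : Set (En n)}
    (h : Sub B w f D) (hf : ∀ y ∈ D, -1 ≤ f y) (x : En n) :
    Sub B (fun y => w y + (1 / (2 * (n * lam))) * ‖y - x‖ ^ 2) (fun _ => 0) D := by
  have hnl : 0 < n * lam := mul_pos (by exact_mod_cast hn) hB.lam_pos
  refine (h.add (k := fun _ => 1) fun t _ => ⟨_, _, ?_, ?_, UJ.neg_normsq (1 / (2 * (n * lam))) x t⟩).mono subset_rfl ?_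
  · exact Matrix.isSymm_one.smul _
  · rw [LB_smul]
    have := hB.tr_lower
    have e : 2 * (1 / (2 * (n * lam))) = 1 / (n * lam) := by field_simp
    rw [e, one_div, ← div_eq_inv_mul, le_div_iff₀ hnl]; linarith
  · intro y hy; have := hf y hy; linarith

set_option maxHeartbeats 1000000 in
lemma lemG {lam Lam : ℝ} {B : Mat n} (hB : Ell lam Lam B) (hn : 0 < n) {x g : En n} {ρ m κ s Cb : ℝ} (hρ : 0 < ρ)
    (hκ : 0 < κ) (hs0 : 0 < s) (hs1 : s < 1) (hCb : 0 ≤ Cb)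
    {w f b : En n → ℝ} (hw : ContinuousOn w (closedBall x ρ)) (hm : ∀ y ∈ closedBall x ρ, |w y| ≤ m)
    (hg : HasGradientAt w g x)
    (hf : ∀ y ∈ ball x ρ, |f y| ≤ 1) (h1 : Sub B w f (ball x ρ)) (h2 : Sub B (fun y => - w y) (fun y => - f y) (ball x ρ))
    (hb : Continuous b) (hbh : ∀ y, |b y - b x| ≤ Cb * (κ ^ (2 - s) * ‖y - x‖ ^ s))
    (hb1 : Sub B (fun y => w y + b y) (fun _ => 0) (ball x ρ))
    (hb2 : Sub B (fun y => - w y + b y) (fun _ => 0) (ball x ρ)) :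
    ‖g‖ ≤ cG n lam Lam Cb s * (m / ρ + κ) := by
  have hnl : 0 < n * lam := mul_pos (by exact_mod_cast hn) hB.lam_pos
  set H : ℝ → ℝ := fun σ => κ ^ (2 - s) * σ ^ s with hH
  have hHpos : ∀ σ, 0 < σ → 0 < H σ := fun σ hσ => by simp only [hH]; positivity
  set a : ℝ := (2:ℝ) ^ (1 - s) with ha
  have ha1 : 1 < a := Real.one_lt_rpow (by norm_num) (by linarith)
  have ha2 : a ≤ 2 := by
    have := Real.rpow_le_rpow_of_exponent_le (x := 2) (by norm_num) (show 1 - s ≤ 1 by linarith)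
    simpa using this
  have hHhalf : ∀ σ, 0 < σ → H (σ / 2) = a * H σ / 2 := by
    intro σ hσ
    simp only [hH, ha]
    rw [Real.div_rpow hσ.le (by norm_num), Real.rpow_sub (x := 2) (by norm_num), Real.rpow_one]
    ring
  have hHle : ∀ σ, κ ≤ σ → H σ ≤ κ * σ := by
    intro σ hσ
    have hσ0 : 0 < σ := hκ.trans_le hσ
    calc H σ = κ * (κ ^ (1 - s) * σ ^ s) := by
          simp only [hH]; rw [show 2 - s = 1 + (1 - s) by ring, Real.rpow_add hκ, Real.rpow_one]; ring
      _ ≤ κ * (σ ^ (1 - s) * σ ^ s) := by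
          have : κ ^ (1 - s) ≤ σ ^ (1 - s) := Real.rpow_le_rpow hκ.le hσ (by linarith)
          gcongr
      _ = κ * σ := by rw [← Real.rpow_add hσ0]; simp
  set Ce := 2 * Cb + 1 / (n * lam) + 1 with hCe
  have hCe0 : 0 < Ce := by positivity
  set σ : ℕ → ℝ := fun k => ρ / 2 ^ k with hσ
  have hσpos : ∀ k, 0 < σ k := fun k => by simp only [hσ]; positivity
  have hσs : ∀ k, σ (k+1) = σ k / 2 := fun k => by simp only [hσ, pow_succ]; field_simp
  set e : ℕ → ℝ := fun k => Ce * min (H (σ k)) (σ k ^ 2) with he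
  set T : ℝ → ℝ := fun t => H t / t with hT
  have hThalf : ∀ t, 0 < t → T (t / 2) = a * T t := by
    intro t ht; simp only [hT]; rw [hHhalf t ht]; field_simp
  have hTpos : ∀ t, 0 < t → 0 < T t := fun t ht => div_pos (hHpos t ht) ht
  have hTle : ∀ t, κ ≤ t → T t ≤ κ := by
    intro t ht; simp only [hT]; rw [div_le_iff₀ (hκ.trans_le ht)]; exact hHle t ht
  set c1 := 4 * Ce / (a - 1) with hc1
  have hc10 : 0 < c1 := div_pos (by positivity) (by linarith)
  have hc1e : c1 * (a - 1) = 4 * Ce := by rw [hc1]; field_simp [show a - 1 ≠ 0 by linarith]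
  set Ψ : ℕ → ℝ := fun k => c1 * min (T (σ k)) κ + 5 * Ce * max (4 * κ - σ k) 0 with hΨ
  have main := grad_general hB hn hρ hm hg (e := e) (Ψ := Ψ) (P := c1 * κ + 20 * Ce * κ)
    (fun k => by have := hHpos _ (hσpos k); have := hσpos k; simp only [he]; positivity)
    (by
      intro k
      have hsub : closedBall x (σ k) ⊆ closedBall x ρ := closedBall_subset_closedBall (by
        simp only [hσ]; exact div_le_self hρ.le (one_le_pow₀ (by norm_num)))
      have hsubo : ball x (σ k) ⊆ ball x ρ := ball_subset_ball (by
        simp only [hσ]; exact div_le_self hρ.le (one_le_pow₀ (by norm_num)))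
      have hσk := hσpos k
      have hHk := hHpos _ hσk
      rcases le_total (H (σ k)) (σ k ^ 2) with hc | hc
      · obtain ⟨p, hp, hp2⟩ := harm_repl hB hn hσk (hw.mono hsub) hb.continuousOn (hb1.mono hsubo fun _ _ => le_rfl)
          (hb2.mono hsubo fun _ _ => le_rfl) (β := Cb * H (σ k)) (η := H (σ k)) (by
            intro y hy
            refine (hbh y).trans ?_
            simp only [hH]
            rw [mem_closedBall_iff_norm] at hy
            gcongr) hHk
        refine ⟨p, hp, fun y hy => (hp2 y hy).trans ?_⟩
        simp only [he, min_eq_left hc, hCe]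
        have : 0 ≤ 1 / (n * lam) * H (σ k) := by positivity
        nlinarith
      · obtain ⟨p, hp, hp2⟩ := harm_repl hB hn hσk (hw.mono hsub) (b := fun y => (1 / (2 * (n * lam))) * ‖y - x‖ ^ 2)
          (by fun_prop)
          (Sub_quad hB hn (h1.mono hsubo fun _ _ => le_rfl) (fun y hy => (abs_le.1 (hf y (hsubo hy))).1) x)
          (Sub_quad hB hn (h2.mono hsubo fun _ _ => le_rfl) (fun y hy => by
            have := (abs_le.1 (hf y (hsubo hy))).2
            linarith) x)
          (β := 1 / (2 * (n * lam)) * σ k ^ 2) (η := σ k ^ 2) (by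
            intro y hy
            rw [mem_closedBall_iff_norm] at hy
            simp only [sub_self, norm_zero, ne_eq, OfNat.ofNat_ne_zero, not_false_eq_true, zero_pow, mul_zero, sub_zero]
            rw [abs_of_nonneg (by positivity)]
            have : ‖y - x‖ ^ 2 ≤ σ k ^ 2 := by gcongr
            have h3 : (1 / (2 * (n * lam))) * ‖y - x‖ ^ 2 ≤ (1 / (2 * (n * lam))) * σ k ^ 2 := by gcongr
            exact h3) (by positivity)
        refine ⟨p, hp, fun y hy => (hp2 y hy).trans ?_⟩
        simp only [he, min_eq_right hc, hCe]
        have e1 : 2 * (1 / (2 * (n * lam)) * σ k ^ 2) = 1 / (n * lam) * σ k ^ 2 := by field_simp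
        rw [e1]
        have : 0 ≤ Cb * σ k ^ 2 := by positivity
        nlinarith)
    (by
      have ht : Tendsto (fun k : ℕ => Ce * (ρ / 2 ^ k)) atTop (𝓝 0) := by
        have := (tendsto_pow_atTop_nhds_zero_of_lt_one (r := (1/2:ℝ)) (by norm_num) (by norm_num)).const_mul (Ce * ρ)
        simpa [div_eq_mul_inv, mul_assoc] using this
      refine squeeze_zero (fun k => ?_) (fun k => ?_) ht
      · have h1 := hHpos _ (hσpos k); have h2 := hσpos k
        change 0 ≤ e k / σ k
        simp only [he]; positivity
      · have := hσpos k
        change e k / σ k ≤ Ce * σ k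
        rw [div_le_iff₀ this]
        have := min_le_right (H (σ k)) (σ k ^ 2)
        simp only [he]
        nlinarith)
    (by
      intro k
      change (e k + e (k+1)) / σ (k+1) ≤ _
      have hk := hσpos k
      have hHk := hHpos _ hk
      rw [div_le_iff₀ (hσpos _)]
      simp only [he, hΨ, hσs]
      set t := σ k
      have hTt : H t = T t * t := by simp only [hT]; field_simp
      have hTp := hTpos t hk
      rw [hHhalf t hk, hThalf t hk, hTt]
      have hmono : min (T t) κ ≤ min (a * T t) κ := by
        apply min_le_min_right; nlinarith
      rcases le_total (4 * κ) t with hc | hc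
      · have hTt2 := hTle t (by linarith)
        have hTt3 := hTle (t/2) (by linarith)
        rw [hThalf t hk] at hTt3
        rw [min_eq_left hTt2, min_eq_left hTt3, max_eq_right (by linarith : 4 * κ - t ≤ 0)]
        have b1 := min_le_left (T t * t) (t ^ 2)
        have b2 := min_le_left (a * (T t * t) / 2) ((t / 2) ^ 2)
        have b3 := le_max_right (4 * κ - t / 2) 0
        have b4 : c1 * (a * T t) - c1 * T t = 4 * Ce * T t := by rw [← hc1e]; ring
        have b5 : 0 < T t * t := by positivity
        have b6 : a * (T t * t) / 2 ≤ T t * t := by nlinarith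
        have b7 : Ce * (min (T t * t) (t ^ 2)) + Ce * (min (a * (T t * t) / 2) ((t / 2) ^ 2)) ≤ Ce * (2 * (T t * t)) := by
          rw [← mul_add]; gcongr; linarith
        have b8 : 0 ≤ 5 * Ce * max (4 * κ - t / 2) 0 * (t / 2) := by positivity
        nlinarith
      · rw [max_eq_left (by linarith : 0 ≤ 4 * κ - t), max_eq_left (by linarith : 0 ≤ 4 * κ - t / 2)]
        have b1 := min_le_right (T t * t) (t ^ 2)
        have b2 := min_le_right (a * (T t * t) / 2) ((t / 2) ^ 2)
        have b7 : Ce * (min (T t * t) (t ^ 2)) + Ce * (min (a * (T t * t) / 2) ((t / 2) ^ 2)) ≤ Ce * (5 / 4 * t ^ 2) := by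
          rw [← mul_add]; gcongr; nlinarith
        have b8 : 0 ≤ c1 * (min (a * T t) κ - min (T t) κ) * (t / 2) := by
          have := sub_nonneg.2 hmono
          positivity
        nlinarith)
    (by have := hTpos _ (hσpos 0); simp only [hΨ]; positivity)
    (by
      intro k
      have b1 := min_le_right (T (σ k)) κ
      have b2 : max (4 * κ - σ k) 0 ≤ 4 * κ := max_le (by linarith [hσpos k]) (by linarith)
      have b3 : c1 * min (T (σ k)) κ ≤ c1 * κ := by gcongr
      have b4 : 5 * Ce * max (4 * κ - σ k) 0 ≤ 5 * Ce * (4 * κ) := by gcongr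
      simp only [hΨ]; linarith)
  have he0 : e 0 / ρ ≤ Ce * κ := by
    rw [div_le_iff₀ hρ]
    have e0 : σ 0 = ρ := by simp [hσ]
    simp only [he, e0]
    rcases le_total κ ρ with hc | hc
    · have := hHle ρ hc
      have := min_le_left (H ρ) (ρ ^ 2)
      rw [mul_assoc]; gcongr; linarith
    · have := min_le_right (H ρ) (ρ ^ 2)
      rw [mul_assoc]; gcongr; nlinarith
  have hK0 : 0 < n * cB n lam Lam := by
    have := cB_pos n lam Lam; have : (0:ℝ) < n := by exact_mod_cast hn
    positivity
  refine main.trans ?_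
  unfold cG
  rw [mul_assoc (n * cB n lam Lam)]
  refine mul_le_mul_of_nonneg_left ?_ hK0.le
  rw [← hCe, ← ha, add_div]
  have hm0 : 0 ≤ m := (abs_nonneg _).trans (hm x (by simp [hρ.le]))
  have hmρ : 0 ≤ m / ρ := by positivity
  have e1 : c1 = Ce * (4 / (a - 1)) := by rw [hc1]; ring
  have : 0 < 4 / (a - 1) := div_pos (by norm_num) (by linarith)
  have : 0 ≤ Ce * (4 / (a - 1) + 21) * (m / ρ) := by positivity
  rw [e1]
  nlinarith

end

section

open scoped Topology

variable {n : ℕ}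

/-- rank-one matrix -/
def op (e : En n) : Mat n := Matrix.of fun i j => e i * e j

lemma op_symm (e : En n) : (op e).IsSymm := by ext i j; simp [op, mul_comm]

lemma qf_op (e v : En n) : qf (op e) v = inner ℝ e v ^ 2 := by
  rw [inner_eq, sq, Finset.sum_mul_sum]
  simp only [qf, op, Matrix.of_apply]
  refine Finset.sum_congr rfl fun i _ => Finset.sum_congr rfl fun j _ => by ring

lemma LB_op (B : Mat n) (e : En n) : LB B (op e) = qf B e := by
  simp only [qf, LB, op, Matrix.of_apply]
  refine Finset.sum_congr rfl fun i _ => Finset.sum_congr rfl fun j _ => by ring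

lemma taylor2 {φ φ1 : ℝ → ℝ} {t0 a2 : ℝ} (h1 : ∀ᶠ t in 𝓝 t0, HasDerivAt φ (φ1 t) t) (h2 : HasDerivAt φ1 a2 t0)
    {ε : ℝ} (hε : 0 < ε) :
    ∀ᶠ t in 𝓝 t0, |φ t - φ t0 - φ1 t0 * (t - t0) - a2 / 2 * (t - t0) ^ 2| ≤ ε * (t - t0) ^ 2 := by
  have h3 := h2.hasFDerivAt.isLittleO.def hε
  obtain ⟨δ, hδ, H⟩ := Metric.eventually_nhds_iff_ball.1 (h1.and h3)
  filter_upwards [ball_mem_nhds t0 hδ] with t ht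
  have hsub : closedBall t0 |t - t0| ⊆ ball t0 δ := by
    apply closedBall_subset_ball; simpa [Real.dist_eq] using ht
  have := (convex_closedBall t0 |t - t0|).norm_image_sub_le_of_norm_hasDerivWithin_le
    (f := fun t => φ t - φ1 t0 * (t - t0) - a2 / 2 * (t - t0) ^ 2)
    (f' := fun t => φ1 t - φ1 t0 - a2 * (t - t0)) (C := ε * |t - t0|)
    (x := t0) (y := t)
    (fun r hr => by
      have e := ((H r (hsub hr)).1.sub (((hasDerivAt_id r).sub_const t0).const_mul (φ1 t0))).sub
        ((((hasDerivAt_id r).sub_const t0).pow 2).const_mul (a2 / 2))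
      refine (e.congr_deriv ?_).hasDerivWithinAt
      simp; ring)
    (fun r hr => by
      have e := (H r (hsub hr)).2
      simp only [ContinuousLinearMap.toSpanSingleton_apply, smul_eq_mul] at e
      rw [mul_comm a2]
      refine e.trans ?_
      have : ‖r - t0‖ ≤ |t - t0| := by simpa [Real.dist_eq] using hr
      gcongr)
    (by simp) (by simp [Real.dist_eq])
  simp only [sub_self, mul_zero, Real.norm_eq_abs, sub_zero, ne_eq, OfNat.ofNat_ne_zero, not_false_eq_true, zero_pow] at this
  rw [mul_assoc, ← sq, sq_abs] at this
  refine le_trans (le_of_eq ?_) this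
  congr 1; ring

lemma jet_comp {q : En n → ℝ} {x p : En n} {S : Mat n} {φ φ1 : ℝ → ℝ} {a2 : ℝ}
    (hq : ∀ y, q y = q x + inner ℝ p (y - x) + qf S (y - x) / 2)
    (h1 : ∀ᶠ t in 𝓝 (q x), HasDerivAt φ (φ1 t) t) (h2 : HasDerivAt φ1 a2 (q x)) :
    UJ (fun y => - φ (q y)) x (-(φ1 (q x) • p)) (-(φ1 (q x) • S + a2 • op p)) := by
  obtain ⟨c, hc⟩ : ∃ c, ∀ i j, |S i j| ≤ c := by
    refine ⟨∑ i, ∑ j, |S i j|, fun i j => ?_⟩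
    exact (Finset.single_le_sum (f := fun j => |S i j|) (fun _ _ => abs_nonneg _)
        (Finset.mem_univ j)).trans (Finset.single_le_sum (f := fun i => ∑ j, |S i j|)
          (fun _ _ => Finset.sum_nonneg fun _ _ => abs_nonneg _) (Finset.mem_univ i))
  set K := max (n ^ 2 * c) (max ‖p‖ 1) with hK
  have hK1 : 1 ≤ K := (le_max_right _ _).trans (le_max_right _ _)
  have hKp : ‖p‖ ≤ K := (le_max_left _ _).trans (le_max_right _ _)
  have hKc : n ^ 2 * c ≤ K := le_max_left _ _
  intro ε hε
  have hqc : Tendsto q (𝓝 x) (𝓝 (q x)) := by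
    have : Continuous q := by
      have e : q = fun y => q x + inner ℝ p (y - x) + qf S (y - x) / 2 := funext hq
      rw [e]; unfold qf; fun_prop
    exact this.tendsto x
  have hε' : 0 < ε / (8 * K ^ 2) := by positivity
  have hn : ∀ᶠ y in 𝓝 x, ‖y - x‖ < min 1 (ε / (4 * K ^ 2 * (|a2| + 1))) := by
    have : Tendsto (fun y => ‖y - x‖) (𝓝 x) (𝓝 0) := by
      have : Continuous fun y : En n => ‖y - x‖ := by fun_prop
      simpa using this.tendsto x
    exact this.eventually (gt_mem_nhds (by positivity))
  filter_upwards [hqc.eventually (taylor2 h1 h2 hε'), hn] with y hy hv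
  set v := y - x with hvd
  set r := ‖v‖ with hr
  have hr0 : 0 ≤ r := norm_nonneg _
  have hr1 : r ≤ 1 := hv.le.trans (min_le_left _ _)
  have hr2 : r * (4 * K ^ 2 * (|a2| + 1)) ≤ ε := by
    have := hv.le.trans (min_le_right _ _)
    rwa [le_div_iff₀ (by positivity)] at this
  set l := inner ℝ p v with hl
  set Q := qf S v / 2 with hQ
  have hl1 : |l| ≤ K * r := (abs_real_inner_le_norm p v).trans (by gcongr)
  have hQ1 : |Q| ≤ K * r ^ 2 := by
    have := qf_bound S c hc v
    rw [hQ, abs_div, abs_two]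
    have h3 : n ^ 2 * c * ‖v‖ ^ 2 ≤ K * r ^ 2 := by gcongr
    have : 0 ≤ K * r ^ 2 := by positivity
    linarith
  have hd : q y - q x = l + Q := by rw [hq y]; ring
  rw [hd] at hy
  have h3 : |l + Q| ≤ 2 * K * r := by
    refine (abs_add_le _ _).trans ?_
    nlinarith [mul_nonneg (by linarith : 0 ≤ K) hr0]
  have h4 : (l + Q) ^ 2 ≤ 4 * K ^ 2 * r ^ 2 := by
    rw [← sq_abs]
    calc |l + Q| ^ 2 ≤ (2 * K * r) ^ 2 := by gcongr
      _ = _ := by ring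
  have h5 : |a2 / 2 * ((l + Q) ^ 2 - l ^ 2)| ≤ ε / 2 * r ^ 2 := by
    have e : (l + Q) ^ 2 - l ^ 2 = Q * ((l + Q) + l) := by ring
    rw [e, abs_mul, abs_mul, abs_div, abs_two]
    have h6 : |l + Q + l| ≤ 3 * K * r := (abs_add_le _ _).trans (by linarith)
    calc |a2| / 2 * (|Q| * |l + Q + l|) ≤ |a2| / 2 * (K * r ^ 2 * (3 * K * r)) := by gcongr
      _ = 3 / 8 * (r * (4 * K ^ 2 * |a2|)) * r ^ 2 := by ring
      _ ≤ 3 / 8 * (r * (4 * K ^ 2 * (|a2| + 1))) * r ^ 2 := by gcongr; linarith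
      _ ≤ 3 / 8 * ε * r ^ 2 := by gcongr
      _ ≤ _ := by nlinarith [mul_nonneg hε.le (sq_nonneg r)]
  have h6 : ε / (8 * K ^ 2) * (l + Q) ^ 2 ≤ ε / 2 * r ^ 2 := by
    calc _ ≤ ε / (8 * K ^ 2) * (4 * K ^ 2 * r ^ 2) := by gcongr
      _ = _ := by field_simp; ring
  rw [inner_neg_left, inner_smul_left, qf_neg, qf_add, qf_smul, qf_smul, qf_op]
  simp only [conj_trivial]
  have h7 := (abs_le.1 hy).1
  have h8 := (abs_le.1 h5).2
  have h9 := (abs_le.1 h5).1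
  have e : qf S v = 2 * Q := by rw [hQ]; ring
  rw [e, ← hl]
  nlinarith

structure Frame (lam Lam : ℝ) (B : Mat n) (e f : En n) (N : ℝ) : Prop where
  low : ∀ a b : ℝ, lam * (a ^ 2 + b ^ 2) ≤ qf B (a • e + b • f)
  up : ∀ a b : ℝ, qf B (a • e + b • f) ≤ Lam * (a ^ 2 + b ^ 2)
  bd : ∀ v, inner ℝ e v ^ 2 + inner ℝ f v ^ 2 ≤ N ^ 2 * ‖v‖ ^ 2

lemma rpow_holder {a b s : ℝ} (ha : 0 ≤ a) (hb : 0 ≤ b) (hs0 : 0 ≤ s) (hs1 : s ≤ 1) :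
    |a ^ s - b ^ s| ≤ |a - b| ^ s := by
  wlog h : b ≤ a generalizing a b
  · rw [abs_sub_comm, abs_sub_comm a b]; exact this hb ha (by linarith)
  have h1 := Real.rpow_add_le_add_rpow (sub_nonneg.2 h) hb hs0 hs1
  rw [sub_add_cancel] at h1
  rw [abs_of_nonneg (sub_nonneg.2 h), abs_of_nonneg (sub_nonneg.2 (Real.rpow_le_rpow hb h hs0))]
  linarith

def sE (lam Lam : ℝ) : ℝ := 1 - lam / (2 * Lam)

set_option maxHeartbeats 1000000 in
lemma barrier {lam Lam : ℝ} {B : Mat n} (hB : Ell lam Lam B) {e f : En n} {N : ℝ} (hN : 1 ≤ N)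
    (hF : Frame lam Lam B e f N) (α β : ℝ) {κ : ℝ} (hκ : 0 < κ) :
    ∃ b : En n → ℝ, Continuous b ∧
      (∀ x y, |b y - b x| ≤ (12 / lam * N) * (κ ^ (2 - sE lam Lam) * ‖y - x‖ ^ sE lam Lam)) ∧
      ∀ x, ∃ g A, Matrix.IsSymm A ∧ 0 ≤ LB B A ∧
        (|inner ℝ e x - α| ≤ κ → |inner ℝ f x - β| ≤ κ → 1 ≤ LB B A) ∧ UJ (fun y => - b y) x (-g) (-A) := by
  have hl := hB.lam_pos
  have hL : 0 < Lam := hl.trans_le hB.lam_le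
  set s := sE lam Lam with hs
  have hs1 : s < 1 := by rw [hs, sE]; have : 0 < lam / (2 * Lam) := by positivity
                         linarith
  have hs0 : 1 / 2 ≤ s := by
    rw [hs, sE]
    have : lam / (2 * Lam) ≤ 1 / 2 := by rw [div_le_div_iff₀ (by positivity) (by norm_num)]; linarith [hB.lam_le]
    linarith
  have hsL : (1 - s) * Lam = lam / 2 := by rw [hs, sE]; field_simp; ring
  set t1 : En n → ℝ := fun y => inner ℝ e y - α with ht1
  set t2 : En n → ℝ := fun y => inner ℝ f y - β with ht2
  set q : En n → ℝ := fun y => κ ^ 2 + t1 y ^ 2 + t2 y ^ 2 with hq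
  have hqp : ∀ y, 0 < q y := fun y => by simp only [hq]; positivity
  set c := 12 / lam * κ ^ (2 - s) with hc
  have hc0 : 0 < c := by positivity
  have hqc : Continuous q := by simp only [hq, ht1, ht2]; fun_prop
  have hd1 : ∀ x y, t1 y = t1 x + inner ℝ e (y - x) := fun x y => by simp only [ht1, inner_sub_right]; ring
  have hd2 : ∀ x y, t2 y = t2 x + inner ℝ f (y - x) := fun x y => by simp only [ht2, inner_sub_right]; ring
  have hq2 : ∀ x y, q y = q x + inner ℝ ((2 * t1 x) • e + (2 * t2 x) • f) (y - x)
      + qf ((2:ℝ) • (op e + op f)) (y - x) / 2 := by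
    intro x y
    rw [inner_add_left, inner_smul_left, inner_smul_left, qf_smul, qf_add, qf_op, qf_op]
    simp only [hq, hd1 x y, hd2 x y, conj_trivial]; ring
  refine ⟨fun y => c * q y ^ (s / 2), ?_, ?_, ?_⟩
  · have : Continuous fun y => q y ^ (s / 2) := hqc.rpow_const fun y => Or.inl (hqp y).ne'
    fun_prop
  · intro x y
    have hsq : ∀ y, q y ^ (s / 2) = Real.sqrt (q y) ^ s := by
      intro y
      rw [Real.sqrt_eq_rpow, ← Real.rpow_mul (hqp y).le]; congr 1; ring
    have hlip : ∀ x y, Real.sqrt (q y) ≤ Real.sqrt (q x) + N * ‖y - x‖ := by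
      intro x y
      apply Real.sqrt_le_iff.2 ⟨by positivity, ?_⟩
      have hb := hF.bd (y - x)
      rw [add_sq, Real.sq_sqrt (hqp x).le]
      have e1 : q y = q x + 2 * (t1 x * inner ℝ e (y - x) + t2 x * inner ℝ f (y - x))
          + (inner ℝ e (y - x) ^ 2 + inner ℝ f (y - x) ^ 2) := by
        simp only [hq, hd1 x y, hd2 x y]; ring
      have e2 : t1 x * inner ℝ e (y - x) + t2 x * inner ℝ f (y - x) ≤ Real.sqrt (q x) * (N * ‖y - x‖) := by
        refine le_of_abs_le (abs_le_of_sq_le_sq ?_ (by positivity))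
        rw [mul_pow, Real.sq_sqrt (hqp x).le, mul_pow]
        calc _ ≤ (t1 x ^ 2 + t2 x ^ 2) * (inner ℝ e (y - x) ^ 2 + inner ℝ f (y - x) ^ 2) := by
              nlinarith [sq_nonneg (t1 x * inner ℝ f (y - x) - t2 x * inner ℝ e (y - x))]
          _ ≤ q x * (N ^ 2 * ‖y - x‖ ^ 2) := by
              apply mul_le_mul _ hb (by positivity) (hqp x).le
              simp only [hq]; nlinarith
      rw [e1]; nlinarith
    have h1 : |Real.sqrt (q y) - Real.sqrt (q x)| ≤ N * ‖y - x‖ := by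
      have a1 := hlip x y
      have a2 := hlip y x
      rw [norm_sub_rev] at a2
      rw [abs_le]; constructor <;> linarith
    rw [← mul_sub, abs_mul, abs_of_pos hc0, hsq, hsq]
    have h2 := rpow_holder (Real.sqrt_nonneg (q y)) (Real.sqrt_nonneg (q x)) (by linarith : 0 ≤ s) hs1.le
    have h3 : |Real.sqrt (q y) - Real.sqrt (q x)| ^ s ≤ N * ‖y - x‖ ^ s := by
      refine (Real.rpow_le_rpow (abs_nonneg _) h1 (by linarith)).trans ?_
      rw [Real.mul_rpow (by linarith) (norm_nonneg _)]
      have : N ^ s ≤ N := by simpa using Real.rpow_le_rpow_of_exponent_le hN hs1.le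
      gcongr
    calc _ ≤ c * (N * ‖y - x‖ ^ s) := by gcongr; exact h2.trans h3
      _ = _ := by rw [hc]; ring
  · intro x
    set p := (2 * t1 x) • e + (2 * t2 x) • f with hp
    set S := (2:ℝ) • (op e + op f) with hS
    have hd : ∀ t : ℝ, 0 < t → HasDerivAt (fun t => c * t ^ (s / 2)) (c * (s / 2 * t ^ (s / 2 - 1))) t :=
      fun t ht => (Real.hasDerivAt_rpow_const (Or.inl ht.ne')).const_mul c
    have hd' : HasDerivAt (fun t => c * (s / 2 * t ^ (s / 2 - 1)))
        (c * (s / 2 * ((s / 2 - 1) * q x ^ (s / 2 - 1 - 1)))) (q x) :=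
      ((Real.hasDerivAt_rpow_const (Or.inl (hqp x).ne')).const_mul _).const_mul c
    have hj := jet_comp (hq2 x) (φ := fun t => c * t ^ (s / 2)) (φ1 := fun t => c * (s / 2 * t ^ (s / 2 - 1)))
      (by filter_upwards [lt_mem_nhds (hqp x)] with t ht using hd t ht) hd'
    have hLB : LB B ((c * (s / 2 * q x ^ (s / 2 - 1))) • S + (c * (s / 2 * ((s / 2 - 1) * q x ^ (s / 2 - 1 - 1)))) • op p)
       = c * s * q x ^ (s / 2 - 1) / q x * (q x * (qf B e + qf B f) - (2 - s) * qf B (t1 x • e + t2 x • f)) := by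
      rw [LB_add, LB_smul, LB_smul, LB_smul, LB_add, LB_op, LB_op, LB_op]
      have : p = (2:ℝ) • (t1 x • e + t2 x • f) := by rw [hp, smul_add, smul_smul, smul_smul]
      rw [this, qf_vsmul, Real.rpow_sub_one (hqp x).ne' (s / 2 - 1)]
      have := (hqp x).ne'
      field_simp
      ring
    have hkey : lam / 2 * q x ≤ q x * (qf B e + qf B f) - (2 - s) * qf B (t1 x • e + t2 x • f) := by
      have p1 := qf_comb B hB.symm (t1 x) (t2 x) e f
      have p2 := qf_comb B hB.symm (-t2 x) (t1 x) e f
      have l2 := hF.low (-t2 x) (t1 x)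
      have u1 := hF.up (t1 x) (t2 x)
      have l3 := hF.low 1 0
      have l4 := hF.low 0 1
      simp at l3 l4
      have u2 := mul_le_mul_of_nonneg_left u1 (by linarith : 0 ≤ 1 - s)
      rw [← mul_assoc, hsL] at u2
      have hκ2 : 0 < κ ^ 2 := by positivity
      have k1 : κ ^ 2 * (2 * lam) ≤ κ ^ 2 * (qf B e + qf B f) := by gcongr; linarith
      have k2 : 0 ≤ lam * κ ^ 2 := by positivity
      simp only [hq]
      nlinarith
    have hfac : 0 < c * s * q x ^ (s / 2 - 1) / q x := by
      have := Real.rpow_pos_of_pos (hqp x) (s / 2 - 1)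
      have := hqp x
      have : 0 < s := by linarith
      positivity
    refine ⟨_, _, ?_, ?_, ?_, hj⟩
    · exact Matrix.IsSymm.add (Matrix.IsSymm.smul (Matrix.IsSymm.smul (Matrix.IsSymm.add (op_symm e) (op_symm f)) _) _)
        (Matrix.IsSymm.smul (op_symm p) _)
    · rw [hLB]
      have := hqp x
      exact mul_nonneg hfac.le (le_trans (by positivity) hkey)
    · intro ha hb
      rw [hLB]
      have hqx := hqp x
      have m1 := mul_le_mul_of_nonneg_left hkey hfac.le
      refine le_trans ?_ m1
      have e1 : c * s * q x ^ (s / 2 - 1) / q x * (lam / 2 * q x) = 6 * s * (κ ^ (2 - s) * q x ^ (s / 2 - 1)) := by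
        rw [hc]; field_simp; ring
      rw [e1]
      have q3 : q x ≤ 3 * κ ^ 2 := by
        have a1 : t1 x ^ 2 ≤ κ ^ 2 := by rw [← sq_abs]; gcongr
        have a2 : t2 x ^ 2 ≤ κ ^ 2 := by rw [← sq_abs]; gcongr
        simp only [hq]; linarith
      have r1 : (3 * κ ^ 2) ^ (s / 2 - 1) ≤ q x ^ (s / 2 - 1) :=
        Real.rpow_le_rpow_of_nonpos hqx q3 (by linarith)
      have r2 : (3 * κ ^ 2) ^ (s / 2 - 1) = 3 ^ (s / 2 - 1) * κ ^ (s - 2) := by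
        rw [Real.mul_rpow (by norm_num) (by positivity), ← Real.rpow_natCast κ 2, ← Real.rpow_mul hκ.le]
        congr 2; push_cast; ring
      have r3 : (1:ℝ) / 3 ≤ 3 ^ (s / 2 - 1) := by
        have := Real.rpow_le_rpow_of_exponent_le (x := 3) (by norm_num) (show (-1:ℝ) ≤ s / 2 - 1 by linarith)
        rw [Real.rpow_neg_one] at this; linarith
      have r4 : κ ^ (2 - s) * κ ^ (s - 2) = 1 := by rw [← Real.rpow_add hκ]; simp
      have r5 : 0 < κ ^ (2 - s) := by positivity
      have r6 : 1 / 3 ≤ κ ^ (2 - s) * q x ^ (s / 2 - 1) := by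
        calc (1:ℝ) / 3 ≤ 3 ^ (s / 2 - 1) * 1 := by linarith
          _ = κ ^ (2 - s) * (3 ^ (s / 2 - 1) * κ ^ (s - 2)) := by rw [← r4]; ring
          _ ≤ _ := by rw [← r2]; gcongr
      nlinarith

end

section

open scoped Topology

variable {n : ℕ}

lemma mv_symm (A : Mat n) (hA : A.IsSymm) (v w : En n) : inner ℝ v (mv A w) = inner ℝ (mv A v) w := by
  rw [inner_eq, inner_eq]
  simp only [mv, Finset.mul_sum, Finset.sum_mul]
  rw [Finset.sum_comm]
  refine Finset.sum_congr rfl fun i _ => Finset.sum_congr rfl fun j _ => ?_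
  rw [hA.apply i j]; ring

lemma mv_add (A A' : Mat n) (v : En n) : mv (A + A') v = mv A v + mv A' v := by
  ext i; simp [mv, add_mul, Finset.sum_add_distrib]

lemma entry_le (A : Mat n) (i j : Fin n) : |A i j| ≤ ‖A‖ := Matrix.norm_entry_le_entrywise_sup_norm A

lemma norm_le_entry {A : Mat n} {c : ℝ} (hc : 0 ≤ c) (h : ∀ i j, |A i j| ≤ c) : ‖A‖ ≤ c :=
  (Matrix.norm_le_iff hc).2 h

/-- orthonormal pair -/
structure OP (e f : En n) : Prop where
  ne : ‖e‖ = 1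
  nf : ‖f‖ = 1
  ip : inner ℝ e f = 0

lemma OP.sq {e f : En n} (h : OP e f) (a b : ℝ) : ‖a • e + b • f‖ ^ 2 = a ^ 2 + b ^ 2 := by
  rw [norm_add_sq_real, norm_smul, norm_smul, h.ne, h.nf, inner_smul_left, inner_smul_right, h.ip]
  simp

lemma OP.bessel {e f : En n} (h : OP e f) (v : En n) : inner ℝ e v ^ 2 + inner ℝ f v ^ 2 ≤ ‖v‖ ^ 2 := by
  have h1 := h.sq (inner ℝ e v) (inner ℝ f v)
  have h2 := norm_sub_sq_real v (inner ℝ e v • e + inner ℝ f v • f)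
  have h3 : inner ℝ v (inner ℝ e v • e + inner ℝ f v • f) = inner ℝ e v ^ 2 + inner ℝ f v ^ 2 := by
    rw [inner_add_right, inner_smul_right, inner_smul_right, real_inner_comm e v, real_inner_comm f v]; ring
  rw [h1, h3] at h2
  nlinarith [sq_nonneg ‖v - (inner ℝ e v • e + inner ℝ f v • f)‖]

lemma OP.frame {e f : En n} (h : OP e f) {lam Lam : ℝ} {B : Mat n} (hB : Ell lam Lam B) :
    Frame lam Lam B e f 1 := by
  refine ⟨fun a b => ?_, fun a b => ?_, fun v => ?_⟩
  · have := hB.lower (a • e + b • f); rwa [h.sq] at this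
  · have := hB.upper (a • e + b • f); rwa [h.sq] at this
  · simpa using h.bessel v

lemma OP.le1 {e f : En n} (h : OP e f) (v : En n) : |inner ℝ e v| ≤ ‖v‖ ∧ |inner ℝ f v| ≤ ‖v‖ := by
  constructor
  · simpa [h.ne] using abs_real_inner_le_norm e v
  · simpa [h.nf] using abs_real_inner_le_norm f v

lemma exists_OP (hn : 2 ≤ n) : ∃ e f : En n, OP e f := by
  refine ⟨EuclideanSpace.single ⟨0, by omega⟩ 1, EuclideanSpace.single ⟨1, by omega⟩ 1, ?_, ?_, ?_⟩
  · simp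
  · simp
  · simp [EuclideanSpace.inner_single_left, Pi.single_apply]

lemma bigeig {lam Lam : ℝ} {B : Mat n} (hB : Ell lam Lam B) (hn : 0 < n) {A : Mat n} (hA : A.IsSymm)
    (hL : |LB B A| ≤ 1) (hK : 2 * n / lam ≤ ‖A‖) :
    ∃ e f : En n, OP e f ∧ ∀ w, lam / (2 * n ^ 2 * Lam) * ‖A‖ * |inner ℝ e w| ≤ ‖mv A w‖ ∧
      lam / (2 * n ^ 2 * Lam) * ‖A‖ * |inner ℝ f w| ≤ ‖mv A w‖ := by
  have hl := hB.lam_pos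
  have hLp : 0 < Lam := hl.trans_le hB.lam_le
  have hn' : (1:ℝ) ≤ n := by exact_mod_cast hn
  have hn0 : (0:ℝ) < n := by linarith
  obtain ⟨v, μ, h1, h2⟩ := spec A hA
  have hv : ∀ k, ‖v k‖ = 1 := v.orthonormal.1
  set K := ‖A‖ with hKd
  have hK0 : 0 < K := lt_of_lt_of_le (by positivity) hK
  set c := lam / (2 * n ^ 2 * Lam) with hc
  have : Nonempty (Fin n) := ⟨⟨0, hn⟩⟩
  obtain ⟨k1, hk1⟩ := Finite.exists_max fun k => |μ k|
  have hent : K ≤ n * |μ k1| := by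
    refine norm_le_entry (by positivity) fun i j => ?_
    rw [h1 i j]
    refine (Finset.abs_sum_le_sum_abs _ _).trans ?_
    calc _ ≤ ∑ k : Fin n, |μ k1| := Finset.sum_le_sum fun k _ => by
          rw [abs_mul, abs_mul]
          have a1 : |v k i| ≤ 1 := (abs_coord _ _).trans_eq (hv k)
          have a2 : |v k j| ≤ 1 := (abs_coord _ _).trans_eq (hv k)
          have a3 := hk1 k
          calc _ ≤ |μ k1| * 1 * 1 := by apply mul_le_mul (mul_le_mul a3 a1 (abs_nonneg _) (abs_nonneg _)) a2 (abs_nonneg _) (by positivity)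
            _ = _ := by ring
      _ = _ := by simp
  have hq : ∀ k, lam ≤ qf B (v k) ∧ qf B (v k) ≤ Lam := fun k => by
    have a := hB.lower (v k); have b := hB.upper (v k); rw [hv] at a b; constructor <;> linarith
  have hexp := spec_LB (B := B) h1
  have hk2 : ∃ k2, k2 ≠ k1 ∧ c * K ≤ |μ k2| := by
    by_contra hcon
    push Not at hcon
    have s1 : LB B A = μ k1 * qf B (v k1) + ∑ k ∈ Finset.univ.erase k1, μ k * qf B (v k) := by
      rw [hexp]; exact (Finset.add_sum_erase _ (fun k => μ k * qf B (v k)) (Finset.mem_univ k1)).symm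
    have s2 : |∑ k ∈ Finset.univ.erase k1, μ k * qf B (v k)| ≤ (n - 1) * (c * K * Lam) := by
      refine (Finset.abs_sum_le_sum_abs _ _).trans ?_
      calc _ ≤ ∑ k ∈ Finset.univ.erase k1, c * K * Lam := Finset.sum_le_sum fun k hk => by
            rw [abs_mul, abs_of_nonneg (hl.le.trans (hq k).1)]
            have := hcon k (Finset.ne_of_mem_erase hk)
            have := (hq k).2
            have : 0 ≤ qf B (v k) := hl.le.trans (hq k).1
            gcongr
        _ = _ := by
            rw [Finset.sum_const, Finset.card_erase_of_mem (Finset.mem_univ _), Finset.card_univ, Fintype.card_fin, nsmul_eq_mul,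
              Nat.cast_sub hn]; simp
    have s3 : |μ k1 * qf B (v k1)| ≤ 1 + (n - 1) * (c * K * Lam) := by
      have e : μ k1 * qf B (v k1) = LB B A - ∑ k ∈ Finset.univ.erase k1, μ k * qf B (v k) := by rw [s1]; ring
      rw [e]; exact (abs_sub _ _).trans (by linarith)
    rw [abs_mul, abs_of_nonneg (hl.le.trans (hq k1).1)] at s3
    have s4 : lam * K ≤ n * (|μ k1| * qf B (v k1)) := by
      calc lam * K ≤ lam * (n * |μ k1|) := by gcongr
        _ = n * (|μ k1| * lam) := by ring
        _ ≤ _ := by gcongr; exact (hq k1).1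
    have e5 : c * Lam * n ^ 2 = lam / 2 := by rw [hc]; field_simp
    have s6 : 2 * n ≤ lam * K := by rw [div_le_iff₀ hl] at hK; linarith
    have s7 := mul_le_mul_of_nonneg_left s3 hn0.le
    have s8 : n * (1 + (n - 1) * (c * K * Lam)) = n + c * Lam * n ^ 2 * K - n * (c * Lam) * K := by ring
    rw [s8, e5] at s7
    have : 0 < n * (c * Lam) * K := by positivity
    linarith
  obtain ⟨k2, hne, hk2⟩ := hk2
  have hk1' : c * K ≤ |μ k1| := by
    rw [hc, div_mul_eq_mul_div, div_le_iff₀ (by positivity)]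
    have : lam * K ≤ Lam * (n * |μ k1|) := by gcongr; exact hB.lam_le
    nlinarith [mul_nonneg (mul_nonneg hLp.le hn0.le) (abs_nonneg (μ k1))]
  have hfin : ∀ k, c * K ≤ |μ k| → ∀ w, c * K * |inner ℝ (v k) w| ≤ ‖mv A w‖ := by
    intro k hk w
    have a := abs_real_inner_le_norm (v k) (mv A w)
    rw [mv_symm A hA, h2, inner_smul_left, hv, one_mul, abs_mul] at a
    simp only [conj_trivial] at a
    exact le_trans (by gcongr) a
  exact ⟨v k1, v k2, ⟨hv _, hv _, v.orthonormal.2 hne.symm⟩, fun w => ⟨hfin k1 hk1' w, hfin k2 hk2 w⟩⟩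

end

section

open scoped Topology

variable {n : ℕ}

lemma hasGrad_poly (p : Pol n) (x : En n) : HasGradientAt (ev p) (gr p x) x := by
  obtain ⟨C, hC, h⟩ := poly_taylor p x
  have h0 : (fun y => ev p y - ev p x - inner ℝ (gr p x) (y - x)) =O[𝓝 x] fun y => ‖y - x‖ ^ 2 := by
    apply Asymptotics.IsBigO.of_bound (C + n ^ 2 * ‖he p x‖)
    filter_upwards [closedBall_mem_nhds x one_pos] with y hy
    rw [mem_closedBall_iff_norm] at hy
    have h1 := h y hy
    have h2 := qf_bound (he p x) ‖he p x‖ (entry_le _) (y - x)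
    have h3 : C * ‖y - x‖ ^ 3 ≤ C * ‖y - x‖ ^ 2 := by
      apply mul_le_mul_of_nonneg_left _ hC
      exact pow_le_pow_of_le_one (norm_nonneg _) hy (by norm_num)
    rw [Real.norm_eq_abs, Real.norm_eq_abs, abs_of_nonneg (sq_nonneg ‖y - x‖)]
    have h4 := abs_le.1 h1
    have h5 := abs_le.1 h2
    have h6 := (abs_nonneg _).trans h2
    rw [abs_le]; constructor <;> linarith [h4.1, h4.2, h5.1, h5.2]
  have h1 := h0.hasFDerivAt (𝕜 := ℝ) (by norm_num)
  have h2 : HasFDerivAt (fun y => ev p x + inner ℝ (gr p x) (y - x)) (InnerProductSpace.toDual ℝ (En n) (gr p x)) x := by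
    have := ((InnerProductSpace.toDual ℝ (En n) (gr p x)).hasFDerivAt (x := x)).const_add (ev p x - inner ℝ (gr p x) x)
    refine this.congr_of_eventuallyEq (Filter.Eventually.of_forall fun y => ?_)
    simp only [InnerProductSpace.toDual_apply_apply, inner_sub_right]; ring
  rw [hasGradientAt_iff_hasFDerivAt]
  have h3 := h1.add h2
  rw [zero_add] at h3
  refine h3.congr_of_eventuallyEq (Filter.Eventually.of_forall fun y => ?_)
  simp only [Pi.add_apply]; ring

lemma HasGradientAt_add {f g : En n → ℝ} {a b x : En n} (hf : HasGradientAt f a x) (hg : HasGradientAt g b x) :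
    HasGradientAt (fun y => f y + g y) (a + b) x := by
  rw [hasGradientAt_iff_hasFDerivAt] at *; rw [map_add]; exact HasFDerivAt.add hf hg

structure Setup (lam Lam CR : ℝ) (B : Mat n) (V f : En n → ℝ) (Z : Set (En n)) (T T' : En n →ₗ[ℝ] En n)
    (P : Mat n) (gz z : En n) (R0 : ℝ) : Prop where
  hB : Ell lam Lam B
  hCR : 2 ≤ CR
  cont : ContinuousOn V (closedBall z R0)
  sub1 : Sub B V f (ball z R0)
  sub2 : Sub B (fun y => - V y) (fun y => - f y) (ball z R0)
  fb : ∀ y ∈ ball z R0, |f y| ≤ 1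
  fz : ∀ y ∈ ball z R0, f y ≠ 0 → y ∈ Z ∨ (T y ∈ Z ∧ ‖T y - z‖ ≤ CR * ‖y - z‖)
  gradz : HasGradientAt V gz z
  gradZ : ∀ x ∈ Z, x ∈ ball z R0 → HasGradientAt V (gz - mv P (x - z)) x
  Ps : P.IsSymm
  PL : |LB B P| ≤ 1
  Pb : ‖P‖ ≤ 1 / lam
  adj : ∀ p y, inner ℝ (T' p) y = inner ℝ p (T y)
  Tq : ∀ p, qf B (T' p) = qf B p
  Tn : ∀ v, ‖T v‖ ≤ CR * ‖v‖

def Slab (Z : Set (En n)) (z e f : En n) (r κ : ℝ) : Prop :=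
  ∀ x ∈ Z, ‖x - z‖ < r → |inner ℝ e (x - z)| ≤ κ ∧ |inner ℝ f (x - z)| ≤ κ

lemma setup_barrier {lam Lam CR : ℝ} {B : Mat n} {V f : En n → ℝ} {Z : Set (En n)} {T T' : En n →ₗ[ℝ] En n}
    {P : Mat n} {gz z : En n} {R0 : ℝ} (S : Setup lam Lam CR B V f Z T T' P gz z R0) {r κ : ℝ} (hr : 0 < r)
    (hrR : r ≤ R0) (hκ : 0 < κ) {e e' : En n} (ho : OP e e') (hs : Slab Z z e e' r κ) :
    ∃ b : En n → ℝ, Continuous b ∧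
      (∀ x y, |b y - b x| ≤ (12 / lam * (1 + CR)) * (κ ^ (2 - sE lam Lam) * ‖y - x‖ ^ sE lam Lam)) ∧
      ∀ (w g : En n → ℝ) (D : Set (En n)), D ⊆ ball z (r / CR) → (∀ y ∈ D, |g y| ≤ |f y|) → Sub B w g D →
        Sub B (fun y => w y + b y) (fun _ => 0) D := by
  have hCR := S.hCR
  have hF1 := ho.frame S.hB
  have hF2 : Frame lam Lam B (T' e) (T' e') CR := by
    refine ⟨fun a b => ?_, fun a b => ?_, fun v => ?_⟩
    · rw [← map_smul, ← map_smul, ← map_add, S.Tq]; exact hF1.low a b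
    · rw [← map_smul, ← map_smul, ← map_add, S.Tq]; exact hF1.up a b
    · rw [S.adj, S.adj, ← mul_pow]
      refine (ho.bessel (T v)).trans ?_
      have := S.Tn v
      gcongr
  obtain ⟨b1, c1, m1, j1⟩ := barrier S.hB le_rfl hF1 (inner ℝ e z) (inner ℝ e' z) hκ
  obtain ⟨b2, c2, m2, j2⟩ := barrier S.hB (by linarith) hF2 (inner ℝ e z) (inner ℝ e' z) hκ
  refine ⟨fun y => b1 y + b2 y, c1.add c2, fun x y => ?_, fun w g D hD hg hw => ?_⟩
  · have e : b1 y + b2 y - (b1 x + b2 x) = (b1 y - b1 x) + (b2 y - b2 x) := by ring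
    rw [e]
    refine (abs_add_le _ _).trans ((add_le_add (m1 x y) (m2 x y)).trans (le_of_eq (by ring)))
  · classical
    have s1 := hw.add (g := b1) (k := fun x => if |inner ℝ e x - inner ℝ e z| ≤ κ ∧ |inner ℝ e' x - inner ℝ e' z| ≤ κ then 1 else 0)
      (fun x hx => by
        obtain ⟨b', A, ha, h0, h1, hU⟩ := j1 x
        refine ⟨b', A, ha, ?_, hU⟩
        show (if _ then _ else _) ≤ _
        split_ifs with h
        · exact h1 h.1 h.2
        · exact h0)
    have s2 := s1.add (g := b2) (k := fun x => if |inner ℝ (T' e) x - inner ℝ e z| ≤ κ ∧ |inner ℝ (T' e') x - inner ℝ e' z| ≤ κ then 1 else 0)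
      (fun x hx => by
        obtain ⟨b', A, ha, h0, h1, hU⟩ := j2 x
        refine ⟨b', A, ha, ?_, hU⟩
        show (if _ then _ else _) ≤ _
        split_ifs with h
        · exact h1 h.1 h.2
        · exact h0)
    have s3 : Sub B (fun y => w y + (b1 y + b2 y)) (fun _ => 0) D := by
      have e : (fun y => w y + (b1 y + b2 y)) = fun y => w y + b1 y + b2 y := by ext; ring
      rw [e]
      refine s2.mono subset_rfl fun x hx => ?_
      have hx1 : ‖x - z‖ < r / CR := by simpa [dist_eq_norm] using hD hx
      have hx2 : r / CR ≤ r := div_le_self hr.le (by linarith)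
      have hxR : x ∈ ball z R0 := by rw [mem_ball, dist_eq_norm]; linarith
      have hgx := hg x hx
      show 0 ≤ g x + (if _ then _ else _) + (if _ then _ else _)
      by_cases hf : f x = 0
      · rw [hf, abs_zero] at hgx
        have : g x = 0 := abs_nonpos_iff.1 hgx
        rw [this]; split_ifs <;> norm_num
      · have hg1 : -1 ≤ g x := (abs_le.1 (hgx.trans (S.fb x hxR))).1
        rcases S.fz x hxR hf with h | ⟨h, h'⟩
        · have := hs x h (by linarith)
          rw [inner_sub_right, inner_sub_right] at this
          rw [if_pos this]; split_ifs <;> linarith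
        · have h2 : ‖T x - z‖ < r := by
            refine h'.trans_lt ?_
            rw [lt_div_iff₀ (by linarith)] at hx1; linarith
          have := hs _ h h2
          rw [inner_sub_right, inner_sub_right, ← S.adj, ← S.adj] at this
          rw [if_pos this]; split_ifs <;> linarith
    exact s3

lemma gradest {lam Lam CR : ℝ} {B : Mat n} {V f : En n → ℝ} {Z : Set (En n)} {T T' : En n →ₗ[ℝ] En n}
    {P : Mat n} {gz z : En n} {R0 : ℝ} (S : Setup lam Lam CR B V f Z T T' P gz z R0) (hn : 0 < n) {r κ : ℝ} (hr : 0 < r)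
    (hrR : r ≤ R0) (hκ : 0 < κ) {e e' : En n} (ho : OP e e') (hs : Slab Z z e e' r κ)
    (p : Pol n) (hp : LP B p = 0) {x g : En n} {ρ m : ℝ} (hρ : 0 < ρ) (h1 : ball x ρ ⊆ ball z (r / CR))
    (h2 : closedBall x ρ ⊆ closedBall z R0) (hm : ∀ y ∈ closedBall x ρ, |V y + ev p y| ≤ m)
    (hg : HasGradientAt V g x) :
    ‖g + gr p x‖ ≤ max (cG n lam Lam (12 / lam * (1 + CR)) (sE lam Lam)) 1 * (m / ρ + κ) := by
  obtain ⟨b, hb, hbm, hsub⟩ := setup_barrier S hr hrR hκ ho hs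
  have hl := S.hB.lam_pos
  have hL : 0 < Lam := hl.trans_le S.hB.lam_le
  have hCR := S.hCR
  have hball : ball x ρ ⊆ ball z R0 := h1.trans (ball_subset_ball ((div_le_self hr.le (by linarith)).trans hrR))
  have k1 : Sub B (fun y => V y + ev p y) f (ball x ρ) := by
    have := (S.sub1.mono hball (fun x _ => le_rfl)).add_poly p
    refine this.mono subset_rfl fun y _ => ?_
    simp [hp, ev]
  have k2 : Sub B (fun y => - (V y + ev p y)) (fun y => - f y) (ball x ρ) := by
    have := (S.sub2.mono hball (fun x _ => le_rfl)).add_poly (-p)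
    have hp' : LP B (-p) = 0 := by
      have := LP_sub B 0 p
      rw [hp] at this; simpa [LP] using this
    have e : (fun y => - (V y + ev p y)) = fun y => - V y + ev (-p) y := by ext y; simp; ring
    rw [e]
    refine this.mono subset_rfl fun y _ => ?_
    simp [hp', ev]
  have hs1 : sE lam Lam < 1 := by rw [sE]; have : 0 < lam / (2 * Lam) := by positivity
                                  linarith
  have hs0 : 0 < sE lam Lam := by
    rw [sE]
    have : lam / (2 * Lam) ≤ 1 / 2 := by rw [div_le_div_iff₀ (by positivity) (by norm_num)]; linarith [S.hB.lam_le]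
    linarith
  have hm0 : 0 ≤ m := (abs_nonneg _).trans (hm x (by simp [hρ.le]))
  have := lemG S.hB hn hρ hκ hs0 hs1 (Cb := 12 / lam * (1 + CR)) (by positivity) (w := fun y => V y + ev p y) (f := f) (b := b)
    ((S.cont.mono h2).add (ev_cont p).continuousOn) hm (HasGradientAt_add hg (hasGrad_poly p x))
    (fun y hy => S.fb y (hball hy)) k1 k2 hb (hbm x)
    (hsub _ f _ h1 (fun y _ => le_rfl) k1) (hsub _ _ _ h1 (fun y _ => by simp) k2)
  refine this.trans ?_
  gcongr
  exact le_max_left _ _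

end

section

open scoped Topology

variable {n : ℕ}

def wA (V : En n → ℝ) (z gz : En n) (A : Mat n) (y : En n) : ℝ :=
  V y - V z - inner ℝ gz (y - z) - qf A (y - z) / 2

lemma wA_eq (V : En n → ℝ) (z gz : En n) (A : Mat n) (y : En n) :
    wA V z gz A y = V y + ev (-qp z (V z) gz A) y := by
  rw [ev_neg, ev_qp, wA]; ring

lemma LP_neg (B : Mat n) (p : Pol n) : LP B (-p) = - LP B p := by
  have := LP_sub B 0 p
  simpa [LP] using this

lemma he_zero_LB {B : Mat n} {h : Pol n} (hh : LP B h = 0) (x : En n) : LB B (he h x) = 0 := by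
  rw [← ev_LP, hh]; simp [ev]

set_option maxHeartbeats 1000000 in
lemma step (hn : 0 < n) {lam Lam CR : ℝ} (hl : 0 < lam) (hL : lam ≤ Lam) (hCR : 2 ≤ CR) :
    ∃ θ C1 C3 C5 : ℝ, 0 < θ ∧ θ < 1 ∧ 0 ≤ C1 ∧ 0 ≤ C3 ∧ 0 < C5 ∧
    ∀ {B : Mat n} {V f : En n → ℝ} {Z : Set (En n)} {T T' : En n →ₗ[ℝ] En n}
    {P : Mat n} {gz z : En n} {R0 : ℝ}, Setup lam Lam CR B V f Z T T' P gz z R0 →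
    ∀ (r : ℝ) (A : Mat n) (E δ : ℝ) (e e' : En n), 0 < r → r ≤ R0 → A.IsSymm → LB B A = 0 → OP e e' →
      Slab Z z e e' r (δ * r) → 0 < δ → δ ≤ 1 → 0 ≤ E → (∀ y ∈ closedBall z r, |wA V z gz A y| ≤ E * r ^ 2) →
      (∃ A1 : Mat n, A1.IsSymm ∧ LB B A1 = 0 ∧ ‖A1 - A‖ ≤ C3 * (E + δ) ∧
        ∀ y ∈ closedBall z (θ * r), |wA V z gz A1 y| ≤ (E / 2 + C1 * δ) * (θ * r) ^ 2) ∧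
      ∀ x ∈ Z, ‖x - z‖ < θ * r → ‖mv (P + A) (x - z)‖ ≤ C5 * (E + δ) * r := by
  have hLp : 0 < Lam := hl.trans_le hL
  have hCR0 : 0 < CR := by linarith
  set a : ℝ := 2 * (12 / lam * (1 + CR)) + 1 with ha
  have ha1 : 1 ≤ a := by have : 0 < 12 / lam * (1 + CR) := by positivity
                         linarith
  set G : ℝ := max (cG n lam Lam (12 / lam * (1 + CR)) (sE lam Lam)) 1 with hG
  have hG1 : 1 ≤ G := le_max_right _ _
  have hcB := cB_pos n lam Lam
  set K3 : ℝ := 64 * n ^ 3 * cB n lam Lam ^ 3 with hK3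
  have hK30 : 0 ≤ K3 := by positivity
  set θ : ℝ := 1 / (8 * CR + 2 * K3 * CR ^ 3) with hθ
  have hθ0 : 0 < θ := by positivity
  have hθ1 : θ * (8 * CR + 2 * K3 * CR ^ 3) = 1 := by rw [hθ]; field_simp
  have hθK : K3 * CR ^ 3 * θ ≤ 1 / 2 := by nlinarith [mul_pos hθ0 hCR0]
  have hθC : θ ≤ 1 / CR / 8 := by
    rw [div_div, le_div_iff₀ (by positivity)]
    have : 0 ≤ θ * (2 * K3 * CR ^ 3) := by positivity
    linarith
  have hθlt : θ < 1 := by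
    have : 1 / CR ≤ 1 := by rw [div_le_one hCR0]; linarith
    linarith
  refine ⟨θ, (2 * a + G * (a * CR + 1) + K3 * a * CR ^ 3) / θ ^ 2, 4 * cB n lam Lam ^ 2 * CR ^ 2 * a, 2 * G * CR,
    hθ0, hθlt, by positivity, by positivity, by positivity, ?_⟩
  intro B V f Z T T' P gz z R0 S r A E δ e e' hr hrR hA hLA ho hs hδ hδ1 hE hw
  have hκ : 0 < δ * r := by positivity
  set r1 := r / CR with hr1
  have hr10 : 0 < r1 := by positivity
  have hr1r : r1 ≤ r := div_le_self hr.le (by linarith)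
  have hrr1 : r = CR * r1 := by rw [hr1]; field_simp
  have hθr : θ * r ≤ r1 / 8 := by
    calc θ * r ≤ 1 / CR / 8 * r := by gcongr
      _ = _ := by rw [hr1]; ring
  have hcc : closedBall z r1 ⊆ closedBall z R0 := closedBall_subset_closedBall (hr1r.trans hrR)
  set p0 := -qp z (V z) gz A with hp0
  have hLp0 : LP B p0 = 0 := by rw [hp0, LP_neg, LP_qp B z _ _ A hA, hLA]; simp
  have hgr0 : ∀ y, gr p0 y = - (gz + mv A (y - z)) := fun y => by rw [hp0, gr_neg, gr_qp z _ _ A hA]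
  constructor
  · -- harmonic replacement
    obtain ⟨b, hb, hbm, hsub⟩ := setup_barrier S hr hrR hκ ho hs
    have hball : ball z r1 ⊆ ball z R0 := ball_subset_ball (hr1r.trans hrR)
    have k1 : Sub B (fun y => V y + ev p0 y) f (ball z r1) := by
      have := (S.sub1.mono hball (fun x _ => le_rfl)).add_poly p0
      refine this.mono subset_rfl fun y _ => ?_
      simp [hLp0, ev]
    have k2 : Sub B (fun y => - (V y + ev p0 y)) (fun y => - f y) (ball z r1) := by
      have := (S.sub2.mono hball (fun x _ => le_rfl)).add_poly (-p0)
      have hp' : LP B (-p0) = 0 := by rw [LP_neg, hLp0, neg_zero]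
      have e : (fun y => - (V y + ev p0 y)) = fun y => - V y + ev (-p0) y := by ext y; simp; ring
      rw [e]
      refine this.mono subset_rfl fun y _ => ?_
      simp [hp', ev]
    have hs1 : sE lam Lam < 1 := by rw [sE]; have : 0 < lam / (2 * Lam) := by positivity
                                    linarith
    have hs0 : 0 < sE lam Lam := by
      rw [sE]
      have : lam / (2 * Lam) ≤ 1 / 2 := by rw [div_le_div_iff₀ (by positivity) (by norm_num)]; linarith
      linarith
    have hβ : ∀ y ∈ closedBall z r1, |b y - b z| ≤ 12 / lam * (1 + CR) * (δ * r ^ 2) := by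
      intro y hy
      refine (hbm z y).trans ?_
      rw [mem_closedBall_iff_norm] at hy
      set s := sE lam Lam
      have a1 : (δ * r) ^ (2 - s) = δ ^ (2 - s) * r ^ (2 - s) := Real.mul_rpow hδ.le hr.le
      have a2 : δ ^ (2 - s) ≤ δ := by
        simpa using Real.rpow_le_rpow_of_exponent_ge hδ hδ1 (show (1:ℝ) ≤ 2 - s by linarith)
      have a3 : ‖y - z‖ ^ s ≤ r ^ s := Real.rpow_le_rpow (norm_nonneg _) (hy.trans hr1r) hs0.le
      have a4 : r ^ (2 - s) * r ^ s = r ^ 2 := by rw [← Real.rpow_add hr, ← Real.rpow_natCast]; congr 1; push_cast; ring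
      refine mul_le_mul_of_nonneg_left ?_ (by positivity)
      calc _ ≤ δ * r ^ (2 - s) * r ^ s := by rw [a1]; gcongr
        _ = _ := by rw [mul_assoc, a4]
    obtain ⟨h, hh, hwh⟩ := harm_repl S.hB hn hr10 (w := fun y => V y + ev p0 y) ((S.cont.mono hcc).add (ev_cont p0).continuousOn)
      hb.continuousOn (hsub _ f _ subset_rfl (fun y _ => le_rfl) k1) (hsub _ _ _ subset_rfl (fun y _ => by simp) k2)
      hβ (η := δ * r ^ 2) (by positivity)
    have hwh' : ∀ y ∈ closedBall z r1, |V y + ev p0 y - ev h y| ≤ a * δ * r ^ 2 := fun y hy =>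
      (hwh y hy).trans (le_of_eq (by rw [ha]; ring))
    have hw' : ∀ y ∈ closedBall z r1, |V y + ev p0 y| ≤ E * r ^ 2 := fun y hy => by
      rw [hp0, ← wA_eq]; exact hw y (closedBall_subset_closedBall hr1r hy)
    have hhm : ∀ y ∈ closedBall z r1, |ev h y| ≤ (E + a * δ) * r ^ 2 := by
      intro y hy
      have a1 := abs_le.1 (hwh' y hy); have a2 := abs_le.1 (hw' y hy)
      rw [abs_le]; constructor <;> linarith [a1.1, a1.2, a2.1, a2.2]
    have hg : ‖gr h z‖ ≤ G * (a * CR + 1) * δ * r := by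
      have := gradest S hn hr hrR hκ ho hs (p0 - h) (by rw [LP_sub, hLp0, hh, sub_zero]) (x := z) (g := gz) (m := a * δ * r ^ 2)
        hr10 subset_rfl hcc (fun y hy => by rw [ev_sub, ← add_sub_assoc]; exact hwh' y hy) S.gradz
      have e0 : mv A (z - z) = 0 := by ext i; simp [mv]
      rw [gr_sub, hgr0, e0] at this
      have e : gz + (-(gz + 0) - gr h z) = - gr h z := by abel
      rw [e, norm_neg] at this
      refine this.trans (le_of_eq ?_)
      rw [← hG]; field_simp; rw [hrr1]; ring
    have hhe : ∀ i j, |he h z i j| ≤ 4 * cB n lam Lam ^ 2 * ((E + a * δ) * r ^ 2) / r1 ^ 2 := he_bound S.hB hn h hh hr10 hhm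
    have ht := harm_taylor S.hB hn h hh hr10 hhm
    have hzz : wA V z gz A z = 0 := by simp [wA, qf]
    have hhz : |ev h z| ≤ a * δ * r ^ 2 := by
      have := hwh' z (by simp [hr10.le])
      rw [hp0, ← wA_eq, hzz, zero_sub, abs_neg] at this; exact this
    refine ⟨A + he h z, hA.add (he_symm h z), by rw [LB_add, hLA, he_zero_LB hh, add_zero], ?_, ?_⟩
    · rw [add_sub_cancel_left]
      apply norm_le_entry (by positivity)
      intro i j
      refine (hhe i j).trans ?_
      calc _ = 4 * cB n lam Lam ^ 2 * CR ^ 2 * (E + a * δ) := by field_simp; rw [hrr1]; ring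
        _ ≤ 4 * cB n lam Lam ^ 2 * CR ^ 2 * (a * (E + δ)) := by gcongr; nlinarith
        _ = _ := by ring
    · intro y hy
      have hyn : ‖y - z‖ ≤ θ * r := by rwa [mem_closedBall_iff_norm] at hy
      have hy1 : y ∈ closedBall z (r1 / 8) := closedBall_subset_closedBall hθr hy
      have hy2 : y ∈ closedBall z r1 := closedBall_subset_closedBall (by linarith) hy1
      have b1 := ht y hy1
      have b2 := hwh' y hy2
      have b3 : |inner ℝ (gr h z) (y - z)| ≤ G * (a * CR + 1) * δ * r ^ 2 := by
        refine (abs_real_inner_le_norm _ _).trans ?_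
        calc _ ≤ (G * (a * CR + 1) * δ * r) * (1 * r) := by
              gcongr
              exact hyn.trans (by gcongr)
          _ = _ := by ring
      have b4 : 64 * n ^ 3 * cB n lam Lam ^ 3 * ((E + a * δ) * r ^ 2) * ‖y - z‖ ^ 3 / r1 ^ 3
          ≤ (E / 2 * θ ^ 2 + K3 * a * CR ^ 3 * δ) * r ^ 2 := by
        rw [← hK3]
        calc _ ≤ K3 * ((E + a * δ) * r ^ 2) * (θ * r) ^ 3 / r1 ^ 3 := by gcongr
          _ = (E * (K3 * CR ^ 3 * θ) * θ ^ 2 + K3 * a * CR ^ 3 * δ * θ ^ 3) * r ^ 2 := by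
              field_simp; rw [hrr1]; ring
          _ ≤ (E * (1 / 2) * θ ^ 2 + K3 * a * CR ^ 3 * δ * 1) * r ^ 2 := by
              gcongr
              exact pow_le_one₀ hθ0.le hθlt.le
          _ = _ := by ring
      have e1 : wA V z gz (A + he h z) y = (V y + ev p0 y - ev h y) + ev h z + inner ℝ (gr h z) (y - z)
          + (ev h y - ev h z - inner ℝ (gr h z) (y - z) - qf (he h z) (y - z) / 2) := by
        rw [hp0, ← wA_eq, wA, wA, qf_add]; ring
      have e2 : (E / 2 + (2 * a + G * (a * CR + 1) + K3 * a * CR ^ 3) / θ ^ 2 * δ) * (θ * r) ^ 2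
        = a * δ * r ^ 2 + a * δ * r ^ 2 + G * (a * CR + 1) * δ * r ^ 2 + (E / 2 * θ ^ 2 + K3 * a * CR ^ 3 * δ) * r ^ 2 := by
        field_simp; ring
      rw [e1, e2]
      refine (abs_add_le _ _).trans (add_le_add ((abs_add_le _ _).trans (add_le_add ((abs_add_le _ _).trans (add_le_add b2 hhz)) b3)) (b1.trans b4))
  · intro x hx hxn
    have hxR : x ∈ ball z R0 := by rw [mem_ball, dist_eq_norm]; linarith
    have hd : dist x z ≤ r1 / 8 := by rw [dist_eq_norm]; linarith
    have := gradest S hn hr hrR hκ ho hs p0 hLp0 (x := x) (m := E * r ^ 2) (half_pos hr10)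
      (ball_subset_ball' (by linarith)) ((closedBall_subset_closedBall' (by linarith)).trans hcc)
      (fun y hy => by
        rw [hp0, ← wA_eq]
        exact hw y (closedBall_subset_closedBall' (by linarith) hy)) (S.gradZ x hx hxR)
    rw [hgr0] at this
    have e : gz - mv P (x - z) + -(gz + mv A (x - z)) = - mv (P + A) (x - z) := by rw [mv_add]; abel
    rw [e, norm_neg] at this
    refine this.trans ?_
    have e2 : E * r ^ 2 / (r1 / 2) = 2 * CR * E * r := by field_simp; rw [hrr1]; ring
    rw [← hG, e2]
    have : δ * r ≤ 2 * CR * δ * r := by nlinarith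
    calc _ ≤ G * (2 * CR * E * r + 2 * CR * δ * r) := by gcongr
      _ = _ := by ring

end

section

open scoped Topology

variable {n : ℕ}

set_option maxHeartbeats 1000000 in
lemma thmA (hn : 2 ≤ n) {lam Lam CR R0 m0 : ℝ} (hl : 0 < lam) (hL : lam ≤ Lam) (hCR : 2 ≤ CR) (hR0 : 0 < R0)
    (hm0 : 0 ≤ m0) :
    ∃ C : ℝ, 0 < C ∧ ∀ {B : Mat n} {V f : En n → ℝ} {Z : Set (En n)} {T T' : En n →ₗ[ℝ] En n}
    {P : Mat n} {gz z : En n}, Setup lam Lam CR B V f Z T T' P gz z R0 → ‖gz‖ ≤ m0 →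
    (∀ y ∈ closedBall z R0, |V y| ≤ m0) →
    ∀ y ∈ closedBall z R0, |V y - V z - inner ℝ gz (y - z)| ≤ C * ‖y - z‖ ^ 2 := by
  have hn0 : 0 < n := by omega
  have hnr : (0:ℝ) < n := by exact_mod_cast hn0
  have hLp : 0 < Lam := hl.trans_le hL
  obtain ⟨θ, C1, C3, C5, hθ, hθ1, hC1, hC3, hC5, H⟩ := step hn0 hl hL hCR
  set E0 : ℝ := (2 * m0 + m0 * R0) / R0 ^ 2 with hE0
  have hE00 : 0 ≤ E0 := by positivity
  set Es := max E0 (2 * C1) with hEs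
  have hEs1 : E0 ≤ Es := le_max_left _ _
  have hEs2 : 2 * C1 ≤ Es := le_max_right _ _
  set L := 4 * C1 + 4 with hLd
  set η := 1 / (4 * L) with hη
  have hL0 : 0 < L := by positivity
  have hη0 : 0 < η := by positivity
  have hLη : L * η = 1 / 4 := by rw [hη]; field_simp
  set c := lam / (2 * n ^ 2 * Lam) with hc
  have hc0 : 0 < c := by positivity
  set D := 4 * C3 with hD
  have hD0 : 0 ≤ D := by positivity
  set K0 := max (max (2 * n / lam) (1 / lam)) (C5 / (c * η * θ)) with hK0
  have k1 : 2 * n / lam ≤ K0 := (le_max_left _ _).trans (le_max_left _ _)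
  have k2 : 1 / lam ≤ K0 := (le_max_right _ _).trans (le_max_left _ _)
  have k3 : C5 / (c * η * θ) ≤ K0 := le_max_right _ _
  have hK0p : 0 < K0 := lt_of_lt_of_le (by positivity) k2
  set K1 := K0 + C3 * (Es + 1) + D * (Es + L) with hK1
  have hEs0 : 0 ≤ Es := hE00.trans hEs1
  have hK1p : 0 ≤ K1 := by positivity
  set Cf := Es + n ^ 2 * (K1 + 1 / lam) with hCf
  have hCfp : 0 ≤ Cf := by positivity
  refine ⟨Cf / θ ^ 2 + 1, by positivity, ?_⟩
  intro B V f Z T T' P gz z S hgz hV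
  have inv : ∀ k : ℕ, ∃ (A : Mat n) (E δ : ℝ) (e e' : En n), A.IsSymm ∧ LB B A = 0 ∧ OP e e' ∧
      Slab Z z e e' (θ ^ k * R0) (δ * (θ ^ k * R0)) ∧ 0 < δ ∧ δ ≤ 1 ∧ 0 ≤ E ∧ E ≤ Es ∧
      (∀ y ∈ closedBall z (θ ^ k * R0), |wA V z gz A y| ≤ E * (θ ^ k * R0) ^ 2) ∧ ‖P + A‖ + D * (E + L * δ) ≤ K1 := by
    intro k
    induction k with
    | zero =>
      obtain ⟨e, e', ho⟩ := exists_OP hn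
      refine ⟨0, E0, 1, e, e', by simp [Matrix.IsSymm], LB_zero B, ho, ?_, one_pos, le_rfl, hE00, hEs1, ?_, ?_⟩
      · intro x _ hx
        have := ho.le1 (x - z)
        constructor <;> linarith [this.1, this.2]
      · intro y hy
        rw [pow_zero, one_mul] at hy ⊢
        have e : E0 * R0 ^ 2 = 2 * m0 + m0 * R0 := by rw [hE0]; field_simp
        rw [e, wA, qf_zero]
        have h1 := abs_le.1 (hV y hy)
        have h2 := abs_le.1 (hV z (by simp [hR0.le]))
        have h3 : |inner ℝ gz (y - z)| ≤ m0 * R0 := by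
          refine (abs_real_inner_le_norm _ _).trans ?_
          rw [mem_closedBall_iff_norm] at hy
          gcongr
        have h4 := abs_le.1 h3
        rw [abs_le]; constructor <;> linarith [h1.1, h1.2, h2.1, h2.2, h4.1, h4.2]
      · rw [add_zero, mul_one]
        have := S.Pb
        have h5 : D * (E0 + L) ≤ D * (Es + L) := by gcongr
        have : 0 ≤ C3 * (Es + 1) := by positivity
        linarith
    | succ k ih =>
      obtain ⟨A, E, δ, e, e', hA, hLA, ho, hs, hδ, hδ1, hE, hEE, hbd, hΦ⟩ := ih
      set r := θ ^ k * R0 with hr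
      have hr0 : 0 < r := by positivity
      have hrR : r ≤ R0 := by
        rw [hr]; exact mul_le_of_le_one_left hR0.le (pow_le_one₀ hθ.le hθ1.le)
      obtain ⟨⟨A1, hA1, hLA1, hdA, hbd1⟩, hgrad⟩ := H S r A E δ e e' hr0 hrR hA hLA ho hs hδ hδ1 hE hbd
      have hr' : θ ^ (k + 1) * R0 = θ * r := by rw [hr, pow_succ]; ring
      rw [hr']
      have hE' : E / 2 + C1 * δ ≤ Es := by
        have : C1 * δ ≤ C1 * 1 := by gcongr
        linarith
      have hE'0 : 0 ≤ E / 2 + C1 * δ := by positivity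
      have hPA : ‖P + A1‖ ≤ ‖P + A‖ + C3 * (E + δ) := by
        have : P + A1 = (P + A) + (A1 - A) := by abel
        rw [this]; exact (norm_add_le _ _).trans (by gcongr)
      by_cases hbig : K0 ≤ ‖P + A‖
      · have hLPA : |LB B (P + A)| ≤ 1 := by rw [LB_add, hLA, add_zero]; exact S.PL
        obtain ⟨e1, e2, ho', hee⟩ := bigeig S.hB hn0 (S.Ps.add hA) hLPA (k1.trans hbig)
        have hδ' : 0 < min 1 (η * (E + δ)) := by positivity
        refine ⟨A1, E / 2 + C1 * δ, min 1 (η * (E + δ)), e1, e2, hA1, hLA1, ho', ?_, hδ', min_le_left _ _,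
          hE'0, hE', hbd1, ?_⟩
        · have key : ∀ t : ℝ, 0 ≤ t → c * ‖P + A‖ * t ≤ C5 * (E + δ) * r → t ≤ η * (E + δ) * (θ * r) := by
            intro t ht h
            have h1 : c * K0 * t ≤ C5 * (E + δ) * r := le_trans (by gcongr) h
            have h2 : C5 ≤ K0 * (c * η * θ) := by rwa [div_le_iff₀ (by positivity)] at k3
            have h3 : c * K0 * t ≤ c * K0 * (η * (E + δ) * (θ * r)) := by
              refine h1.trans ?_
              calc C5 * (E + δ) * r ≤ K0 * (c * η * θ) * (E + δ) * r := by gcongr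
                _ = _ := by ring
            exact le_of_mul_le_mul_left h3 (by positivity)
          have key2 : ∀ t : ℝ, t ≤ θ * r → t ≤ η * (E + δ) * (θ * r) → t ≤ min 1 (η * (E + δ)) * (θ * r) := by
            intro t h1 h2
            rw [min_mul_of_nonneg _ _ (by positivity)]
            exact le_min (by linarith) h2
          intro x hx hxr
          have g := hgrad x hx hxr
          have b := ho'.le1 (x - z)
          exact ⟨key2 _ (b.1.trans hxr.le) (key _ (abs_nonneg _) ((hee (x - z)).1.trans g)),
            key2 _ (b.2.trans hxr.le) (key _ (abs_nonneg _) ((hee (x - z)).2.trans g))⟩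
        · have h1 : L * min 1 (η * (E + δ)) ≤ 1 / 4 * (E + δ) := by
            rw [← hLη, mul_assoc]; gcongr; exact min_le_right _ _
          have h2 : D * (E / 2 + C1 * δ + L * min 1 (η * (E + δ))) ≤ D * (E / 2 + C1 * δ + 1 / 4 * (E + δ)) := by gcongr
          have h3 : 0 ≤ C3 * (C1 * δ) := by positivity
          have h4 : 0 ≤ C3 * δ := by positivity
          have h5 : ‖P + A‖ + C3 * (E + δ) + D * (E / 2 + C1 * δ + 1 / 4 * (E + δ)) ≤ ‖P + A‖ + D * (E + L * δ) := by
            have e : D * (E + L * δ) - D * (E / 2 + C1 * δ + 1 / 4 * (E + δ)) = C3 * (E + δ) + 12 * (C3 * (C1 * δ)) + 14 * (C3 * δ) := by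
              rw [hD, hLd]; ring
            linarith
          linarith
      · push Not at hbig
        refine ⟨A1, E / 2 + C1 * δ, 1, e, e', hA1, hLA1, ho, ?_, one_pos, le_rfl, hE'0, hE', hbd1, ?_⟩
        · intro x hx hxr
          have b := ho.le1 (x - z)
          constructor <;> linarith [b.1, b.2]
        · have h1 : C3 * (E + δ) ≤ C3 * (Es + 1) := by gcongr
          have h2 : D * (E / 2 + C1 * δ + L * 1) ≤ D * (Es + L) := by rw [mul_one]; gcongr
          linarith
  have fin : ∀ k : ℕ, ∀ y ∈ closedBall z (θ ^ k * R0), |V y - V z - inner ℝ gz (y - z)| ≤ Cf * (θ ^ k * R0) ^ 2 := by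
    intro k y hy
    obtain ⟨A, E, δ, e, e', hA, hLA, ho, hs, hδ, hδ1, hE, hEE, hbd, hΦ⟩ := inv k
    have h1 := hbd y hy
    have hAn : ‖A‖ ≤ K1 + 1 / lam := by
      have : A = (P + A) - P := by abel
      rw [this]
      refine (norm_sub_le _ _).trans (add_le_add ?_ S.Pb)
      have : 0 ≤ D * (E + L * δ) := by positivity
      linarith
    have h2 := qf_bound A ‖A‖ (entry_le A) (y - z)
    rw [mem_closedBall_iff_norm] at hy
    set r := θ ^ k * R0
    have h3 : n ^ 2 * ‖A‖ * ‖y - z‖ ^ 2 ≤ n ^ 2 * (K1 + 1 / lam) * r ^ 2 := by gcongr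
    have h4 : E * r ^ 2 ≤ Es * r ^ 2 := by gcongr
    have e : V y - V z - inner ℝ gz (y - z) = wA V z gz A y + qf A (y - z) / 2 := by rw [wA]; ring
    rw [e]
    refine (abs_add_le _ _).trans ?_
    rw [abs_div, abs_two, hCf]
    have := abs_nonneg (qf A (y - z))
    rw [add_mul]
    linarith
  intro y hy
  by_cases hyz : y = z
  · subst hyz; simp
  have hpos : 0 < ‖y - z‖ := norm_pos_iff.2 (sub_ne_zero.2 hyz)
  rw [mem_closedBall_iff_norm] at hy
  obtain ⟨k, hk1, hk2⟩ := exists_nat_pow_near_of_lt_one (x := ‖y - z‖ / R0) (by positivity)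
    (by rw [div_le_one hR0]; exact hy) hθ hθ1
  rw [lt_div_iff₀ hR0] at hk1
  rw [div_le_iff₀ hR0] at hk2
  refine (fin k y (by rwa [mem_closedBall_iff_norm])).trans ?_
  have e : Cf * (θ ^ k * R0) ^ 2 = Cf / θ ^ 2 * (θ ^ (k + 1) * R0) ^ 2 := by field_simp; ring
  rw [e]
  have : (θ ^ (k + 1) * R0) ^ 2 ≤ ‖y - z‖ ^ 2 := by gcongr
  calc _ ≤ Cf / θ ^ 2 * ‖y - z‖ ^ 2 := by gcongr
    _ ≤ _ := by rw [add_mul]; linarith [sq_nonneg ‖y - z‖]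

end

section

open scoped Topology

variable {n : ℕ}

def e0 [NeZero n] : En n := EuclideanSpace.single 0 1

lemma inner_e0 [NeZero n] (v : En n) : inner ℝ e0 v = v 0 := by
  simp [e0, EuclideanSpace.inner_single_left]

lemma e0_apply [NeZero n] (i : Fin n) : (e0 : En n) i = if i = 0 then 1 else 0 := by
  simp [e0, Pi.single_apply]

def Be [NeZero n] (B : Mat n) : En n := WithLp.toLp 2 fun i => B i 0

/-- oblique reflection -/
def Tl [NeZero n] (B : Mat n) : En n →ₗ[ℝ] En n where
  toFun x := x - (2 * x 0 / B 0 0) • Be B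
  map_add' x y := by
    rw [PiLp.add_apply, mul_add, add_div, add_smul]; abel
  map_smul' c x := by
    rw [PiLp.smul_apply, smul_eq_mul, RingHom.id_apply, smul_sub, smul_smul]
    congr 2; ring

def Tl' [NeZero n] (B : Mat n) : En n →ₗ[ℝ] En n where
  toFun p := p - (2 * inner ℝ (Be B) p / B 0 0) • e0
  map_add' x y := by
    rw [inner_add_right, mul_add, add_div, add_smul]; abel
  map_smul' c x := by
    rw [inner_smul_right, RingHom.id_apply, smul_sub, smul_smul]
    congr 2; ring

lemma Tl_apply [NeZero n] (B : Mat n) (x : En n) : Tl B x = x - (2 * x 0 / B 0 0) • Be B := rfl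
lemma Tl'_apply [NeZero n] (B : Mat n) (p : En n) : Tl' B p = p - (2 * inner ℝ (Be B) p / B 0 0) • e0 := rfl

lemma qf_e0 [NeZero n] (B : Mat n) : qf B e0 = B 0 0 := by
  simp [qf, e0_apply]

lemma bf_e0 [NeZero n] (B : Mat n) (hs : ∀ i j, B i j = B j i) (p : En n) : bf B p e0 = inner ℝ (Be B) p := by
  rw [inner_eq]
  simp [bf, e0_apply, Be]

lemma norm_e0 [NeZero n] : ‖(e0 : En n)‖ = 1 := by simp [e0]

section
variable [NeZero n] {lam Lam : ℝ} {B : Mat n} (hB : Ell lam Lam B)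
include hB

lemma B00 : lam ≤ B 0 0 ∧ B 0 0 ≤ Lam := by
  have a := hB.lower e0; have b := hB.upper e0
  rw [qf_e0, norm_e0] at a b
  constructor <;> linarith

lemma Tl_zero (x : En n) : (Tl B x) 0 = - x 0 := by
  have := (B00 hB).1; have := hB.lam_pos
  have hb : B 0 0 ≠ 0 := by linarith
  rw [Tl_apply, PiLp.sub_apply, PiLp.smul_apply, smul_eq_mul]
  show x 0 - 2 * x 0 / B 0 0 * B 0 0 = _
  field_simp; ring

lemma Tl_inv (x : En n) : Tl B (Tl B x) = x := by
  rw [Tl_apply B (Tl B x), Tl_zero hB, Tl_apply]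
  rw [sub_sub, ← add_smul]
  have : 2 * x 0 / B 0 0 + 2 * -x 0 / B 0 0 = 0 := by ring
  rw [this, zero_smul, sub_zero]

lemma Tl_fix {x : En n} (hx : x 0 = 0) : Tl B x = x := by
  rw [Tl_apply, hx]; simp

lemma Tl_adj (p y : En n) : inner ℝ (Tl' B p) y = inner ℝ p (Tl B y) := by
  rw [Tl_apply, Tl'_apply, inner_sub_left, inner_sub_right, inner_smul_left, inner_smul_right, inner_e0,
    real_inner_comm p (Be B)]
  simp only [conj_trivial]; ring

lemma Tl_q (p : En n) : qf B (Tl' B p) = qf B p := by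
  have := (B00 hB).1; have := hB.lam_pos
  have hb : B 0 0 ≠ 0 := by linarith
  have := qf_comb B hB.symm 1 (-(2 * inner ℝ (Be B) p / B 0 0)) p e0
  rw [one_smul, neg_smul, ← sub_eq_add_neg] at this
  rw [Tl'_apply, this, bf_e0 B hB.symm, qf_e0]
  field_simp; ring

lemma B_entry (i : Fin n) : |B i 0| ≤ Lam := by
  have h1 := hB.qf_nonneg ((1:ℝ) • EuclideanSpace.single i 1 + (1:ℝ) • e0)
  have h2 := hB.qf_nonneg ((1:ℝ) • EuclideanSpace.single i 1 + (-1:ℝ) • e0)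
  rw [qf_comb B hB.symm, bf_e0 B hB.symm, qf_e0] at h1 h2
  have e : inner ℝ (Be B) (EuclideanSpace.single i (1:ℝ)) = B i 0 := by
    rw [real_inner_comm]; simp [EuclideanSpace.inner_single_left, Be]
  have hi := hB.upper (EuclideanSpace.single i 1)
  have h0 := (B00 hB).2
  rw [e] at h1 h2
  simp at hi
  rw [abs_le]; constructor <;> linarith

lemma Be_norm : ‖Be B‖ ≤ n * Lam :=
  norm_le_coords _ (fun i => B_entry hB i) (hB.lam_pos.le.trans hB.lam_le)

lemma Be_scaled (t : ℝ) : ‖(2 * t / B 0 0) • Be B‖ ≤ 2 * n * Lam / lam * |t| := by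
  have h1 := (B00 hB).1; have hl := hB.lam_pos
  have hb : 0 < B 0 0 := by linarith
  have hL := hl.le.trans hB.lam_le
  rw [norm_smul, Real.norm_eq_abs, abs_div, abs_mul, abs_two, abs_of_pos hb]
  calc _ ≤ 2 * |t| / lam * (n * Lam) := by
        apply mul_le_mul _ (Be_norm hB) (norm_nonneg _) (by positivity)
        gcongr
    _ = _ := by ring

lemma Tl_norm (v : En n) : ‖Tl B v‖ ≤ (2 + 2 * n * Lam / lam) * ‖v‖ := by
  rw [Tl_apply]
  refine (norm_sub_le _ _).trans ?_
  have h1 := Be_scaled hB (v 0)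
  have h2 := abs_coord v 0
  have hL := hB.lam_pos.le.trans hB.lam_le
  have hl := hB.lam_pos
  have h3 : 2 * n * Lam / lam * |v 0| ≤ 2 * n * Lam / lam * ‖v‖ := by gcongr
  linarith [norm_nonneg v]

lemma Tl_dist {y z : En n} (hy : y 0 ≤ 0) (hz : 0 ≤ z 0) : ‖Tl B y - z‖ ≤ (2 + 2 * n * Lam / lam) * ‖y - z‖ := by
  have e : Tl B y - z = (y - z) - (2 * y 0 / B 0 0) • Be B := by rw [Tl_apply]; abel
  rw [e]
  refine (norm_sub_le _ _).trans ?_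
  have h1 := Be_scaled hB (y 0)
  have h2 : |y 0| ≤ ‖y - z‖ := by
    have := abs_coord (y - z) 0
    rw [PiLp.sub_apply] at this
    refine le_trans ?_ this
    rw [abs_of_nonpos hy, abs_of_nonpos (by linarith)]; linarith
  have hL := hB.lam_pos.le.trans hB.lam_le
  have hl := hB.lam_pos
  have h3 : 2 * n * Lam / lam * |y 0| ≤ 2 * n * Lam / lam * ‖y - z‖ := by gcongr
  linarith [norm_nonneg (y - z)]

lemma Tl_cont : Continuous (Tl B) := LinearMap.continuous_of_finiteDimensional _

lemma congrT (A : Mat n) (hA : A.IsSymm) : ∃ A' : Mat n, A'.IsSymm ∧ (∀ v, qf A' v = qf A (Tl B v)) ∧ LB B A' = LB B A := by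
  obtain ⟨v, μ, h1, h2⟩ := spec A hA
  have key : ∀ w : Fin n → En n, ∀ A' : Mat n, (∀ i j, A' i j = ∑ k, μ k * w k i * w k j) → ∀ x,
      qf A' x = ∑ k, μ k * inner ℝ (w k) x ^ 2 := by
    intro w A' h x
    have : A' = ∑ k, μ k • op (w k) := by
      ext i j; rw [h, Matrix.sum_apply]
      refine Finset.sum_congr rfl fun k _ => by simp [op, mul_assoc]
    rw [this]
    have gen : ∀ s : Finset (Fin n), qf (∑ k ∈ s, μ k • op (w k)) x = ∑ k ∈ s, μ k * inner ℝ (w k) x ^ 2 := by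
      intro s
      induction s using Finset.induction_on with
      | empty => simp [qf]
      | insert a s ha ih => rw [Finset.sum_insert ha, Finset.sum_insert ha, qf_add, ih, qf_smul, qf_op]
    exact gen _
  set A' : Mat n := Matrix.of fun i j => ∑ k, μ k * (Tl' B (v k)) i * (Tl' B (v k)) j with hA'
  have hA'e : ∀ i j, A' i j = ∑ k, μ k * (Tl' B (v k)) i * (Tl' B (v k)) j := fun i j => rfl
  refine ⟨A', ?_, fun x => ?_, ?_⟩
  · ext i j; rw [Matrix.transpose_apply, hA'e, hA'e]; exact Finset.sum_congr rfl fun k _ => by ring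
  · rw [key _ A' hA'e, key _ A h1]
    exact Finset.sum_congr rfl fun k _ => by rw [Tl_adj hB]
  · rw [spec_LB hA'e, spec_LB h1]
    exact Finset.sum_congr rfl fun k _ => by rw [Tl_q hB]

lemma UJ_T {w : En n → ℝ} {x b : En n} {A A' : Mat n} (h : UJ w x b A) (hA : ∀ v, qf A' v = qf A (Tl B v)) :
    UJ (fun y => w (Tl B y)) (Tl B x) (Tl' B b) A' := by
  intro ε hε
  set c := 2 + 2 * n * Lam / lam with hc
  have hl := hB.lam_pos
  have hL := hl.le.trans hB.lam_le
  have hc0 : 0 < c := by positivity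
  have ht : Tendsto (Tl B) (𝓝 (Tl B x)) (𝓝 x) := by
    have := (Tl_cont hB).tendsto (Tl B x)
    rwa [Tl_inv hB] at this
  filter_upwards [ht.eventually (h (ε / c ^ 2) (by positivity))] with y hy
  have e : Tl B y - x = Tl B (y - Tl B x) := by rw [map_sub, Tl_inv hB]
  rw [e, ← Tl_adj hB, ← hA] at hy
  simp only [Tl_inv hB]
  have h5 := Tl_norm hB (y - Tl B x)
  have key : ε / c ^ 2 * ‖Tl B (y - Tl B x)‖ ^ 2 ≤ ε * ‖y - Tl B x‖ ^ 2 := by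
    calc ε / c ^ 2 * ‖Tl B (y - Tl B x)‖ ^ 2 ≤ ε / c ^ 2 * (c * ‖y - Tl B x‖) ^ 2 := by gcongr
      _ = _ := by field_simp
  linarith

end

def oext [NeZero n] (B : Mat n) (v : En n → ℝ) (y : En n) : ℝ := if 0 ≤ y 0 then v y else - v (Tl B y)
def fext [NeZero n] (B : Mat n) (g : En n → ℝ) (y : En n) : ℝ := if 0 < y 0 then g y else if y 0 < 0 then - g (Tl B y) else 0

lemma coord_cont [NeZero n] : Continuous fun y : En n => y 0 := by fun_prop

lemma reflect_sub [NeZero n] {lam Lam : ℝ} {B : Mat n} (hB : Ell lam Lam B) {v g : En n → ℝ} {z : En n} {r R0 : ℝ}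
    (hz : 0 ≤ z 0) (hR : (2 + 2 * n * Lam / lam) * R0 ≤ r)
    (h1 : Sub B v g (Bplus n z r)) (h2 : Sub B (fun y => - v y) (fun y => - g y) (Bplus n z r))
    (h0 : ∀ y ∈ ball z r, y 0 = 0 → v y = 0) : Sub B (oext B v) (fext B g) (ball z R0) := by
  have hl := hB.lam_pos
  have hL := hl.le.trans hB.lam_le
  intro x hx b A hA hU
  have hxn : ‖x - z‖ < R0 := by simpa [dist_eq_norm] using hx
  have hR0 : 0 < R0 := (norm_nonneg _).trans_lt hxn
  have hc1 : 1 ≤ 2 + 2 * n * Lam / lam := by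
    have : 0 ≤ 2 * n * Lam / lam := by positivity
    linarith
  have hRr : R0 ≤ r := le_trans (le_mul_of_one_le_left hR0.le hc1) hR
  rcases lt_trichotomy (x 0) 0 with hx0 | hx0 | hx0
  · obtain ⟨A', hA', hq, hLB⟩ := congrT hB A hA
    have hT := UJ_T hB hU hq
    have hT0 : 0 < (Tl B x) 0 := by rw [Tl_zero hB]; linarith
    have hT2 : UJ (fun y => - v y) (Tl B x) (Tl' B b) A' := by
      refine hT.congr ?_
      filter_upwards [(isOpen_lt continuous_const coord_cont).mem_nhds hT0] with y hy
      have : (0:ℝ) < y 0 := hy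
      rw [oext, Tl_zero hB, Tl_inv hB, if_neg (by linarith)]
    have hmem : Tl B x ∈ Bplus n z r := by
      refine ⟨hT0, ?_⟩
      rw [mem_ball, dist_eq_norm]
      refine (Tl_dist hB hx0.le hz).trans_lt (lt_of_lt_of_le ?_ hR)
      gcongr
    have := h2 _ hmem _ A' hA' hT2
    rw [hLB] at this
    rw [fext, if_neg (by linarith), if_pos hx0]; exact this
  · obtain ⟨A', hA', hq, hLB⟩ := congrT hB A hA
    have hT := hU.add (UJ_T hB hU hq |> fun h => by rwa [Tl_fix hB hx0] at h)
    have hc : UJ (fun _ => (0:ℝ)) x (b + Tl' B b) (A + A') := by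
      refine hT.congr ?_
      filter_upwards [isOpen_ball.mem_nhds (ball_subset_ball hRr hx)] with y hy
      rw [oext, oext, Tl_zero hB, Tl_inv hB]
      rcases lt_trichotomy (y 0) 0 with hy0 | hy0 | hy0
      · rw [if_neg (by linarith), if_pos (by linarith)]; ring
      · rw [if_pos hy0.ge, if_pos (by linarith), Tl_fix hB hy0, h0 y hy hy0]; ring
      · rw [if_pos hy0.le, if_neg (by linarith)]; ring
    have := LB_nonneg hB _ (hA.add hA') (UJ_nonneg_of_const hc)
    rw [LB_add, hLB] at this
    rw [fext, if_neg (by linarith), if_neg (by linarith)]; linarith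
  · have hmem : x ∈ Bplus n z r := ⟨hx0, ball_subset_ball hRr hx⟩
    have := h1 x hmem b A hA (hU.congr (by
      filter_upwards [(isOpen_lt continuous_const coord_cont).mem_nhds hx0] with y hy
      have : (0:ℝ) < y 0 := hy
      rw [oext, if_pos this.le]))
    rw [fext, if_pos hx0]; exact this

end

section

open scoped Topology

variable {n : ℕ}

structure LinP [NeZero n] (B : Mat n) (z : En n) (M : ℝ) (u : En n → ℝ) (Ω : Set (En n)) : Prop where
  cont : ContinuousOn u (closure (Bplus n z 1))
  Ωo : IsOpen Ω
  Ωs : Ω ⊆ HplusSet n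
  s1 : Sub B u (Ω.indicator fun _ => (1 : ℝ)) (Bplus n z 1)
  s2 : Sub B (fun y => - u y) (fun y => - Ω.indicator (fun _ => (1 : ℝ)) y) (Bplus n z 1)
  vanish : ∀ x ∈ Bplus n z 1 \ Ω, u x = 0 ∧ HasGradientAt u 0 x
  bdd : ∀ x ∈ Bplus n z 1, |u x| ≤ M
  bz : ∀ x ∈ PiSet n ∩ ball (0 : En n) 1, u x = 0
  zf : z ∈ frontier Ω
  uz : u z = 0
  gw : HasGradientWithinAt u 0 (closure (Bplus n z 1)) z
  zb : z ∈ ball (0 : En n) (1 / 2)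

lemma UJ.smul {w : En n → ℝ} {x b : En n} {A : Mat n} {c : ℝ} (hc : 0 < c) (h : UJ w x b A) :
    UJ (fun y => c * w y) x (c • b) (c • A) := by
  intro ε hε
  filter_upwards [h (ε / c) (by positivity)] with y hy
  rw [inner_smul_left, qf_smul]
  have := mul_le_mul_of_nonneg_left hy hc.le
  have e : c * (ε / c * ‖y - x‖ ^ 2) = ε * ‖y - x‖ ^ 2 := by field_simp
  simp only [conj_trivial]
  linarith

lemma Sub.smul {B : Mat n} {w f : En n → ℝ} {D : Set (En n)} {c : ℝ} (hc : 0 < c) (h : Sub B w f D) :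
    Sub B (fun y => c * w y) (fun y => c * f y) D := by
  intro x hx b A hA hU
  have h1 := UJ.smul (inv_pos.2 hc) hU
  have h2 : UJ w x (c⁻¹ • b) (c⁻¹ • A) := by
    refine h1.congr (Filter.Eventually.of_forall fun y => ?_)
    field_simp
  have h3 := h x hx _ _ (by unfold Matrix.IsSymm at *; rw [Matrix.transpose_smul, hA]) h2
  rw [LB_smul, inv_mul_eq_div, le_div_iff₀ hc] at h3
  linarith

lemma mem_clo [NeZero n] {y z : En n} {r : ℝ} (hy : 0 ≤ y 0) (hr : y ∈ ball z r) : y ∈ closure (Bplus n z r) := by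
  have h1 : y ∈ closure (HplusSet n) := by
    have ht : Tendsto (fun t : ℝ => y + t • (e0 : En n)) (𝓝[>] 0) (𝓝 y) := by
      have : Continuous fun t : ℝ => y + t • (e0 : En n) := by fun_prop
      have := (this.tendsto 0).mono_left (nhdsWithin_le_nhds (s := Ioi 0))
      simpa using this
    refine mem_closure_of_tendsto ht ?_
    filter_upwards [self_mem_nhdsWithin] with t ht
    have : (0:ℝ) < t := ht
    show 0 < (y + t • (e0 : En n)) 0
    rw [PiLp.add_apply, PiLp.smul_apply, e0_apply]; simp; linarith
  have := isOpen_ball.inter_closure (t := HplusSet n) ⟨hr, h1⟩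
  rwa [inter_comm] at this

lemma gradW {v : En n → ℝ} {s : Set (En n)} {z : En n} (h : HasGradientWithinAt v 0 s z) (hz : v z = 0) {ε : ℝ} (hε : 0 < ε) :
    ∀ᶠ y in 𝓝[s] z, |v y| ≤ ε * ‖y - z‖ := by
  rw [hasGradientWithinAt_iff_isLittleO] at h
  filter_upwards [h.bound hε] with y hy
  simpa [hz] using hy

lemma LinP.z0 [NeZero n] {B : Mat n} {z : En n} {M : ℝ} {u : En n → ℝ} {Ω : Set (En n)} (h : LinP B z M u Ω) : 0 ≤ z 0 := by
  have h1 : z ∈ closure Ω := h.zf.1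
  have h2 : closure Ω ⊆ {x : En n | 0 ≤ x 0} :=
    closure_minimal (fun x hx => (show (0:ℝ) < x 0 from h.Ωs hx).le) (isClosed_le continuous_const coord_cont)
  exact h2 h1

lemma LinP.zn [NeZero n] {B : Mat n} {z : En n} {M : ℝ} {u : En n → ℝ} {Ω : Set (En n)} (h : LinP B z M u Ω) : z ∉ Ω := by
  have := h.zf.2
  rwa [h.Ωo.interior_eq] at this

lemma LinP.u0 [NeZero n] {B : Mat n} {z : En n} {M : ℝ} {u : En n → ℝ} {Ω : Set (En n)} (h : LinP B z M u Ω) {y : En n}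
    (hy : y ∈ ball z (1/2)) (hy0 : y 0 = 0) : u y = 0 := by
  refine h.bz y ⟨hy0, ?_⟩
  have h1 := h.zb
  rw [mem_ball] at *
  linarith [dist_triangle y z 0]

lemma LinP.ub [NeZero n] {B : Mat n} {z : En n} {M : ℝ} {u : En n → ℝ} {Ω : Set (En n)} (h : LinP B z M u Ω) (hM : 0 < M) {y : En n}
    (hy : y ∈ ball z (1/2)) (hy0 : 0 ≤ y 0) : |u y| ≤ M := by
  rcases hy0.eq_or_lt with h0 | h0
  · rw [h.u0 hy h0.symm]; simpa using hM.le
  · exact h.bdd y ⟨h0, ball_subset_ball (by norm_num) hy⟩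

lemma oext_grad [NeZero n] {lam Lam : ℝ} {B : Mat n} (hB : Ell lam Lam B) {v : En n → ℝ} {z : En n}
    (h : HasGradientWithinAt v 0 (closure (Bplus n z 1)) z) (hv : v z = 0) (hz : z 0 = 0) :
    HasGradientAt (oext B v) 0 z := by
  rw [hasGradientAt_iff_isLittleO]
  have hV : oext B v z = 0 := by rw [oext, if_pos hz.ge, hv]
  refine Asymptotics.IsLittleO.of_bound fun ε hε => ?_
  have hl := hB.lam_pos
  have hL := hl.le.trans hB.lam_le
  set c := 2 + 2 * n * Lam / lam with hc
  have hc0 : 0 < c := by positivity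
  have hc1 : 1 ≤ c := by
    have : 0 ≤ 2 * n * Lam / lam := by positivity
    linarith
  have h1 := gradW h hv (ε := ε / c) (by positivity)
  rw [eventually_nhdsWithin_iff] at h1
  have ht : Tendsto (Tl B) (𝓝 z) (𝓝 z) := by
    have := (Tl_cont hB).tendsto z
    rwa [Tl_fix hB hz] at this
  have hb : ball z 1 ∈ 𝓝 z := ball_mem_nhds z one_pos
  filter_upwards [h1, ht.eventually h1, hb, ht.eventually_mem hb] with y a1 a2 a3 a4
  rw [hV]
  simp only [inner_zero_left, sub_zero, Real.norm_eq_abs]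
  rw [oext]
  split_ifs with hy
  · refine (a1 (mem_clo hy a3)).trans ?_
    gcongr
    exact div_le_self hε.le hc1
  · push Not at hy
    rw [abs_neg]
    refine (a2 (mem_clo (by rw [Tl_zero hB]; linarith) a4)).trans ?_
    have := Tl_dist hB (y := y) (z := z) hy.le hz.ge
    calc ε / c * ‖Tl B y - z‖ ≤ ε / c * (c * ‖y - z‖) := by gcongr
      _ = _ := by field_simp

end

section

open scoped Topology

variable {n : ℕ}

def Pm [NeZero n] (B : Mat n) (τ : ℝ) : Mat n := (τ / B 0 0) • op e0
def qm [NeZero n] (B : Mat n) (τ : ℝ) : Pol n := qp 0 0 0 (-(Pm B τ))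

lemma Pm_symm [NeZero n] (B : Mat n) (τ : ℝ) : (Pm B τ).IsSymm := by
  unfold Pm Matrix.IsSymm; rw [Matrix.transpose_smul, op_symm]

lemma nPm_symm [NeZero n] (B : Mat n) (τ : ℝ) : (-(Pm B τ)).IsSymm := by
  have := Pm_symm B τ
  unfold Matrix.IsSymm at *; rw [Matrix.transpose_neg, this]

lemma ev_qm [NeZero n] (B : Mat n) (τ : ℝ) (y : En n) : ev (qm B τ) y = - (τ / B 0 0 * y 0 ^ 2 / 2) := by
  rw [qm, ev_qp, qf_neg, Pm, qf_smul, qf_op, sub_zero, inner_e0]; simp; ring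

lemma mv_Pm [NeZero n] (B : Mat n) (τ : ℝ) (y : En n) : mv (-(Pm B τ)) y = -((τ / B 0 0 * y 0) • (e0 : En n)) := by
  ext i
  simp only [mv, Pm, op, e0_apply, PiLp.neg_apply, PiLp.smul_apply, Matrix.neg_apply, Matrix.smul_apply, Matrix.of_apply, smul_eq_mul]
  rw [Finset.sum_eq_single 0]
  · simp
  · intro j _ hj; simp [hj]
  · simp

lemma mv_lin (A : Mat n) (x z : En n) : mv (-A) x = mv (-A) z - mv A (x - z) := by
  ext i
  simp only [mv, PiLp.sub_apply, Matrix.neg_apply, ← Finset.sum_sub_distrib]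
  refine Finset.sum_congr rfl fun j _ => by ring

lemma gr_qm [NeZero n] (B : Mat n) (τ : ℝ) (y : En n) : gr (qm B τ) y = mv (-(Pm B τ)) y := by
  rw [qm, gr_qp _ _ _ _ (nPm_symm B τ)]; simp

lemma LP_qm [NeZero n] {lam Lam : ℝ} {B : Mat n} (hB : Ell lam Lam B) (τ : ℝ) (y : En n) : ev (LP B (qm B τ)) y = -τ := by
  have := (B00 hB).1; have := hB.lam_pos
  have hb : B 0 0 ≠ 0 := by linarith
  rw [qm, LP_qp _ _ _ _ _ (nPm_symm B τ), ev_C, LB_neg, Pm, LB_smul, LB_op, qf_e0]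
  field_simp

lemma oext_neg [NeZero n] (B : Mat n) (v : En n → ℝ) : oext B (fun y => - v y) = fun y => - oext B v y := by
  ext y; unfold oext; split_ifs <;> rfl
lemma fext_neg [NeZero n] (B : Mat n) (v : En n → ℝ) : fext B (fun y => - v y) = fun y => - fext B v y := by
  ext y; unfold fext; split_ifs <;> simp

lemma mkSetup [NeZero n] {lam Lam : ℝ} {B : Mat n} (hB : Ell lam Lam B) {z : En n} {M : ℝ} {u : En n → ℝ}
    {Ω : Set (En n)} (h : LinP B z M u Ω) (hM : 0 < M) {R0 τ : ℝ} (hR0 : 0 < R0) (hR : (2 + 2 * n * Lam / lam) * R0 ≤ 1/4)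
    (hτ : 0 < τ) (hτ1 : τ ≤ 1) (hτM : τ * M ≤ 1) :
    Setup lam Lam (2 + 2 * n * Lam / lam) B (oext B fun y => τ * u y + ev (qm B τ) y)
      (fext B fun y => τ * (Ω.indicator (fun _ => (1:ℝ)) y - 1)) {x | 0 < x 0 ∧ x ∉ Ω} (Tl B) (Tl' B) (Pm B τ)
      (mv (-(Pm B τ)) z) z R0 ∧ ‖mv (-(Pm B τ)) z‖ ≤ 1 + 2 / lam ∧
      ∀ y ∈ closedBall z R0, |oext B (fun y => τ * u y + ev (qm B τ) y) y| ≤ 1 + 2 / lam := by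
  have hl := hB.lam_pos
  have hL := hl.le.trans hB.lam_le
  have hb := (B00 hB).1
  have hb0 : 0 < B 0 0 := by linarith
  have hz0 := h.z0
  set CR := 2 + 2 * n * Lam / lam with hCRd
  have hCR : 2 ≤ CR := by
    have : 0 ≤ 2 * n * Lam / lam := by positivity
    linarith
  have hR4 : R0 ≤ 1/4 := le_trans (le_mul_of_one_le_left hR0.le (by linarith)) hR
  have hzn : ‖z‖ < 1/2 := by simpa using h.zb
  have hz1 : |z 0| ≤ 1/2 := (abs_coord z 0).trans hzn.le
  set v : En n → ℝ := fun y => τ * u y + ev (qm B τ) y with hv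
  set g : En n → ℝ := fun y => τ * (Ω.indicator (fun _ => (1:ℝ)) y - 1) with hg
  have hv0 : ∀ y ∈ ball z (1/2), y 0 = 0 → v y = 0 := by
    intro y hy hy0
    simp only [hv]; rw [h.u0 hy hy0, ev_qm, hy0]; ring
  have s1 : Sub B v g (Bplus n z 1) := by
    refine ((h.s1.smul hτ).add_poly (qm B τ)).mono subset_rfl fun x hx => ?_
    rw [LP_qm hB]; simp only [hg]; linarith
  have s2 : Sub B (fun y => - v y) (fun y => - g y) (Bplus n z 1) := by
    have e : (fun y => - v y) = fun y => τ * (- u y) + ev (-(qm B τ)) y := by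
      ext y; simp only [hv, ev_neg]; ring
    rw [e]
    refine ((h.s2.smul hτ).add_poly (-(qm B τ))).mono subset_rfl fun x hx => ?_
    have := LP_qm hB τ x
    rw [ev_LP, he_neg, LB_neg, ← ev_LP, this]; simp only [hg]; linarith
  have hball : Bplus n z (1/2) ⊆ Bplus n z 1 := fun x hx => ⟨hx.1, ball_subset_ball (by norm_num) hx.2⟩
  have s1' := s1.mono hball fun x _ => le_rfl
  have s2' := s2.mono hball fun x _ => le_rfl
  have hR' : CR * R0 ≤ 1/2 := by linarith
  have hTball : ∀ y ∈ closedBall z R0, y 0 ≤ 0 → Tl B y ∈ ball z (1/2) := by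
    intro y hy hy0
    rw [mem_ball, dist_eq_norm]
    rw [mem_closedBall, dist_eq_norm] at hy
    have := Tl_dist hB hy0 hz0
    have h3 : CR * ‖y - z‖ ≤ CR * R0 := by gcongr
    linarith
  have hbsub : closedBall z R0 ⊆ ball z (1/2) := closedBall_subset_ball (by linarith)
  have hvb : ∀ y ∈ ball z (1/2), 0 ≤ y 0 → |v y| ≤ 1 + 2 / lam := by
    intro y hy hy0
    have h1 := h.ub hM hy hy0
    have h2 : |τ * u y| ≤ 1 := by
      rw [abs_mul, abs_of_pos hτ]
      exact (mul_le_mul_of_nonneg_left h1 hτ.le).trans hτM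
    have h3 : y 0 ≤ 1 := by
      have := abs_coord (y - z) 0
      rw [mem_ball, dist_eq_norm] at hy
      rw [PiLp.sub_apply] at this
      linarith [le_abs_self (y 0 - z 0), le_abs_self (z 0)]
    have h4 : |ev (qm B τ) y| ≤ 2 / lam := by
      rw [ev_qm, abs_neg, abs_of_nonneg (by positivity)]
      have h5 : τ / B 0 0 ≤ 1 / lam := by gcongr
      have h6 : y 0 ^ 2 ≤ 1 := pow_le_one₀ hy0 h3
      have h7 : τ / B 0 0 * y 0 ^ 2 ≤ 1 / lam * 1 := by gcongr
      have h8 : 0 < 1 / lam := by positivity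
      have : 2 / lam = 2 * (1 / lam) := by ring
      linarith
    exact (abs_add_le _ _).trans (add_le_add h2 h4)
  have hgradZ : ∀ x : En n, 0 < x 0 → x ∉ Ω → x ∈ ball z R0 → HasGradientAt (oext B v) (mv (-(Pm B τ)) x) x := by
    intro x hx0 hxΩ hxb
    have h1 := (h.vanish x ⟨⟨hx0, ball_subset_ball (by linarith) hxb⟩, hxΩ⟩).2
    have h2 : HasGradientAt (fun y => τ * u y) (0 : En n) x := by
      rw [hasGradientAt_iff_hasFDerivAt] at *
      have := h1.const_mul τ
      simpa using this
    have h3 := HasGradientAt_add h2 (hasGrad_poly (qm B τ) x)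
    rw [zero_add, gr_qm] at h3
    refine h3.congr_of_eventuallyEq ?_
    filter_upwards [(isOpen_lt continuous_const coord_cont).mem_nhds hx0] with y hy
    have : (0:ℝ) < y 0 := hy
    rw [oext, if_pos this.le]
  refine ⟨⟨hB, hCR, ?_, ?_, ?_, ?_, ?_, ?_, ?_, Pm_symm B τ, ?_, ?_, Tl_adj hB, Tl_q hB, Tl_norm hB⟩, ?_, ?_⟩
  · have hvc : ContinuousOn v (closure (Bplus n z 1)) :=
      (continuousOn_const.mul h.cont).add (ev_cont _).continuousOn
    have hc1 : ContinuousOn (oext B v) (closedBall z R0 ∩ {y | 0 ≤ y 0}) := by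
      refine (hvc.mono ?_).congr (f := v) ?_
      · intro y hy
        exact mem_clo hy.2 (ball_subset_ball (by norm_num) (hbsub hy.1))
      · intro y hy
        have : 0 ≤ y 0 := hy.2
        simp only [oext]; rw [if_pos this]
    have hc2 : ContinuousOn (oext B v) (closedBall z R0 ∩ {y | y 0 ≤ 0}) := by
      have hcomp : ContinuousOn (fun y => - v (Tl B y)) (closedBall z R0 ∩ {y | y 0 ≤ 0}) := by
        refine (hvc.comp (Tl_cont hB).continuousOn ?_).neg
        intro y hy
        have : y 0 ≤ 0 := hy.2
        refine mem_clo (by rw [Tl_zero hB]; linarith) (ball_subset_ball (by norm_num) (hTball y hy.1 this))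
      refine hcomp.congr ?_
      intro y hy
      have hy0 : y 0 ≤ 0 := hy.2
      simp only [oext]
      split_ifs with hy1
      · have : y 0 = 0 := le_antisymm hy0 hy1
        rw [Tl_fix hB this, hv0 y (hbsub hy.1) this]; simp
      · rfl
    have := hc1.union_of_isClosed hc2 (isClosed_closedBall.inter (isClosed_le continuous_const coord_cont))
      (isClosed_closedBall.inter (isClosed_le coord_cont continuous_const))
    refine this.mono fun y hy => ?_
    rcases le_total 0 (y 0) with a | a
    · exact Or.inl ⟨hy, a⟩
    · exact Or.inr ⟨hy, a⟩
  · exact reflect_sub hB hz0 hR' s1' s2' hv0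
  · have := reflect_sub (v := fun y => - v y) (g := fun y => - g y) hB hz0 hR' s2' (by simpa using s1')
      (fun y hy hy0 => by rw [hv0 y hy hy0]; simp)
    rwa [oext_neg, fext_neg] at this
  · have hgb : ∀ y, |g y| ≤ 1 := by
      intro y; simp only [hg]
      by_cases hy : y ∈ Ω
      · simp [hy]
      · simp [hy, abs_of_pos hτ, hτ1]
    intro y _
    unfold fext
    split_ifs
    · exact hgb y
    · rw [abs_neg]; exact hgb _
    · simp
  · intro y hy hne
    have hgn : ∀ y, g y ≠ 0 → y ∉ Ω := by
      intro y hy hy'; apply hy; simp [hg, hy']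
    unfold fext at hne
    split_ifs at hne with a1 a2
    · exact Or.inl ⟨a1, hgn _ hne⟩
    · refine Or.inr ⟨⟨by rw [Tl_zero hB]; linarith, hgn _ (by simpa using hne)⟩, Tl_dist hB a2.le hz0⟩
    · exact absurd rfl hne
  · rcases hz0.eq_or_lt with hz | hz
    · have e : mv (-(Pm B τ)) z = 0 := by rw [mv_Pm, ← hz]; simp
      rw [e]
      refine oext_grad hB ?_ (hv0 z (mem_ball_self (by norm_num)) hz.symm) hz.symm
      have h1 := hasGrad_poly (qm B τ) z
      rw [gr_qm, e, hasGradientAt_iff_hasFDerivAt] at h1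
      have h2 := h.gw
      rw [hasGradientWithinAt_iff_hasFDerivWithinAt] at *
      have h3 := (h2.const_mul τ).add h1.hasFDerivWithinAt
      rw [map_zero, smul_zero, zero_add] at h3
      rw [map_zero]
      exact h3
    · exact hgradZ z hz h.zn (mem_ball_self hR0)
  · intro x hx hxb
    have := hgradZ x hx.1 hx.2 hxb
    rwa [mv_lin _ x z] at this
  · rw [Pm, LB_smul, LB_op, qf_e0, div_mul_cancel₀ _ hb0.ne', abs_of_pos hτ]; exact hτ1
  · apply norm_le_entry (by positivity)
    intro i j
    have h5 : τ / B 0 0 ≤ 1 / lam := by gcongr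
    simp only [Pm, op, Matrix.smul_apply, Matrix.of_apply, smul_eq_mul, e0_apply]
    rw [abs_mul, abs_of_pos (by positivity : 0 < τ / B 0 0)]
    refine (mul_le_of_le_one_right (by positivity) ?_).trans h5
    split_ifs <;> simp
  · rw [mv_Pm, norm_neg, norm_smul, norm_e0, mul_one, Real.norm_eq_abs, abs_mul, abs_of_pos (by positivity : 0 < τ / B 0 0)]
    have h5 : τ / B 0 0 ≤ 1 / lam := by gcongr
    have h7 : τ / B 0 0 * |z 0| ≤ 1 / lam * (1/2) := by gcongr
    have h8 : 0 < 1 / lam := by positivity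
    have : 2 / lam = 2 * (1 / lam) := by ring
    linarith
  · intro y hy
    unfold oext
    split_ifs with hy0
    · exact hvb y (hbsub hy) hy0
    · push Not at hy0
      rw [abs_neg]
      exact hvb _ (hTball y hy hy0.le) (by rw [Tl_zero hB]; linarith)

lemma growth [NeZero n] (hn : 2 ≤ n) {lam Lam : ℝ} (hl : 0 < lam) (hL : lam ≤ Lam) :
    ∃ C R0 : ℝ, 0 < C ∧ 0 < R0 ∧ ∀ (B : Mat n) (z : En n) (M : ℝ) (u : En n → ℝ) (Ω : Set (En n)),
      Ell lam Lam B → 0 < M → LinP B z M u Ω → ∀ y ∈ Bplus n z R0, |u y| ≤ C * (M + 1) * ‖y - z‖ ^ 2 := by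
  have hLp : 0 < Lam := hl.trans_le hL
  set CR := 2 + 2 * n * Lam / lam with hCRd
  have hCR : 2 ≤ CR := by
    have : 0 ≤ 2 * n * Lam / lam := by positivity
    linarith
  have hCR0 : 0 < CR := by linarith
  have hR0 : 0 < 1 / (4 * CR) := by positivity
  obtain ⟨C, hC, H⟩ := thmA (m0 := 1 + 2 / lam) hn hl hL hCR hR0 (by positivity)
  refine ⟨C + 1 / lam, 1 / (4 * CR), by positivity, hR0, ?_⟩
  intro B z M u Ω hB hM h y hy
  have hb := (B00 hB).1
  have hb0 : 0 < B 0 0 := by linarith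
  have hM1 : 0 < M + 1 := by linarith
  set τ := 1 / (M + 1) with hτd
  have hτ : 0 < τ := by positivity
  have hτ1 : τ ≤ 1 := by rw [hτd, div_le_one hM1]; linarith
  have hτM : τ * M ≤ 1 := by rw [hτd, one_div_mul_eq_div, div_le_one hM1]; linarith
  obtain ⟨S, g1, g2⟩ := mkSetup hB h hM hR0 (by rw [← hCRd]; apply le_of_eq; field_simp) hτ hτ1 hτM
  have h1 := H S g1 g2 y (ball_subset_closedBall hy.2)
  have hy0 : 0 < y 0 := hy.1
  rw [oext, if_pos hy0.le, oext, if_pos h.z0, h.uz, ev_qm, ev_qm, mv_Pm, inner_neg_left, inner_smul_left, inner_e0, PiLp.sub_apply] at h1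
  simp only [conj_trivial] at h1
  have e : τ * u y + -(τ / B 0 0 * y 0 ^ 2 / 2) - (τ * 0 + -(τ / B 0 0 * z 0 ^ 2 / 2)) - -(τ / B 0 0 * z 0 * (y 0 - z 0))
    = τ * u y - τ / B 0 0 * (y 0 - z 0) ^ 2 / 2 := by ring
  rw [e] at h1
  have h2 : (y 0 - z 0) ^ 2 ≤ ‖y - z‖ ^ 2 := by
    have := abs_coord (y - z) 0
    rw [PiLp.sub_apply] at this
    rw [← sq_abs]; gcongr
  have h5 : τ / B 0 0 ≤ 1 / lam := by gcongr
  have h6 : τ / B 0 0 * (y 0 - z 0) ^ 2 ≤ 1 / lam * ‖y - z‖ ^ 2 := by gcongr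
  have h6' : 0 ≤ τ / B 0 0 * (y 0 - z 0) ^ 2 := by positivity
  have h7 : |τ * u y| ≤ (C + 1 / lam) * ‖y - z‖ ^ 2 := by
    rw [abs_le] at *
    have : 0 ≤ 1 / lam * ‖y - z‖ ^ 2 := by positivity
    constructor <;> nlinarith [h1.1, h1.2]
  rw [abs_mul, abs_of_pos hτ, hτd, one_div_mul_eq_div, div_le_iff₀ hM1] at h7
  linarith

end

section

open scoped Topology

variable {n : ℕ}

def Sij (i j : Fin n) : Mat n := (1/2 : ℝ) • (Matrix.single i j 1 + Matrix.single j i 1)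

lemma Sij_symm (i j : Fin n) : (Sij i j : Mat n).IsSymm := by
  unfold Sij Matrix.IsSymm
  simp [Matrix.transpose_smul, Matrix.transpose_add, Matrix.transpose_single, add_comm]

lemma sum_Sij (A : Mat n) (hA : A.IsSymm) : A = ∑ p : Fin n × Fin n, A p.1 p.2 • Sij p.1 p.2 := by
  have h1 : ∑ p : Fin n × Fin n, A p.1 p.2 • (Matrix.single p.1 p.2 (1:ℝ)) = A := by
    rw [Fintype.sum_prod_type]
    conv_rhs => rw [Matrix.matrix_eq_sum_single A]
    refine Finset.sum_congr rfl fun i _ => Finset.sum_congr rfl fun j _ => ?_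
    rw [Matrix.smul_single]; simp
  have h2 : ∑ p : Fin n × Fin n, A p.1 p.2 • (Matrix.single p.2 p.1 (1:ℝ)) = A := by
    have := congrArg Matrix.transpose h1
    rw [hA, Matrix.transpose_sum] at this
    refine Eq.trans (Finset.sum_congr rfl fun p _ => ?_) this
    rw [Matrix.transpose_smul, Matrix.transpose_single]
  have e : ∀ p : Fin n × Fin n, A p.1 p.2 • Sij p.1 p.2 = (1/2 : ℝ) • (A p.1 p.2 • (Matrix.single p.1 p.2 (1:ℝ)) + A p.1 p.2 • (Matrix.single p.2 p.1 (1:ℝ))) := by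
    intro p; rw [Sij, ← smul_add, smul_comm]
  simp_rw [e]
  rw [← Finset.smul_sum, Finset.sum_add_distrib, h1, h2, ← two_smul ℝ A, smul_smul]
  norm_num

variable {lam Lam : ℝ} {F : Mat n → ℝ}

lemma F_add (hF : EllipticF n lam Lam F) {A C : Mat n} (hA : A.IsSymm) (hC : C.IsSymm) : F (A + C) = F A + F C := by
  have key : ∀ A C : Mat n, A.IsSymm → C.IsSymm → F (A + C) ≤ F A + F C := by
    intro A C hA hC
    have := hF.convexF.2 hA hC (by norm_num : (0:ℝ) ≤ 1/2) (by norm_num : (0:ℝ) ≤ 1/2) (by norm_num)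
    rw [← smul_add, hF.homogeneous, smul_eq_mul, smul_eq_mul] at this
    linarith
  have neg : ∀ A : Mat n, F (-A) = - F A := by
    intro A; have := hF.homogeneous (-1) A; simpa using this
  have sn : ∀ A : Mat n, A.IsSymm → (-A).IsSymm := by
    intro A h; unfold Matrix.IsSymm at *; rw [Matrix.transpose_neg, h]
  have h1 := key A C hA hC
  have h2 := key (-A) (-C) (sn _ hA) (sn _ hC)
  rw [← neg_add, neg, neg, neg] at h2
  linarith

def Bof (F : Mat n → ℝ) : Mat n := Matrix.of fun i j => F (Sij i j)

lemma F_zero (hF : EllipticF n lam Lam F) : F 0 = 0 := by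
  have := hF.homogeneous 0 0
  simpa using this

lemma F_lin (hF : EllipticF n lam Lam F) (A : Mat n) (hA : A.IsSymm) : F A = LB (Bof F) A := by
  have gen : ∀ s : Finset (Fin n × Fin n), (∑ p ∈ s, A p.1 p.2 • Sij p.1 p.2 : Mat n).IsSymm ∧
      F (∑ p ∈ s, A p.1 p.2 • Sij p.1 p.2) = ∑ p ∈ s, A p.1 p.2 * F (Sij p.1 p.2) := by
    intro s
    induction s using Finset.induction_on with
    | empty => simp [F_zero hF]
    | insert a s ha ih =>
      have hs : (A a.1 a.2 • Sij a.1 a.2 : Mat n).IsSymm := by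
        have := Sij_symm a.1 a.2
        unfold Matrix.IsSymm at *; rw [Matrix.transpose_smul, this]
      rw [Finset.sum_insert ha, Finset.sum_insert ha]
      refine ⟨hs.add ih.1, ?_⟩
      rw [F_add hF hs ih.1, ih.2, hF.homogeneous]
  conv_lhs => rw [sum_Sij A hA]
  rw [(gen Finset.univ).2, LB, Fintype.sum_prod_type]
  refine Finset.sum_congr rfl fun i _ => Finset.sum_congr rfl fun j _ => ?_
  simp [Bof, mul_comm]

lemma norm_op (v : En n) : matOpNorm (op v) = ‖v‖ ^ 2 := by
  have e : ∀ x : En n, Matrix.toEuclideanCLM (𝕜 := ℝ) (op v) x = inner ℝ v x • v := by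
    intro x
    ext i
    simp only [Matrix.ofLp_toEuclideanCLM, Matrix.mulVec, dotProduct, op, Matrix.of_apply, PiLp.smul_apply, smul_eq_mul, inner_eq, Finset.sum_mul]
    refine Finset.sum_congr rfl fun j _ => by ring
  unfold matOpNorm
  apply le_antisymm
  · refine ContinuousLinearMap.opNorm_le_bound _ (by positivity) fun x => ?_
    rw [e, norm_smul]
    have := norm_inner_le_norm (𝕜 := ℝ) v x
    nlinarith [norm_nonneg v]
  · by_cases hv : v = 0
    · simp [hv]
    · have := (Matrix.toEuclideanCLM (𝕜 := ℝ) (op v)).le_opNorm v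
      rw [e, real_inner_self_eq_norm_sq, norm_smul, norm_pow, norm_norm] at this
      exact le_of_mul_le_mul_right this (norm_pos_iff.2 hv)

lemma op_psd (v : En n) : (op v).PosSemidef := by
  have := Matrix.posSemidef_vecMulVec_self_star (R := ℝ) (fun i => v i)
  convert this using 1
  ext i j; simp [op, Matrix.vecMulVec_apply]

lemma ellB (hF : EllipticF n lam Lam F) : Ell lam Lam (Bof F) := by
  have k : ∀ v, qf (Bof F) v = F (op v) := fun v => by rw [F_lin hF _ (op_symm v), LB_op]
  have h0 : (0 : Mat n).IsSymm := Matrix.isSymm_zero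
  refine ⟨hF.lam_pos, hF.lam_le_Lam, fun i j => ?_, fun v => ?_, fun v => ?_⟩
  · simp only [Bof, Matrix.of_apply, Sij]; rw [add_comm]
  · have := hF.elliptic_lower 0 (op v) h0 (op_psd v)
    rw [norm_op, zero_add, F_zero hF, sub_zero] at this
    rwa [k]
  · have := hF.elliptic_upper 0 (op v) h0 (op_psd v)
    rw [norm_op, zero_add, F_zero hF, sub_zero] at this
    rwa [k]

lemma quad_eq (c : ℝ) (b : En n) (A : Mat n) (x : En n) : quadPoly c b A x = c + inner ℝ b x + qf A x / 2 := by
  rw [quadPoly, inner_eq, qf]; ring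

lemma qf_shift (A : Mat n) (hA : A.IsSymm) (x y : En n) : qf A y = qf A x + 2 * inner ℝ (mv A x) (y - x) + qf A (y - x) := by
  have h1 := qf_comb A (fun i j => (hA.apply i j).symm) 1 1 x (y - x)
  rw [one_smul, one_smul, add_sub_cancel] at h1
  have h2 : bf A x (y - x) = inner ℝ (mv A x) (y - x) := by
    rw [← mv_symm A hA, inner_eq, bf]
    simp only [mv, Finset.mul_sum]
    refine Finset.sum_congr rfl fun i _ => Finset.sum_congr rfl fun j _ => by ring
  rw [h1, h2]; ring

lemma quad_diff (b : En n) (A : Mat n) (hA : A.IsSymm) (x y : En n) :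
    quadPoly 0 (b - mv A x) A y - quadPoly 0 (b - mv A x) A x = inner ℝ b (y - x) + qf A (y - x) / 2 := by
  rw [quad_eq, quad_eq, qf_shift A hA x y, inner_sub_left, inner_sub_left]
  rw [inner_sub_right, inner_sub_right]; ring

lemma eps_symm (A : Mat n) (hA : A.IsSymm) (ε : ℝ) : (A + (2 * ε) • (1 : Mat n)).IsSymm := by
  unfold Matrix.IsSymm at *; rw [Matrix.transpose_add, hA, Matrix.transpose_smul, Matrix.transpose_one]

lemma eps_lim {a b : ℝ} (c : ℝ) (h : ∀ ε > 0, a ≤ b + 2 * ε * c) : a ≤ b := by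
  by_contra hc
  push Not at hc
  have := h ((a - b) / (4 * (|c| + 1))) (by have := sub_pos.2 hc; positivity)
  have h1 : (a - b) / (4 * (|c| + 1)) * c ≤ (a - b) / 4 := by
    rw [div_mul_eq_mul_div, div_le_div_iff₀ (by positivity) (by norm_num)]
    nlinarith [le_abs_self c]
  linarith

lemma visc_sub (hF : EllipticF n lam Lam F) {g u : En n → ℝ} {D : Set (En n)} (h : ViscositySol F g D u) :
    Sub (Bof F) u g D := by
  intro x hx b A hA hU
  refine eps_lim (LB (Bof F) 1) fun ε hε => ?_
  have hs := eps_symm A hA ε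
  have := (h x hx).1 0 (b - mv (A + (2 * ε) • 1) x) _ hs (by
    have : ∀ᶠ y in 𝓝[D] x, u y - quadPoly 0 (b - mv (A + (2 * ε) • 1) x) (A + (2 * ε) • 1) y ≤
        u x - quadPoly 0 (b - mv (A + (2 * ε) • 1) x) (A + (2 * ε) • 1) x := by
      refine nhdsWithin_le_nhds ?_
      filter_upwards [hU ε hε] with y hy
      have := quad_diff b _ hs x y
      rw [qf_add, qf_smul, qf_one] at this
      linarith
    exact this)
  rw [F_lin hF _ hs, LB_add, LB_smul] at this
  exact this

lemma visc_sub' (hF : EllipticF n lam Lam F) {g u : En n → ℝ} {D : Set (En n)} (h : ViscositySol F g D u) :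
    Sub (Bof F) (fun y => - u y) (fun y => - g y) D := by
  refine visc_sub hF fun x hx => ⟨fun c b A hA hm => ?_, fun c b A hA hm => ?_⟩
  all_goals
    have hA' : (-A).IsSymm := by unfold Matrix.IsSymm at *; rw [Matrix.transpose_neg, hA]
    have hn : F (-A) = - F A := by have := hF.homogeneous (-1) A; simpa using this
    have e : ∀ y, u y - quadPoly (-c) (-b) (-A) y = - (- u y - quadPoly c b A y) := by
      intro y; rw [quad_eq, quad_eq, inner_neg_left, qf_neg]; ring
  · have := (h x hx).2 (-c) (-b) (-A) hA' (by simp_rw [e]; exact hm.neg)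
    linarith
  · have := (h x hx).1 (-c) (-b) (-A) hA' (by simp_rw [e]; exact hm.neg)
    linarith

end

section

open scoped Topology

variable {n : ℕ} [NeZero n] {lam Lam M : ℝ} {B : Mat n} {z : En n} {u : En n → ℝ} {Ω : Set (En n)}

lemma sub_kap (hB : Ell lam Lam B) (h : LinP B z M u Ω) {κ : ℝ} (hκ0 : 0 < κ) (hκ : 2 * κ * (n * Lam) ≤ 1) (y : En n) {D : Set (En n)}
    (hD : D ⊆ Ω) (hD' : D ⊆ ball z 1) : Sub B (fun x => u x + -(κ * ‖x - y‖ ^ 2)) (fun _ => 0) D := by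
  have h1 := h.s1.mono (D' := D) (g := fun _ => 1) (fun x hx => ⟨h.Ωs (hD hx), hD' hx⟩) (fun x hx => by simp [hD hx])
  have h2 := h1.add (g := fun x => -(κ * ‖x - y‖ ^ 2)) (k := fun _ => -1) (fun x hx => by
    refine ⟨-((2 * κ) • (x - y)), -((2 * κ) • (1 : Mat n)), ?_, ?_, ?_⟩
    · unfold Matrix.IsSymm; simp [Matrix.transpose_neg, Matrix.transpose_smul]
    · rw [LB_neg, LB_smul]
      have := hB.tr_upper
      nlinarith
    · simpa using UJ_normsq κ y x)
  refine h2.mono subset_rfl fun x _ => by norm_num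

lemma clo_nonneg (h : LinP B z M u Ω) {x : En n} (hx : x ∈ closure Ω) : 0 ≤ x 0 := by
  have h2 : closure Ω ⊆ {x : En n | 0 ≤ x 0} :=
    closure_minimal (fun x hx => (show (0:ℝ) < x 0 from h.Ωs hx).le) (isClosed_le continuous_const coord_cont)
  exact h2 hx

lemma u_off (h : LinP B z M u Ω) {x : En n} (hx : x ∈ ball z (1/2)) (hx0 : 0 ≤ x 0) (hxΩ : x ∉ Ω) : u x = 0 := by
  rcases hx0.eq_or_lt with h0 | h0
  · exact h.u0 hx h0.symm
  · exact (h.vanish x ⟨⟨h0, ball_subset_ball (by norm_num) hx⟩, hxΩ⟩).1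

lemma u_nonpos (hB : Ell lam Lam B) (h : LinP B z M u Ω) (hM : 0 < M) {κ : ℝ} (hκ0 : 0 < κ) (hκ : 2 * κ * (n * Lam) ≤ 1)
    (hMκ : M ≤ κ / 16) {y : En n} (hy : y ∈ ball z (1/8)) (hy0 : 0 ≤ y 0) : u y ≤ 0 := by
  by_cases hyΩ : y ∈ Ω
  swap
  · exact (u_off h (ball_subset_ball (by norm_num) hy) hy0 hyΩ).le
  set D := Ω ∩ ball y (1/4) with hD
  have hyz : dist y z < 1/8 := hy
  have hcl : closure D ⊆ closedBall y (1/4) := closure_minimal (inter_subset_right.trans ball_subset_closedBall) isClosed_closedBall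
  have hclz : closure D ⊆ ball z (1/2) := fun x hx => by
    have := hcl hx
    rw [mem_closedBall] at this
    rw [mem_ball]; linarith [dist_triangle x y z]
  have hpos : ∀ x ∈ closure D, 0 ≤ x 0 := fun x hx => clo_nonneg h (closure_mono inter_subset_left hx)
  have hs := sub_kap hB h hκ0 hκ y (D := D) inter_subset_left
    (subset_closure.trans (hclz.trans (ball_subset_ball (by norm_num))))
  have hc : ContinuousOn (fun x => u x + -(κ * ‖x - y‖ ^ 2)) (closure D) := by
    refine (h.cont.mono fun x hx => mem_clo (hpos x hx) (ball_subset_ball (by norm_num) (hclz hx))).add ?_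
    fun_prop
  have := max_principle_gen hB (Nat.pos_of_ne_zero (NeZero.ne n)) (h.Ωo.inter isOpen_ball)
    ((isCompact_closedBall y (1/4)).of_isClosed_subset isClosed_closure hcl) hc hs (m := 0) (fun x hx hxD => by
      by_cases hxΩ : x ∈ Ω
      · have h1 : 1/4 ≤ ‖x - y‖ := by
          by_contra hcon
          push Not at hcon
          exact hxD ⟨hxΩ, by rwa [mem_ball, dist_eq_norm]⟩
        have h2 := (abs_le.1 (h.ub hM (hclz hx) (hpos x hx))).2
        have h3 : κ * (1/4) ^ 2 ≤ κ * ‖x - y‖ ^ 2 := by gcongr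
        linarith
      · rw [u_off h (hclz hx) (hpos x hx) hxΩ]
        have : 0 ≤ κ * ‖x - y‖ ^ 2 := by positivity
        linarith) y (subset_closure ⟨hyΩ, mem_ball_self (by norm_num)⟩)
  simpa using this

lemma tangent (hB : Ell lam Lam B) (h : LinP B z M u Ω) {κ : ℝ} (hκ0 : 0 < κ) (hκ : 2 * κ * (n * Lam) ≤ 1)
    (hu : ∀ y ∈ ball z (1/8), 0 ≤ y 0 → u y ≤ 0) {y p : En n} {d : ℝ} (hd : 0 < d) (hyd : ball y d ⊆ Ω)
    (hyz : closedBall y d ⊆ ball z (1/8)) (hp : ‖p - y‖ = d)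
    (hg : ∀ ε > 0, ∀ᶠ x in 𝓝[closedBall y d] p, |u x| ≤ ε * ‖x - p‖) : False := by
  have hpos : ∀ x ∈ closedBall y d, 0 ≤ x 0 := fun x hx => by
    rw [← closure_ball y hd.ne'] at hx
    exact clo_nonneg h (closure_mono hyd hx)
  have hs := sub_kap hB h hκ0 hκ y hyd (ball_subset_closedBall.trans (hyz.trans (ball_subset_ball (by norm_num))))
  have hc : ContinuousOn (fun x => u x + -(κ * ‖x - y‖ ^ 2)) (closedBall y d) := by
    refine (h.cont.mono fun x hx => mem_clo (hpos x hx) (ball_subset_ball (by norm_num) (hyz hx))).add ?_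
    fun_prop
  have hmp := max_principle hB (Nat.pos_of_ne_zero (NeZero.ne n)) hd hc hs (m := -(κ * d ^ 2)) (fun x hx => by
    have hx' : ‖x - y‖ = d := by simpa [dist_eq_norm] using hx
    have hxc : x ∈ closedBall y d := sphere_subset_closedBall hx
    rw [hx']
    linarith [hu x (hyz hxc) (hpos x hxc)])
  have hx1 : ∀ t : ℝ, p + t • (y - p) - y = (1 - t) • (p - y) := fun t => by module
  have hxc : ∀ t : ℝ, 0 ≤ t → t ≤ 1 → p + t • (y - p) ∈ closedBall y d := by
    intro t h0 h1
    rw [mem_closedBall, dist_eq_norm, hx1, norm_smul, hp, Real.norm_eq_abs, abs_of_nonneg (by linarith)]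
    nlinarith
  have ht : Tendsto (fun t : ℝ => p + t • (y - p)) (𝓝[>] 0) (𝓝[closedBall y d] p) := by
    refine tendsto_nhdsWithin_iff.2 ⟨?_, ?_⟩
    · have : Continuous fun t : ℝ => p + t • (y - p) := by fun_prop
      have := (this.tendsto 0).mono_left (nhdsWithin_le_nhds (s := Ioi 0))
      simpa using this
    · filter_upwards [Ioo_mem_nhdsGT (zero_lt_one' ℝ)] with t ht
      exact hxc t ht.1.le ht.2.le
  obtain ⟨t, h1, h2⟩ := ((ht.eventually (hg (κ * d / 2) (by positivity))).and (Ioo_mem_nhdsGT (zero_lt_one' ℝ))).exists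
  have ht0 : 0 < t := h2.1
  have ht1 : t < 1 := h2.2
  have h3 := hmp _ (hxc t ht0.le ht1.le)
  simp only [hx1, norm_smul, hp, Real.norm_eq_abs, abs_of_nonneg (by linarith : (0:ℝ) ≤ 1 - t)] at h3
  have h4 : ‖p + t • (y - p) - p‖ = t * d := by
    rw [add_sub_cancel_left, norm_smul, norm_sub_rev, hp, Real.norm_eq_abs, abs_of_pos ht0]
  rw [h4] at h1
  have h5 := (abs_le.1 h1).1
  have h6 : 0 < κ * d ^ 2 := by positivity
  have h7 : 0 < κ * d ^ 2 * t := by positivity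
  nlinarith

lemma front_int (hB : Ell lam Lam B) (h : LinP B z M u Ω) {κ : ℝ} (hκ0 : 0 < κ) (hκ : 2 * κ * (n * Lam) ≤ 1)
    (hu : ∀ y ∈ ball z (1/8), 0 ≤ y 0 → u y ≤ 0) {q : En n} (hq : q ∈ frontier Ω) (hq0 : 0 < q 0) (hqz : q ∈ ball z (1/16)) : False := by
  have hqn : q ∉ Ω := by have := hq.2; rwa [h.Ωo.interior_eq] at this
  obtain ⟨y, hyΩ, hyq⟩ := Metric.mem_closure_iff.1 hq.1 (min (1/64) (q 0 / 2)) (by positivity)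
  have hy1 := hyq.trans_le (min_le_left _ _)
  have hy2 := hyq.trans_le (min_le_right _ _)
  have hcl : IsClosed Ωᶜ := h.Ωo.isClosed_compl
  have hne : (Ωᶜ).Nonempty := ⟨q, hqn⟩
  obtain ⟨p, hp, hpd⟩ := hcl.exists_infDist_eq_dist hne y
  set d := infDist y Ωᶜ with hd
  have hdq : d ≤ dist y q := infDist_le_dist_of_mem hqn
  have hd0 : 0 < d := (hcl.notMem_iff_infDist_pos hne).1 (fun hh => hh hyΩ)
  rw [dist_comm] at hy1 hy2
  have hqz' : dist q z < 1/16 := hqz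
  have hpn : ‖p - y‖ = d := by rw [hpd, dist_comm, dist_eq_norm]
  have hsub : closedBall y d ⊆ ball z (1/8) := fun x hx => by
    rw [mem_closedBall] at hx
    rw [mem_ball]
    linarith [dist_triangle x y q, dist_triangle x q z]
  have hp0 : 0 < p 0 := by
    have h1 := abs_coord (p - q) 0
    rw [PiLp.sub_apply] at h1
    have h2 : ‖p - q‖ < q 0 := by
      rw [← dist_eq_norm]
      have := dist_triangle p y q
      rw [dist_eq_norm p y, hpn] at this
      linarith
    linarith [(abs_le.1 h1).1]
  have hpm : p ∈ Bplus n z 1 \ Ω := ⟨⟨hp0, ball_subset_ball (by norm_num) (hsub (by rw [mem_closedBall, dist_eq_norm, hpn]))⟩, hp⟩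
  obtain ⟨v1, v2⟩ := h.vanish p hpm
  refine tangent hB h hκ0 hκ hu hd0 (p := p) ?_ hsub hpn fun ε hε => ?_
  · intro x hx
    by_contra hxn
    have := infDist_le_dist_of_mem (x := y) (show x ∈ Ωᶜ from hxn)
    rw [mem_ball, dist_comm] at hx
    linarith
  · exact nhdsWithin_mono _ (subset_univ _) (gradW (hasGradientWithinAt_univ.2 v2) v1 hε)

lemma nondeg (hB : Ell lam Lam B) (h : LinP B z M u Ω) (hM : 0 < M) {κ : ℝ} (hκ0 : 0 < κ) (hκ : 2 * κ * (n * Lam) ≤ 1) : κ / 16 ≤ M := by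
  by_contra hcon
  push Not at hcon
  have hu : ∀ y ∈ ball z (1/8), 0 ≤ y 0 → u y ≤ 0 := fun y hy hy0 => u_nonpos hB h hM hκ0 hκ hcon.le hy hy0
  rcases h.z0.eq_or_lt with hz | hz
  swap
  · exact front_int hB h hκ0 hκ hu h.zf hz (mem_ball_self (by norm_num))
  by_cases hex : ∃ q ∈ Bplus n z (1/16), q ∉ Ω
  · obtain ⟨q, hq, hqn⟩ := hex
    have hconv : Convex ℝ (Bplus n z (1/16)) := by
      refine Convex.inter ?_ (convex_ball _ _)
      intro x hx y hy a b ha hb hab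
      have hx' : 0 < x 0 := hx
      have hy' : 0 < y 0 := hy
      show 0 < (a • x + b • y) 0
      rw [PiLp.add_apply, PiLp.smul_apply, PiLp.smul_apply, smul_eq_mul, smul_eq_mul]
      rcases ha.eq_or_lt with h0 | h0
      · have : b = 1 := by linarith
        rw [← h0, this]; linarith
      · have := mul_pos h0 hx'
        have := mul_nonneg hb hy'.le
        linarith
    obtain ⟨y, hyΩ, hyz⟩ := Metric.mem_closure_iff.1 h.zf.1 (1/16) (by norm_num)
    have hnf : ∀ p ∈ Bplus n z (1/16), p ∉ frontier Ω := fun p hp hpf => front_int hB h hκ0 hκ hu hpf hp.1 hp.2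
    have hcase : ∀ p ∈ Bplus n z (1/16), p ∉ Ω → p ∉ closure Ω := fun p hp hpn hpc =>
      hnf p hp ⟨hpc, by rwa [h.Ωo.interior_eq]⟩
    obtain ⟨p, hp, hp1, hp2⟩ := hconv.isPreconnected Ω (closure Ω)ᶜ h.Ωo isClosed_closure.isOpen_compl
      (fun p hp => by
        by_cases hpΩ : p ∈ Ω
        · exact Or.inl hpΩ
        · exact Or.inr (hcase p hp hpΩ))
      ⟨y, ⟨h.Ωs hyΩ, by rwa [mem_ball, dist_comm]⟩, hyΩ⟩ ⟨q, hq, hcase q hq hqn⟩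
    exact hp2 (subset_closure hp1)
  · push Not at hex
    have hn1 : ‖(e0 : En n)‖ = 1 := norm_e0
    refine tangent hB h hκ0 hκ hu (y := z + (1/64 : ℝ) • (e0 : En n)) (p := z) (d := 1/64) (by norm_num) ?_ ?_ ?_ ?_
    · intro x hx
      rw [mem_ball, dist_eq_norm] at hx
      refine hex x ⟨?_, ?_⟩
      · have h1 := abs_coord (x - (z + (1/64 : ℝ) • (e0 : En n))) 0
        rw [PiLp.sub_apply, PiLp.add_apply, PiLp.smul_apply, e0_apply, ← hz] at h1
        simp at h1
        show 0 < x 0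
        have := neg_abs_le (x 0 - 64⁻¹)
        norm_num at hx h1 this ⊢
        linarith
      · rw [mem_ball, dist_eq_norm]
        have e : x - z = (x - (z + (1/64 : ℝ) • (e0 : En n))) + (1/64 : ℝ) • (e0 : En n) := by abel
        rw [e]
        refine (norm_add_le _ _).trans_lt ?_
        rw [norm_smul, hn1]; norm_num at hx ⊢; linarith
    · intro x hx
      rw [mem_closedBall, dist_eq_norm] at hx
      rw [mem_ball, dist_eq_norm]
      have e : x - z = (x - (z + (1/64 : ℝ) • (e0 : En n))) + (1/64 : ℝ) • (e0 : En n) := by abel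
      rw [e]
      refine (norm_add_le _ _).trans_lt ?_
      rw [norm_smul, hn1]; norm_num at hx ⊢; linarith
    · rw [sub_add_cancel_left, norm_neg, norm_smul, hn1]; norm_num
    · intro ε hε
      refine nhdsWithin_mono _ ?_ (gradW h.gw h.uz hε)
      intro x hx
      rw [mem_closedBall, dist_eq_norm] at hx
      have h1 := abs_coord (x - (z + (1/64 : ℝ) • (e0 : En n))) 0
      rw [PiLp.sub_apply, PiLp.add_apply, PiLp.smul_apply, e0_apply, ← hz] at h1
      simp at h1
      refine mem_clo ?_ ?_
      · have := neg_abs_le (x 0 - 64⁻¹)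
        norm_num at hx h1 this ⊢
        linarith
      · rw [mem_ball, dist_eq_norm]
        have e : x - z = (x - (z + (1/64 : ℝ) • (e0 : En n))) + (1/64 : ℝ) • (e0 : En n) := by abel
        rw [e]
        refine (norm_add_le _ _).trans_lt ?_
        rw [norm_smul, hn1]; norm_num at hx ⊢; linarith

end

section

lemma final (n : ℕ) [NeZero n] (hn : 2 ≤ n) (lam Lam : ℝ) :
    ∃ C₀ : ℝ, 0 < C₀ ∧
      ∀ (F : Matrix (Fin n) (Fin n) ℝ → ℝ), EllipticF n lam Lam F →
        ∀ M : ℝ, 0 < M →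
          ∀ (z : En n) (u : En n → ℝ) (Ω : Set (En n)), MemPplus F z 1 M u Ω →
            u z = 0 → HasGradientWithinAt u 0 (closure (Bplus n z 1)) z →
            z ∈ frontier Ω → z ∈ ball (0 : En n) (1 / 2) →
            ∀ j : ℕ, Vr u Ω z ((2 : ℝ) ^ (-(j : ℤ))) ≤ C₀ →
              Sdyadic n u z (j + 1) ≤
                max ((2 : ℝ)⁻¹ ^ 2 * Sdyadic n u z j) (C₀ * M * (2 : ℝ) ^ (-(2 * j : ℤ))) := by
  by_cases hlL : 0 < lam ∧ lam ≤ Lam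
  swap
  · exact ⟨1, one_pos, fun F hF => absurd ⟨hF.lam_pos, hF.lam_le_Lam⟩ hlL⟩
  obtain ⟨hl, hL⟩ := hlL
  have hLp : 0 < Lam := hl.trans_le hL
  obtain ⟨C, R0, hC, hR0, H⟩ := growth hn hl hL
  have hn0 : (0:ℝ) < n := by exact_mod_cast (by omega : 0 < n)
  set κ : ℝ := 1 / (2 * (n * Lam)) with hκd
  have hκ0 : 0 < κ := by positivity
  have hκ : 2 * κ * (n * Lam) ≤ 1 := by rw [hκd]; apply le_of_eq; field_simp
  refine ⟨C * (1 + 16 / κ) + 1 / R0 ^ 2, by positivity, ?_⟩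
  set C₀ := C * (1 + 16 / κ) + 1 / R0 ^ 2 with hC₀
  have hC0 : 0 < C₀ := by positivity
  intro F hF M hM z u Ω hu uz gw zf zb j _
  have hB := ellB hF
  have h : LinP (Bof F) z M u Ω := ⟨hu.cont, hu.Ω_open, hu.Ω_sub, visc_sub hF hu.sol, visc_sub' hF hu.sol,
    hu.vanish, hu.bdd, hu.bdry_zero, zf, uz, gw, zb⟩
  have hm := nondeg hB h hM hκ0 hκ
  refine le_max_of_le_right ?_
  set r : ℝ := (2:ℝ) ^ (-((j + 1 : ℕ) : ℤ)) with hr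
  have hr0 : 0 < r := by positivity
  have hr1 : r ≤ 1 := by
    rw [hr, zpow_neg, zpow_natCast]
    exact inv_le_one_of_one_le₀ (one_le_pow₀ (by norm_num))
  have hrj : (2 : ℝ) ^ (-(2 * j : ℤ)) = 4 * r ^ 2 := by
    rw [hr, zpow_neg, zpow_neg, zpow_natCast, zpow_mul, zpow_natCast, pow_succ]
    have : ((2:ℝ) ^ (2:ℤ)) ^ j = 2 ^ j * 2 ^ j := by
      rw [← mul_pow]; norm_num
    rw [this]; field_simp; ring
  have hM1 : M + 1 ≤ (1 + 16 / κ) * M := by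
    have : 1 ≤ 16 / κ * M := by
      rw [div_mul_eq_mul_div, le_div_iff₀ hκ0]; linarith
    linarith
  rw [hrj]
  refine Real.sSup_le ?_ (by positivity)
  rintro _ ⟨y, hy, rfl⟩
  have hyr : ‖y - z‖ < r := by have := hy.2; rwa [mem_ball, dist_eq_norm] at this
  have key : |u y| ≤ C₀ * M * r ^ 2 := by
    by_cases hyR : ‖y - z‖ < R0
    · have h1 := H _ z M u Ω hB hM h y ⟨hy.1, by rwa [mem_ball, dist_eq_norm]⟩
      refine h1.trans ?_
      calc C * (M + 1) * ‖y - z‖ ^ 2 ≤ C * ((1 + 16 / κ) * M) * r ^ 2 := by gcongr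
        _ ≤ C₀ * M * r ^ 2 := by
          have : 0 ≤ 1 / R0 ^ 2 * M * r ^ 2 := by positivity
          rw [hC₀]; linarith
    · push Not at hyR
      have h1 := h.bdd y ⟨hy.1, ball_subset_ball hr1 hy.2⟩
      refine h1.trans ?_
      have h2 : R0 ^ 2 ≤ r ^ 2 := by gcongr; linarith
      have h3 : 1 ≤ 1 / R0 ^ 2 * r ^ 2 := by
        rw [one_div_mul_eq_div, le_div_iff₀ (by positivity)]; linarith
      have h4 : 0 ≤ C * (1 + 16 / κ) * M * r ^ 2 := by positivity
      rw [hC₀]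
      nlinarith
  show |u y| ≤ _
  have : 0 ≤ C₀ * M * r ^ 2 := by positivity
  linarith

end

end DD

/-- **Lemma 2.1** (dyadic decay): there is a constant `C₀ = C₀(n,λ,Λ) > 0` such that for every
`u ∈ P₁⁺(z,M)` with `z ∈ Γ(u) ∩ B(0,1/2)` and every `j ∈ ℕ` with `V_{2^{-j}}(z,u) ≤ C₀` we have
`S_{j+1}(z,u) ≤ max (2⁻² S_j(z,u)) (C₀ M 2^{-2j})`. -/
theorem lemma_dyadic_decay (n : ℕ) [NeZero n] (hn : 2 ≤ n) (lam Lam : ℝ) :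
    ∃ C₀ : ℝ, 0 < C₀ ∧
      ∀ (F : Matrix (Fin n) (Fin n) ℝ → ℝ), EllipticF n lam Lam F →
        ∀ M : ℝ, 0 < M →
          ∀ (z : En n) (u : En n → ℝ) (Ω : Set (En n)), MemPplus F z 1 M u Ω →
            u z = 0 → HasGradientWithinAt u 0 (closure (Bplus n z 1)) z →
            z ∈ frontier Ω → z ∈ ball (0 : En n) (1 / 2) →
            ∀ j : ℕ, Vr u Ω z ((2 : ℝ) ^ (-(j : ℤ))) ≤ C₀ →
              Sdyadic n u z (j + 1) ≤
                max ((2 : ℝ)⁻¹ ^ 2 * Sdyadic n u z j) (C₀ * M * (2 : ℝ) ^ (-(2 * j : ℤ))) := by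
  exact DD.final n hn lam Lam
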